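/- The minimal depth of a sorting network on 11 channels equals 8, and the minimal depth of a sorting network on 12 channels equals 8; that is, for n ∈ {11,12} there exists a sorting network on n channels of depth 8 and none of depth 7. -/

import Mathlib

namespace SN

open scoped Classical

/-- A comparator on `n` channels: a pair of channels. -/
abbrev Comp (n : ℕ) := Fin n × Fin n

/-- A layer is a finite set of comparators. -/
abbrev Layer (n : ℕ) := Finset (Comp n)

/-- A comparator network is a sequence (list) of layers; its depth is the length. -/
abbrev Net (n : ℕ) := List (Layer n)

/-- Each channel is used by at most one comparator of the layer. -/
def NoOverlap {n : ℕ} (L : Layer n) : Prop :=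
  ∀ c ∈ L, ∀ c' ∈ L, c ≠ c' →
    c.1 ≠ c'.1 ∧ c.1 ≠ c'.2 ∧ c.2 ≠ c'.1 ∧ c.2 ≠ c'.2

/-- A (standard) layer: comparators `(i,j)` with `i < j`, channels pairwise disjoint. -/
def IsLayer {n : ℕ} (L : Layer n) : Prop :=
  (∀ c ∈ L, c.1 < c.2) ∧ NoOverlap L

/-- A generalized layer: comparators `(i,j)` with `i ≠ j` allowed in any order. -/
def IsGenLayer {n : ℕ} (L : Layer n) : Prop :=
  (∀ c ∈ L, c.1 ≠ c.2) ∧ NoOverlap L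

def IsNet {n : ℕ} (C : Net n) : Prop := ∀ L ∈ C, IsLayer L

def IsGenNet {n : ℕ} (C : Net n) : Prop := ∀ L ∈ C, IsGenLayer L

/-- Apply one layer to a Boolean vector: a comparator `(i,j)` puts the min
(`&&`) on channel `i` and the max (`||`) on channel `j`. -/
noncomputable def applyLayer {n : ℕ} (L : Layer n) (x : Fin n → Bool) : Fin n → Bool :=
  fun k =>
    if h1 : ∃ c ∈ L, c.1 = k then x h1.choose.1 && x h1.choose.2
    else if h2 : ∃ c ∈ L, c.2 = k then x h2.choose.1 || x h2.choose.2
    else x k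

/-- Run a comparator network on a Boolean input (layers applied in sequence). -/
noncomputable def run {n : ℕ} (C : Net n) (x : Fin n → Bool) : Fin n → Bool :=
  C.foldl (fun y L => applyLayer L y) x

/-- Ascendingly sorted Boolean vector. -/
def BSorted {n : ℕ} (x : Fin n → Bool) : Prop :=
  ∀ i j : Fin n, i ≤ j → x i ≤ x j

/-- A sorting network: a comparator network sorting every Boolean input. -/
def IsSortingNet {n : ℕ} (C : Net n) : Prop :=
  IsNet C ∧ ∀ x : Fin n → Bool, BSorted (run C x)

/-- The set of outputs of a network on all Boolean inputs. -/
def outputs {n : ℕ} (C : Net n) : Set (Fin n → Bool) := Set.range (run C)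

/-- Apply one layer to a vector of naturals. -/
noncomputable def applyLayerN {n : ℕ} (L : Layer n) (x : Fin n → ℕ) : Fin n → ℕ :=
  fun k =>
    if h1 : ∃ c ∈ L, c.1 = k then min (x h1.choose.1) (x h1.choose.2)
    else if h2 : ∃ c ∈ L, c.2 = k then max (x h2.choose.1) (x h2.choose.2)
    else x k

noncomputable def runN {n : ℕ} (C : Net n) (x : Fin n → ℕ) : Fin n → ℕ :=
  C.foldl (fun y L => applyLayerN L y) x

def NSorted {n : ℕ} (x : Fin n → ℕ) : Prop :=
  ∀ i j : Fin n, i ≤ j → x i ≤ x j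

/-- Permute the coordinates of a Boolean vector by `π` (channel `k`'s value
moves to channel `π k`). -/
def permVec {n : ℕ} (π : Equiv.Perm (Fin n)) (x : Fin n → Bool) : Fin n → Bool :=
  fun i => x (π.symm i)

/-- The image of a set of Boolean vectors under coordinate permutation by `π`. -/
def permSet {n : ℕ} (π : Equiv.Perm (Fin n)) (X : Set (Fin n → Bool)) :
    Set (Fin n → Bool) :=
  permVec π '' X

/-- The image `π(L)` of a layer under a permutation of channels. -/
def permLayer {n : ℕ} (π : Equiv.Perm (Fin n)) (L : Layer n) : Layer n :=
  L.image fun c => (π c.1, π c.2)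

/-- Channel `i` is used by some comparator of the layer `L`. -/
def usedIn {n : ℕ} (L : Layer n) (i : Fin n) : Prop := ∃ c ∈ L, c.1 = i ∨ c.2 = i

/-- Channels `i` and `j` are joined by a comparator of `L`. -/
def Joined {n : ℕ} (L : Layer n) (i j : Fin n) : Prop := (i, j) ∈ L ∨ (j, i) ∈ L

/-- `i` is the smaller channel of some comparator of `L` (a min-channel). -/
def MinChan {n : ℕ} (L : Layer n) (i : Fin n) : Prop := ∃ c ∈ L, c.1 = i

/-- `i` is the larger channel of some comparator of `L` (a max-channel). -/
def MaxChan {n : ℕ} (L : Layer n) (i : Fin n) : Prop := ∃ c ∈ L, c.2 = i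

/-- A two-layer network `[L1, L2]` is redundant if some comparator can be removed
so that the outputs of the result are a permutation of the original outputs. -/
def Redundant {n : ℕ} (L1 L2 : Layer n) : Prop :=
  ∃ π : Equiv.Perm (Fin n),
    (∃ c ∈ L1, outputs [L1.erase c, L2] = permSet π (outputs [L1, L2])) ∨
    (∃ c ∈ L2, outputs [L1, L2.erase c] = permSet π (outputs [L1, L2]))

/-- A two-layer network `[L1, L2]` is saturated if it is non-redundant and no
comparator on two channels unused in the second layer can be added to the second
layer so as to make the output set a proper subset of a permutation of the
original output set. -/
def Saturated {n : ℕ} (L1 L2 : Layer n) : Prop :=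
  ¬ Redundant L1 L2 ∧
  ¬ ∃ (c : Comp n) (π : Equiv.Perm (Fin n)),
      c.1 < c.2 ∧ ¬ usedIn L2 c.1 ∧ ¬ usedIn L2 c.2 ∧
      outputs [L1, insert c L2] ⊂ permSet π (outputs [L1, L2])

/-- Vertices of the graph representation of `C`: the comparators of `C`,
tagged with the index of the layer containing them. -/
def Vertex {n : ℕ} (C : Net n) := {p : ℕ × Comp n // p.2 ∈ C.getD p.1 ∅}

/-- The channel carrying the min output (`b = false`, label 1) or max output
(`b = true`, label 2) of a comparator. -/
def outChan {n : ℕ} (c : Comp n) (b : Bool) : Fin n := if b then c.2 else c.1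

/-- An edge with label `b` (1 for min, 2 for max) from comparator `u` to
comparator `v`: the corresponding output of `u` is an input of `v`, i.e. `v`
is the next comparator on that channel. -/
def Edge {n : ℕ} (C : Net n) (b : Bool) (u v : ℕ × Comp n) : Prop :=
  u.1 < v.1 ∧ (outChan u.2 b = v.2.1 ∨ outChan u.2 b = v.2.2) ∧
  ∀ m, u.1 < m → m < v.1 → ¬ usedIn (C.getD m ∅) (outChan u.2 b)

/-- The graph representations of `C` and `D` are isomorphic: a bijection of
comparators preserving the labeled edges. -/
def GraphIso {n m : ℕ} (C : Net n) (D : Net m) : Prop :=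
  ∃ f : Vertex C ≃ Vertex D,
    ∀ (b : Bool) (u v : Vertex C),
      Edge C b u.val v.val ↔ Edge D b (f u).val (f v).val

/-- The graph representation of `C` is connected. -/
def GraphConnected {n : ℕ} (C : Net n) : Prop :=
  ∀ u v : Vertex C,
    Relation.ReflTransGen
      (fun a b : Vertex C => ∃ ℓ : Bool, Edge C ℓ a.val b.val ∨ Edge C ℓ b.val a.val) u v

/-- Reflection of a comparator: `(i,j) ↦ (n-j+1, n-i+1)` (in 1-based terms). -/
def reflectComp {n : ℕ} (c : Comp n) : Comp n := (c.2.rev, c.1.rev)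

def reflectLayer {n : ℕ} (L : Layer n) : Layer n := L.image reflectComp

/-- Reflection `C^R` of a comparator network. -/
def reflect {n : ℕ} (C : Net n) : Net n := C.map reflectLayer

/-- The first layer `F_n = {(2i-1, 2i) : 1 ≤ i ≤ ⌊n/2⌋}` (0-indexed: `(2i, 2i+1)`). -/
def FLayer (n : ℕ) : Layer n :=
  Finset.univ.filter fun c : Comp n => c.1.val % 2 = 0 ∧ c.2.val = c.1.val + 1

/-- The two-layer networks with first layer `F_n`, parametrized by second layer. -/
def SecondLayers (n : ℕ) := {L : Layer n // IsLayer L}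

/-- The number `|R(G_n)|` of equivalence classes of two-layer networks with
first layer `F_n`, under graph isomorphism `≈`. -/
noncomputable def numClasses (n : ℕ) : ℕ :=
  Nat.card (Quot fun L L' : SecondLayers n =>
    GraphIso ([FLayer n, L.val] : Net n) ([FLayer n, L'.val] : Net n))

/-- Redundant two-layer networks with first layer `F_n`. -/
def RedLayers (n : ℕ) := {L : Layer n // IsLayer L ∧ Redundant (FLayer n) L}

/-- The number of equivalence classes of redundant two-layer networks with
first layer `F_n`, under graph isomorphism `≈`. -/
noncomputable def numRedClasses (n : ℕ) : ℕ :=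
  Nat.card (Quot fun L L' : RedLayers n =>
    GraphIso ([FLayer n, L.val] : Net n) ([FLayer n, L'.val] : Net n))

section Sortable

variable {n : ℕ}

/-- The action of the layer whose comparators join `k` with `m k`, for an involution `m`
(fixed points of `m` are unused channels). -/
def ap (m : Fin n → Fin n) (x : Fin n → Bool) : Fin n → Bool :=
  fun k => bif decide (k < m k) then x k && x (m k) else x k || x (m k)

/-- The layer whose comparators join `k` with `m k`. -/
def layerOf (m : Fin n → Fin n) : Layer n :=
  Finset.univ.filter fun c : Comp n => c.1 < c.2 ∧ m c.1 = c.2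

theorem isLayer_layerOf {m : Fin n → Fin n} (hm : m.Involutive) : IsLayer (layerOf m) := by
  refine ⟨fun c hc => by simp [layerOf] at hc; exact hc.1, ?_⟩
  rintro ⟨a, b⟩ hc ⟨a', b'⟩ hc' hne
  simp only [layerOf, Finset.mem_filter, Finset.mem_univ, true_and] at hc hc'
  obtain ⟨h1, rfl⟩ := hc
  obtain ⟨h2, rfl⟩ := hc'
  have key : a ≠ a' := fun h => hne (by rw [h])
  refine ⟨key, fun h => ?_, fun h => ?_, fun h => key (hm.injective h)⟩
  · subst h
    rw [hm] at h1
    exact lt_asymm h1 h2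
  · subst h
    rw [hm] at h2
    exact lt_asymm h1 h2

theorem applyLayer_layerOf {m : Fin n → Fin n} (hm : m.Involutive) (x : Fin n → Bool) :
    applyLayer (layerOf m) x = ap m x := by
  have mem (c : Comp n) : c ∈ layerOf m ↔ c.1 < c.2 ∧ m c.1 = c.2 := by simp [layerOf]
  funext k
  unfold applyLayer ap
  split_ifs with h1 h2
  · obtain ⟨hc, hk⟩ := h1.choose_spec
    obtain ⟨hlt, he⟩ := (mem _).1 hc
    rw [← he, hk] at hlt
    simp [hlt, ← he, hk]
  · obtain ⟨hc, hk⟩ := h2.choose_spec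
    obtain ⟨hlt, he⟩ := (mem _).1 hc
    have he' : m k = h2.choose.1 := (congrArg m (he.trans hk)).symm.trans (hm _)
    rw [hk, ← he'] at hlt
    simp [not_lt.2 hlt.le, hk, ← he', Bool.or_comm]
  · have hlt : ¬ k < m k := fun h => h1 ⟨(k, m k), (mem _).2 ⟨h, rfl⟩, rfl⟩
    have hgt : ¬ m k < k := fun h => h2 ⟨(m k, k), (mem _).2 ⟨h, hm k⟩, rfl⟩
    have he : m k = k := le_antisymm (not_lt.1 hlt) (not_lt.1 hgt)
    simp [he]

theorem exists_layerOf {L : Layer n} (hL : IsLayer L) :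
    ∃ m : Fin n → Fin n, m.Involutive ∧ L = layerOf m := by
  obtain ⟨hlt, hno⟩ := hL
  have uniq {i j k : Fin n} (h : (i, j) ∈ L ∨ (j, i) ∈ L) (h' : (i, k) ∈ L ∨ (k, i) ∈ L) :
      j = k := by
    by_contra hne
    rcases h with h | h <;> rcases h' with h' | h'
    · exact (hno _ h _ h' (by simp [hne])).1 rfl
    · by_cases he : ((i, j) : Comp n) = (k, i)
      · simp only [Prod.mk.injEq] at he
        exact hne (he.2.trans he.1)
      · exact (hno _ h _ h' he).2.1 rfl
    · by_cases he : ((j, i) : Comp n) = (i, k)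
      · simp only [Prod.mk.injEq] at he
        exact hne (he.1.trans he.2)
      · exact (hno _ h _ h' he).2.2.1 rfl
    · exact (hno _ h _ h' (by simp [hne])).2.2.2 rfl
  let m : Fin n → Fin n := fun k => if h : ∃ j, (k, j) ∈ L ∨ (j, k) ∈ L then h.choose else k
  have hm {k j : Fin n} (h : (k, j) ∈ L ∨ (j, k) ∈ L) : m k = j := by
    have hex : ∃ j, (k, j) ∈ L ∨ (j, k) ∈ L := ⟨j, h⟩
    simp only [m, dif_pos hex]
    exact uniq hex.choose_spec h
  refine ⟨m, fun k => ?_, ?_⟩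
  · by_cases hex : ∃ j, (k, j) ∈ L ∨ (j, k) ∈ L
    · obtain ⟨j, hj⟩ := hex
      rw [hm hj, hm hj.symm]
    · have : m k = k := by simp only [m, dif_neg hex]
      rw [this, this]
  · ext ⟨a, b⟩
    simp only [layerOf, Finset.mem_filter, Finset.mem_univ, true_and]
    refine ⟨fun h => ⟨hlt _ h, hm (Or.inl h)⟩, fun ⟨h, he⟩ => ?_⟩
    by_cases hex : ∃ j, (a, j) ∈ L ∨ (j, a) ∈ L
    · obtain ⟨j, hj⟩ := hex
      obtain rfl : j = b := (hm hj).symm.trans he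
      rcases hj with hj | hj
      · exact hj
      · exact absurd (hlt _ hj) (lt_asymm h)
    · simp only [m, dif_neg hex] at he
      exact absurd he h.ne

/-- The number of ones. -/
def wt (x : Fin n → Bool) : ℕ := ∑ k, (x k).toNat

theorem wt_ap {m : Fin n → Fin n} (hm : m.Involutive) (x : Fin n → Bool) :
    wt (ap m x) = wt x := by
  have sym (f : Fin n → ℕ) : ∑ k, f (m k) = ∑ k, f k := Equiv.sum_comp hm.toPerm f
  have key : ∑ k, ((ap m x k).toNat + (ap m x (m k)).toNat) =
      ∑ k, ((x k).toNat + (x (m k)).toNat) := by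
    refine Finset.sum_congr rfl fun k _ => ?_
    simp only [ap, hm k]
    rcases lt_trichotomy k (m k) with h | h | h
    · cases hx : x k <;> cases hy : x (m k) <;> simp [h, h.not_gt]
    · simp [← h]
    · cases hx : x k <;> cases hy : x (m k) <;> simp [h, h.not_gt]
  simp only [Finset.sum_add_distrib] at key
  rw [sym fun k => (ap m x k).toNat, sym fun k => (x k).toNat] at key
  unfold wt
  omega

theorem wt_comp (π : Equiv.Perm (Fin n)) (x : Fin n → Bool) : wt (x ∘ π) = wt x :=
  Equiv.sum_comp π fun k => (x k).toNat

theorem eq_of_le_of_wt_eq {x y : Fin n → Bool} (h : ∀ k, x k ≤ y k) (hw : wt x = wt y) :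
    x = y := by
  have hle : ∀ k ∈ Finset.univ, (x k).toNat ≤ (y k).toNat := fun k _ => by
    have := Bool.le_iff_imp.1 (h k)
    cases hx : x k <;> cases hy : y k <;> simp_all
  have := (Finset.sum_eq_sum_iff_of_le hle).1 hw
  funext k
  have := this k (Finset.mem_univ k)
  cases hx : x k <;> cases hy : y k <;> simp_all

theorem BSorted.eq_of_wt_eq {x y : Fin n → Bool} (hx : BSorted x) (hy : BSorted y)
    (hw : wt x = wt y) : x = y := by
  by_cases h : ∀ k, x k ≤ y k
  · exact eq_of_le_of_wt_eq h hw
  · obtain ⟨k, hk⟩ := not_forall.1 h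
    rw [Bool.le_iff_imp] at hk
    refine (eq_of_le_of_wt_eq (fun j => ?_) hw.symm).symm
    rcases le_total j k with hj | hj
    · have := Bool.le_iff_imp.1 (hy j k hj)
      cases hyj : y j <;> cases hyk : y k <;> cases hxk : x k <;> simp_all
    · have := Bool.le_iff_imp.1 (hx k j hj)
      cases hxj : x j <;> cases hyk : y k <;> cases hxk : x k <;> simp_all

theorem BSorted.ap_eq {x : Fin n → Bool} (hx : BSorted x) (m : Fin n → Fin n) :
    ap m x = x := by
  funext k
  unfold ap
  by_cases h : k < m k
  · have := Bool.le_iff_imp.1 (hx k (m k) h.le)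
    cases h1 : x k <;> cases h2 : x (m k) <;> simp_all
  · have := Bool.le_iff_imp.1 (hx (m k) k (not_lt.1 h))
    cases h1 : x k <;> cases h2 : x (m k) <;> simp_all

/-- Some `k` layers map any two vectors of `X` with equally many ones to the same vector. -/
def Sortable : ℕ → Set (Fin n → Bool) → Prop
  | 0, X => ∀ x ∈ X, ∀ y ∈ X, wt x = wt y → x = y
  | k + 1, X => ∃ m : Fin n → Fin n, m.Involutive ∧ Sortable k (ap m '' X)

theorem Sortable.mono {k : ℕ} {X Y : Set (Fin n → Bool)} (h : Sortable k X) (hY : Y ⊆ X) :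
    Sortable k Y := by
  induction k generalizing X Y with
  | zero => exact fun x hx y hy => h x (hY hx) y (hY hy)
  | succ k ih =>
    obtain ⟨m, hm, h⟩ := h
    exact ⟨m, hm, ih h (Set.image_mono hY)⟩

theorem sortable_of_bSorted_run {C : Net n} (hC : IsNet C) {X : Set (Fin n → Bool)}
    (h : ∀ x ∈ X, BSorted (run C x)) : Sortable C.length X := by
  induction C generalizing X with
  | nil => exact fun x hx y hy hw => (h x hx).eq_of_wt_eq (h y hy) hw
  | cons L C ih =>
    obtain ⟨m, hm, rfl⟩ := exists_layerOf (hC L (by simp))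
    refine ⟨m, hm, ih (fun L hL => hC L (by simp [hL])) ?_⟩
    rintro _ ⟨x, hx, rfl⟩
    rw [← applyLayer_layerOf hm]
    exact h x hx

/-- Relabelling the channels of a layer by `π` permutes its outputs. -/
theorem exists_perm_ap_comp {m : Fin n → Fin n} (hm : m.Involutive) (π : Equiv.Perm (Fin n)) :
    ∃ τ : Equiv.Perm (Fin n), ∀ x, ap (π.symm ∘ m ∘ π) (x ∘ π) = ap m x ∘ τ := by
  set m' := π.symm ∘ m ∘ π with hm'
  have hπ (k : Fin n) : π (m' k) = m (π k) := by simp [hm']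
  have hinv (k : Fin n) : m' (m' k) = k := π.injective (by rw [hπ, hπ, hm])
  let t : Fin n → Fin n := fun k => if (k < m' k ↔ π k < m (π k)) then π k else π (m' k)
  have ht (k : Fin n) : t k = if (k < m' k ↔ π k < m (π k)) then π k else π (m' k) := rfl
  have hinj : Function.Injective t := by
    intro k l hkl
    by_contra hne
    have hml : m' k = l := by
      have hne' : m' k ≠ m' l := fun h => hne (by rw [← hinv k, h, hinv])
      simp only [ht] at hkl
      split_ifs at hkl
      · exact absurd (π.injective hkl) hne
      · rw [π.injective hkl, hinv]
      · exact π.injective hkl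
      · exact absurd (π.injective hkl) hne'
    subst hml
    have hπne : π k ≠ π (m' k) := fun h => hne (π.injective h)
    have hs : (m' k < m' (m' k) ↔ π (m' k) < m (π (m' k))) ↔ (k < m' k ↔ π k < m (π k)) := by
      rw [hinv, ← hπ (m' k), hinv, ← hπ k]
      rcases lt_or_gt_of_ne hne with h1 | h1 <;> rcases lt_or_gt_of_ne hπne with h2 | h2 <;>
        simp [h1, h2, h1.not_gt, h2.not_gt]
    rw [ht, ht, if_congr hs rfl rfl, hinv] at hkl
    split_ifs at hkl
    · exact hπne hkl
    · exact hπne hkl.symm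
  refine ⟨Equiv.ofBijective t (Finite.injective_iff_bijective.1 hinj), fun x => ?_⟩
  funext k
  simp only [Function.comp_apply, Equiv.ofBijective_apply]
  unfold ap
  simp only [Function.comp_apply, ht, hπ]
  by_cases h1 : k < m' k <;> by_cases h2 : π k < m (π k)
  · simp [h1, h2]
  · have h3 : m (π k) ≠ π k := by
      rw [← hπ]
      exact fun h => h1.ne' (π.injective h)
    have h4 : m (π k) < π k := lt_of_le_of_ne (not_lt.1 h2) h3
    simp [h1, h2, hm (π k), h4, Bool.and_comm]
  · simp [h1, h2, hm (π k), h2.not_gt, Bool.or_comm]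
  · simp [h1, h2]

theorem Sortable.image_comp {k : ℕ} {X : Set (Fin n → Bool)} (h : Sortable k X)
    (π : Equiv.Perm (Fin n)) : Sortable k ((· ∘ π) '' X) := by
  induction k generalizing X π with
  | zero =>
    rintro _ ⟨x, hx, rfl⟩ _ ⟨y, hy, rfl⟩ hw
    simp only [wt_comp] at hw
    rw [h x hx y hy hw]
  | succ k ih =>
    obtain ⟨m, hm, h⟩ := h
    obtain ⟨τ, hτ⟩ := exists_perm_ap_comp hm π
    refine ⟨π.symm ∘ m ∘ π, fun k => by simp [hm (π k)], (ih h τ).mono ?_⟩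
    rintro _ ⟨_, ⟨x, hx, rfl⟩, rfl⟩
    exact ⟨ap m x, ⟨x, hx, rfl⟩, (hτ x).symm⟩

/-- Conjugating the first layer by a permutation that preserves the set of inputs. -/
theorem Sortable.image_ap_conj {k : ℕ} {X : Set (Fin n → Bool)} {m : Fin n → Fin n}
    (hm : m.Involutive) (h : Sortable k (ap m '' X)) (π : Equiv.Perm (Fin n))
    (hX : ∀ x ∈ X, x ∘ π.symm ∈ X) : Sortable k (ap (π.symm ∘ m ∘ π) '' X) := by
  obtain ⟨τ, hτ⟩ := exists_perm_ap_comp hm π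
  refine (h.image_comp τ).mono ?_
  rintro _ ⟨x, hx, rfl⟩
  refine ⟨_, ⟨_, hX x hx, rfl⟩, ?_⟩
  change ap m (x ∘ π.symm) ∘ τ = _
  rw [← hτ, Function.comp_assoc]
  simp

/-- Reverse the order of the channels and negate. -/
def refl (x : Fin n → Bool) : Fin n → Bool := fun k => !x k.rev

theorem refl_refl (x : Fin n → Bool) : refl (refl x) = x := by
  funext k
  simp [refl]

theorem wt_refl (x : Fin n → Bool) : wt (refl x) + wt x = n := by
  have h : wt x = ∑ k : Fin n, (x k.rev).toNat :=
    (Equiv.sum_comp Fin.revPerm fun k => (x k).toNat).symm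
  have h1 (k : Fin n) : (!x k.rev).toNat + (x k.rev).toNat = 1 := by cases x k.rev <;> rfl
  rw [h]
  unfold wt refl
  rw [← Finset.sum_add_distrib]
  simp [h1]

theorem ap_refl {m : Fin n → Fin n} (x : Fin n → Bool) :
    ap (fun k => (m k.rev).rev) (refl x) = refl (ap m x) := by
  funext k
  have hk : k < (m k.rev).rev ↔ m k.rev < k.rev := by rw [← Fin.rev_lt_rev, Fin.rev_rev]
  simp only [ap, refl, hk, Fin.rev_rev]
  rcases lt_trichotomy k.rev (m k.rev) with h | h | h
  · simp [h, h.not_gt]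
  · simp [← h]
  · simp [h, h.not_gt]

theorem Sortable.image_refl {k : ℕ} {X : Set (Fin n → Bool)} (h : Sortable k X) :
    Sortable k (refl '' X) := by
  induction k generalizing X with
  | zero =>
    rintro _ ⟨x, hx, rfl⟩ _ ⟨y, hy, rfl⟩ hw
    have := wt_refl x
    have := wt_refl y
    rw [h x hx y hy (by omega)]
  | succ k ih =>
    obtain ⟨m, hm, h⟩ := h
    refine ⟨fun k => (m k.rev).rev, fun k => by simp [hm k.rev], (ih h).mono ?_⟩
    rintro _ ⟨_, ⟨x, hx, rfl⟩, rfl⟩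
    exact ⟨ap m x, ⟨x, hx, rfl⟩, (ap_refl x).symm⟩

/-- If `X` contains sorted vectors, then the layers send the vectors of `X` there. -/
theorem Sortable.exists_layers {k : ℕ} {X : Set (Fin n → Bool)} (h : Sortable k X) :
    ∃ ms : List (Fin n → Fin n), ms.length = k ∧ (∀ m ∈ ms, m.Involutive) ∧
      ∀ x ∈ X, ∀ s ∈ X, BSorted s → wt x = wt s → ms.foldl (fun y m => ap m y) x = s := by
  induction k generalizing X with
  | zero => exact ⟨[], rfl, by simp, fun x hx s hs _ hw => h x hx s hs hw⟩
  | succ k ih =>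
    obtain ⟨m, hm, h⟩ := h
    obtain ⟨ms, hlen, hinv, hms⟩ := ih h
    refine ⟨m :: ms, by simp [hlen], by simpa [hm] using hinv, fun x hx s hs hsort hw => ?_⟩
    exact hms _ ⟨x, hx, rfl⟩ s ⟨s, hs, hsort.ap_eq m⟩ hsort (by rw [wt_ap hm, hw])

end Sortable

section DropChannel

variable {n : ℕ}

theorem Sortable.of_image_snoc {k : ℕ} {X : Set (Fin n → Bool)}
    (h : Sortable k ((fun x => (Fin.snoc x true : Fin (n + 1) → Bool)) '' X)) :
    Sortable k X := by
  induction k generalizing X with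
  | zero =>
    intro x hx y hy hw
    have := h _ ⟨x, hx, rfl⟩ _ ⟨y, hy, rfl⟩ (by simp [wt, Fin.sum_univ_castSucc] at hw ⊢; exact hw)
    exact (Fin.snoc_inj.1 this).1
  | succ k ih =>
    obtain ⟨m, hm, h⟩ := h
    let m' : Fin n → Fin n := fun i =>
      if h : m i.castSucc = Fin.last n then i else (m i.castSucc).castPred h
    have hcast (i : Fin n) (hi : m i.castSucc ≠ Fin.last n) :
        (m' i).castSucc = m i.castSucc := by simp [m', hi]
    have hself (i : Fin n) (hi : m i.castSucc = Fin.last n) : m' i = i := by simp [m', hi]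
    have hinv : m'.Involutive := by
      intro i
      by_cases hi : m i.castSucc = Fin.last n
      · rw [hself i hi, hself i hi]
      · have h1 : m (m' i).castSucc = i.castSucc := by rw [hcast i hi, hm]
        have h2 : m (m' i).castSucc ≠ Fin.last n := by
          rw [h1]
          exact Fin.castSucc_ne_last i
        exact Fin.castSucc_injective n (by rw [hcast _ h2, h1])
    refine ⟨m', hinv, ih (h.mono ?_)⟩
    rintro _ ⟨_, ⟨x, hx, rfl⟩, rfl⟩
    refine ⟨_, ⟨x, hx, rfl⟩, ?_⟩
    funext i
    refine Fin.lastCases ?_ (fun i => ?_) i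
    · simp [ap, Fin.not_lt.2 (Fin.le_last _)]
    · by_cases hi : m i.castSucc = Fin.last n
      · simp [ap, hi, hself i hi, Fin.castSucc_lt_last]
      · simp only [ap, ← hcast i hi, Fin.snoc_castSucc, Fin.castSucc_lt_castSucc_iff]

end DropChannel

section FirstLayer

/-- The layer joining channels `2i` and `2i+1`. -/
def mate : Fin 11 → Fin 11 := ![1, 0, 3, 2, 5, 4, 7, 6, 9, 8, 10]

/-- The outputs of the layer `mate`. -/
def pairSorted : Set (Fin 11 → Bool) := {x | ∀ k, k < mate k → x k ≤ x (mate k)}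

/-- The first `c` comparators of `mate`. -/
def mateBelow (c : ℕ) (k : Fin 11) : Fin 11 := if k.val < 2 * c then mate k else k

theorem mate_involutive : mate.Involutive := by
  unfold Function.Involutive
  decide

theorem mateBelow_involutive : ∀ c < 6, ∀ k, mateBelow c (mateBelow c k) = k := by
  unfold mateBelow
  decide

theorem ap_mateBelow (c : ℕ) {x : Fin 11 → Bool} (hx : x ∈ pairSorted) :
    ap (mateBelow c) x = x := by
  funext k
  unfold ap mateBelow
  split_ifs with h
  · rcases lt_trichotomy k (mate k) with h | h | h
    · have := Bool.le_iff_imp.1 (hx k h)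
      cases h1 : x k <;> cases h2 : x (mate k) <;> simp_all
    · simp [← h]
    · have h' := hx (mate k)
      rw [mate_involutive] at h'
      have := Bool.le_iff_imp.1 (h' h)
      cases h1 : x k <;> cases h2 : x (mate k) <;> simp_all [h.not_gt]
  · simp

theorem cycleType_eq_of_involutive {α : Type*} [Fintype α] [DecidableEq α]
    {σ : Equiv.Perm α} (hσ : ∀ k, σ (σ k) = k) :
    ∃ c, σ.cycleType = Multiset.replicate c 2 ∧ σ.support.card = c * 2 := by
  have h : σ.cycleType = Multiset.replicate σ.cycleType.card 2 := by
    refine Multiset.eq_replicate_card.2 fun b hb => ?_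
    have h2 : orderOf σ ∣ 2 := orderOf_dvd_of_pow_eq_one (by ext k; simp [pow_two, hσ])
    exact le_antisymm (Nat.le_of_dvd two_pos ((Equiv.Perm.dvd_of_mem_cycleType hb).trans h2))
      (Equiv.Perm.two_le_of_mem_cycleType hb)
  refine ⟨_, h, ?_⟩
  rw [← Equiv.Perm.sum_cycleType, h]
  simp

theorem exists_conj_mateBelow {m : Fin 11 → Fin 11} (hm : m.Involutive) :
    ∃ c, ∃ π : Equiv.Perm (Fin 11), π.symm ∘ m ∘ π = mateBelow c := by
  obtain ⟨c, hc, hcard⟩ := cycleType_eq_of_involutive (σ := hm.toPerm) hm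
  have hc6 : c < 6 := by
    have := Finset.card_le_univ hm.toPerm.support
    rw [Fintype.card_fin] at this
    omega
  have hinv : (mateBelow c).Involutive := mateBelow_involutive c hc6
  obtain ⟨c', hc', hcard'⟩ := cycleType_eq_of_involutive (σ := hinv.toPerm) hinv
  have hsupp : hinv.toPerm.support.card = c * 2 := by
    have h : hinv.toPerm.support = Finset.univ.filter fun k : Fin 11 => k.val < 2 * c := by
      ext k
      have : ∀ k : Fin 11, k.val < 10 → mate k ≠ k := by decide
      simp only [Equiv.Perm.mem_support, Function.Involutive.coe_toPerm, mateBelow,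
        Finset.mem_filter, Finset.mem_univ, true_and]
      split_ifs with hk
      · simp [hk, this k (by omega)]
      · simp [hk]
    rw [h]
    have : ∀ c < 6, (Finset.univ.filter fun k : Fin 11 => k.val < 2 * c).card = c * 2 := by decide
    exact this c hc6
  obtain rfl : c' = c := by omega
  obtain ⟨π, hπ⟩ := isConj_iff.1 ((Equiv.Perm.isConj_iff_cycleType_eq).2 (hc.trans hc'.symm))
  refine ⟨c', π.symm, funext fun k => ?_⟩
  have := congrArg (fun σ : Equiv.Perm (Fin 11) => σ k) hπ
  exact this

theorem Sortable.pairSorted {k : ℕ} (h : Sortable (k + 1) (Set.univ : Set (Fin 11 → Bool))) :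
    Sortable k pairSorted := by
  obtain ⟨m, hm, h⟩ := h
  obtain ⟨c, π, hπ⟩ := exists_conj_mateBelow hm
  have h' := h.image_ap_conj hm π (fun _ _ => Set.mem_univ _)
  rw [hπ] at h'
  exact h'.mono fun x hx => ⟨x, Set.mem_univ _, ap_mateBelow c hx⟩

end FirstLayer

section UpperBound

variable {n : ℕ}

/-- `ap` on a batch of vectors: bit `v` of `X k` is the value of the `v`-th vector on channel `k`. -/
def apBatch (m : Fin n → Fin n) (X : Fin n → ℕ) : Fin n → ℕ :=
  fun k => bif decide (k < m k) then Nat.land (X k) (X (m k)) else Nat.lor (X k) (X (m k))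

theorem testBit_apBatch (m : Fin n → Fin n) (X : Fin n → ℕ) (v : ℕ) (k : Fin n) :
    (apBatch m X k).testBit v = ap m (fun i => (X i).testBit v) k := by
  unfold apBatch ap
  cases decide (k < m k)
  · exact Nat.testBit_or _ _ _
  · exact Nat.testBit_and _ _ _

theorem testBit_foldl_apBatch (ms : List (Fin n → Fin n)) (X : Fin n → ℕ) (v : ℕ) (k : Fin n) :
    (ms.foldl (fun Y m => apBatch m Y) X k).testBit v =
      ms.foldl (fun y m => ap m y) (fun i => (X i).testBit v) k := by
  induction ms generalizing X with
  | nil => rfl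
  | cons m ms ih =>
    rw [List.foldl_cons, List.foldl_cons, ih]
    exact congrArg (fun y => ms.foldl (fun y m => ap m y) y k)
      (funext fun i => testBit_apBatch m X v i)

theorem run_map_layerOf {ms : List (Fin n → Fin n)} (hinv : ∀ m ∈ ms, ∀ k, m (m k) = k)
    (x : Fin n → Bool) : run (ms.map layerOf) x = ms.foldl (fun y m => ap m y) x := by
  unfold run
  induction ms generalizing x with
  | nil => rfl
  | cons m ms ih =>
    rw [List.map_cons, List.foldl_cons, List.foldl_cons, applyLayer_layerOf (hinv m (by simp))]
    exact ih (fun m hm => hinv m (by simp [hm])) _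

/-- The truth table of the `k`-th of `n` variables. -/
def truthTable : ℕ → ℕ → ℕ
  | 0, _ => 0
  | n + 1, k => bif Nat.beq k n then Nat.shiftLeft (2 ^ 2 ^ n - 1) (2 ^ n)
      else Nat.lor (truthTable n k) (Nat.shiftLeft (truthTable n k) (2 ^ n))

theorem testBit_truthTable {n k v : ℕ} (hk : k < n) (hv : v < 2 ^ n) :
    (truthTable n k).testBit v = v.testBit k := by
  have hbound (n k : ℕ) : truthTable n k < 2 ^ 2 ^ n := by
    induction n with
    | zero => simp [truthTable]
    | succ n ih =>
      have h2 : 2 ^ n + 2 ^ n = 2 ^ (n + 1) := by rw [pow_succ, mul_two]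
      have hpos := Nat.two_pow_pos n
      unfold truthTable
      cases Nat.beq k n
      · exact Nat.or_lt_two_pow (ih.trans (Nat.pow_lt_pow_right (by norm_num) (by omega)))
          (by rw [← h2, pow_add]
              exact (Nat.shiftLeft_eq _ _).trans_lt (Nat.mul_lt_mul_of_pos_right ih (by positivity)))
      · have : 2 ^ 2 ^ n - 1 < 2 ^ 2 ^ n := Nat.sub_lt (by positivity) one_pos
        rw [← h2, pow_add]
        exact (Nat.shiftLeft_eq _ _).trans_lt (Nat.mul_lt_mul_of_pos_right this (by positivity))
  induction n generalizing v with
  | zero => omega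
  | succ n ih =>
    have hor (a b : ℕ) : Nat.lor a b = a ||| b := rfl
    have hshift (a b : ℕ) : Nat.shiftLeft a b = a <<< b := rfl
    have hbeq : Nat.beq k n = decide (k = n) := by
      rw [Bool.eq_iff_iff, Nat.beq_eq, decide_eq_true_iff]
    rw [pow_succ] at hv
    simp only [truthTable, hor, hshift, hbeq]
    rcases lt_or_ge v (2 ^ n) with hlt | hge
    · by_cases hkn : k = n
      · subst hkn
        simp [Nat.testBit_shiftLeft, hlt.not_ge, Nat.testBit_lt_two_pow hlt]
      · simp [hkn, Nat.testBit_shiftLeft, hlt.not_ge, ih (by omega) hlt]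
    · obtain ⟨w, rfl⟩ := Nat.exists_eq_add_of_le hge
      have hw : w < 2 ^ n := by omega
      by_cases hkn : k = n
      · subst hkn
        simp [Nat.testBit_shiftLeft, Nat.testBit_two_pow_sub_one, hw,
          Nat.testBit_two_pow_add_eq, Nat.testBit_lt_two_pow hw]
      · have hk' : k < n := by omega
        have hz : (truthTable n k).testBit (2 ^ n + w) = false :=
          Nat.testBit_lt_two_pow ((hbound n k).trans_le (Nat.pow_le_pow_right two_pos (by omega)))
        simp [hkn, Nat.testBit_shiftLeft, hz, Nat.testBit_two_pow_add_gt hk', ih hk' hw]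

theorem exists_sortingNet (ms : List (Fin n → Fin n)) (hinv : ms.all fun m => decide (∀ k, m (m k) = k))
    (hsort : ∀ i j : Fin n, i.val + 1 = j.val →
      Nat.land (ms.foldl (fun Y m => apBatch m Y) (fun k => truthTable n k.val) i)
        (ms.foldl (fun Y m => apBatch m Y) (fun k => truthTable n k.val) j) =
      ms.foldl (fun Y m => apBatch m Y) (fun k => truthTable n k.val) i) :
    ∃ C : Net n, C.length = ms.length ∧ IsSortingNet C := by
  replace hinv : ∀ m ∈ ms, ∀ k, m (m k) = k := by simpa using hinv
  refine ⟨ms.map layerOf, by simp, ?_, fun x => ?_⟩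
  · intro L hL
    obtain ⟨m, hm, rfl⟩ := List.mem_map.1 hL
    exact isLayer_layerOf (hinv m hm)
  · rw [run_map_layerOf hinv]
    have hx : x = fun k : Fin n => (truthTable n k.val).testBit (Nat.ofBits x) := by
      funext k
      rw [testBit_truthTable k.isLt (Nat.ofBits_lt_two_pow x), Nat.testBit_ofBits_lt x k k.isLt]
    have hstep (i j : Fin n) (hij : i.val + 1 = j.val) :
        ms.foldl (fun y m => ap m y) x i ≤ ms.foldl (fun y m => ap m y) x j := by
      have h := congrArg (fun z => Nat.testBit z (Nat.ofBits x)) (hsort i j hij)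
      simp only [show ∀ a b, Nat.land a b = a &&& b from fun _ _ => rfl, Nat.testBit_and,
        testBit_foldl_apBatch, ← hx] at h
      rw [Bool.le_iff_imp]
      intro hi
      simpa [hi] using h
    intro i j hij
    obtain ⟨d, hd⟩ := Nat.exists_eq_add_of_le (Fin.le_def.1 hij)
    induction d generalizing j with
    | zero => exact le_of_eq (congrArg _ (Fin.ext (by omega)))
    | succ d ih =>
      have hlt : i.val + d < n := by omega
      exact (ih ⟨i.val + d, hlt⟩ (Fin.le_def.2 (by simp)) rfl).trans
        (hstep _ j (by simp only; omega))

theorem exists_sortingNet_twelve : ∃ C : Net 12, C.length = 8 ∧ IsSortingNet C :=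
  exists_sortingNet
    [![8, 7, 6, 11, 10, 9, 2, 1, 0, 5, 4, 3], ![2, 4, 0, 5, 1, 3, 8, 10, 6, 11, 7, 9],
      ![1, 0, 9, 3, 7, 6, 5, 4, 8, 2, 11, 10], ![0, 3, 7, 1, 9, 5, 6, 2, 10, 4, 8, 11],
      ![1, 0, 3, 2, 5, 4, 7, 6, 9, 8, 11, 10], ![0, 2, 1, 5, 4, 3, 8, 7, 6, 10, 9, 11],
      ![0, 1, 4, 6, 2, 8, 3, 9, 5, 7, 10, 11], ![0, 2, 1, 4, 3, 6, 5, 8, 7, 10, 9, 11]]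
    (by decide +kernel) (by decide +kernel)

theorem exists_sortingNet_eleven : ∃ C : Net 11, C.length = 8 ∧ IsSortingNet C :=
  exists_sortingNet
    [![8, 7, 6, 3, 10, 9, 2, 1, 0, 5, 4], ![2, 4, 0, 5, 1, 3, 8, 10, 6, 9, 7],
      ![1, 0, 9, 3, 7, 6, 5, 4, 8, 2, 10], ![0, 3, 7, 1, 9, 5, 6, 2, 10, 4, 8],
      ![1, 0, 3, 2, 5, 4, 7, 6, 9, 8, 10], ![0, 2, 1, 5, 4, 3, 8, 7, 6, 10, 9],
      ![0, 1, 4, 6, 2, 8, 3, 9, 5, 7, 10], ![0, 2, 1, 4, 3, 6, 5, 8, 7, 10, 9]]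
    (by decide +kernel) (by decide +kernel)

end UpperBound

section Bits

def spreadUp (x a : ℕ) : ℕ := Nat.lor x (Nat.shiftLeft x a)
def spreadDown (x a : ℕ) : ℕ := Nat.lor x (Nat.shiftRight x a)

/-- The union of the shifts of `x` upwards by `0, a, …, 10 * a`. -/
def up11 (x a : ℕ) : ℕ :=
  spreadUp (spreadUp (spreadUp (spreadUp x a) (Nat.mul 2 a)) (Nat.mul 4 a)) (Nat.mul 3 a)

/-- The union of the shifts of `x` downwards by `0, a, …, 10 * a`. -/
def down11 (x a : ℕ) : ℕ :=
  spreadDown (spreadDown (spreadDown (spreadDown x a) (Nat.mul 2 a)) (Nat.mul 4 a)) (Nat.mul 3 a)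

def ones (n : ℕ) : ℕ := Nat.sub (Nat.shiftLeft 1 n) 1
def andNot (a b : ℕ) : ℕ := Nat.xor a (Nat.land a b)

/-- Concatenation of the 256-bit fields `f 0, …, f (n - 1)`. -/
def fields : ℕ → (ℕ → ℕ) → ℕ
  | 0, _ => 0
  | n + 1, f => Nat.lor (fields n f) (Nat.shiftLeft (f n) (Nat.mul 256 n))

/-- Evaluate a number before passing it on. -/
def force {α : Type} (x : ℕ) (k : ℕ → α) : α := Nat.rec (k 0) (fun n _ => k (Nat.succ n)) x

theorem force_eq {α : Type} (x : ℕ) (k : ℕ → α) : force x k = k x := by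
  cases x <;> rfl

theorem testBit_land (a b p : ℕ) : (Nat.land a b).testBit p = (a.testBit p && b.testBit p) :=
  Nat.testBit_and a b p

theorem testBit_lor (a b p : ℕ) : (Nat.lor a b).testBit p = (a.testBit p || b.testBit p) :=
  Nat.testBit_or a b p

theorem testBit_shiftRight' (a s p : ℕ) : (Nat.shiftRight a s).testBit p = a.testBit (p + s) := by
  rw [add_comm]
  exact Nat.testBit_shiftRight a

theorem testBit_shiftLeft' {a s p : ℕ} :
    (Nat.shiftLeft a s).testBit p = true ↔ ∃ q, p = q + s ∧ a.testBit q = true := by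
  have h := Nat.testBit_shiftLeft (i := s) (j := p) a
  change (Nat.shiftLeft a s).testBit p = _ at h
  rw [h]
  constructor
  · intro h
    simp only [Bool.and_eq_true, decide_eq_true_eq] at h
    exact ⟨p - s, by omega, h.2⟩
  · rintro ⟨q, rfl, hq⟩
    simp [hq]

theorem testBit_andNot (a b p : ℕ) : (andNot a b).testBit p = (a.testBit p && !b.testBit p) := by
  have h := Nat.testBit_xor a (Nat.land a b) p
  change (andNot a b).testBit p = _ at h
  rw [h, testBit_land]
  cases a.testBit p <;> cases b.testBit p <;> rfl

theorem testBit_ones {n p : ℕ} : (ones n).testBit p = true ↔ p < n := by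
  have h : ones n = 2 ^ n - 1 := congrArg (· - 1) (Nat.one_shiftLeft n)
  rw [h, Nat.testBit_two_pow_sub_one, decide_eq_true_eq]

theorem testBit_spreadUp {x a p : ℕ} : (spreadUp x a).testBit p = true ↔
    x.testBit p = true ∨ ∃ q, p = q + a ∧ x.testBit q = true := by
  rw [spreadUp, testBit_lor, Bool.or_eq_true, testBit_shiftLeft']

theorem testBit_spreadDown {x a p : ℕ} : (spreadDown x a).testBit p = true ↔
    x.testBit p = true ∨ x.testBit (p + a) = true := by
  rw [spreadDown, testBit_lor, Bool.or_eq_true, testBit_shiftRight']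

theorem testBit_up11 {x a p : ℕ} (h : (up11 x a).testBit p = true) :
    ∃ t < 11, ∃ q, p = q + t * a ∧ x.testBit q = true := by
  have key {x e c p : ℕ} (h : (spreadUp x (Nat.mul c e)).testBit p = true) :
      ∃ t, (t = 0 ∨ t = c) ∧ ∃ q, p = q + t * e ∧ x.testBit q = true := by
    rcases testBit_spreadUp.1 h with h | ⟨q, hq, h⟩
    · exact ⟨0, Or.inl rfl, p, by simp, h⟩
    · exact ⟨c, Or.inr rfl, q, hq, h⟩
  obtain ⟨t3, h3, q3, hq3, hb3⟩ := key h
  obtain ⟨t2, h2, q2, hq2, hb2⟩ := key hb3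
  obtain ⟨t1, h1, q1, hq1, hb1⟩ := key hb2
  rw [← Nat.one_mul a] at hb1
  obtain ⟨t0, h0, q0, hq0, hb0⟩ := key (c := 1) hb1
  exact ⟨t0 + t1 + t2 + t3, by omega, q0, by rw [hq3, hq2, hq1, hq0]; ring, hb0⟩

theorem testBit_down11 {x a p : ℕ} (h : (down11 x a).testBit p = true) :
    ∃ t < 11, x.testBit (p + t * a) = true := by
  have key {x e c p : ℕ} (h : (spreadDown x (Nat.mul c e)).testBit p = true) :
      ∃ t, (t = 0 ∨ t = c) ∧ x.testBit (p + t * e) = true := by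
    rcases testBit_spreadDown.1 h with h | h
    · exact ⟨0, Or.inl rfl, by simpa using h⟩
    · exact ⟨c, Or.inr rfl, h⟩
  obtain ⟨t3, h3, h⟩ := key h
  obtain ⟨t2, h2, h⟩ := key h
  obtain ⟨t1, h1, h⟩ := key h
  rw [← Nat.one_mul a] at h
  obtain ⟨t0, h0, h⟩ := key (c := 1) h
  refine ⟨t0 + t1 + t2 + t3, by omega, ?_⟩
  rw [← h]
  congr 1
  ring

theorem testBit_down11_of {x a p t : ℕ} (ht : t < 11) (h : x.testBit (p + t * a) = true) :
    (down11 x a).testBit p = true := by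
  have key {x e c p t : ℕ} (ht : t = 0 ∨ t = c) (h : x.testBit (p + t * e) = true) :
      (spreadDown x (Nat.mul c e)).testBit p = true := by
    rcases ht with rfl | rfl
    · exact testBit_spreadDown.2 (Or.inl (by simpa using h))
    · exact testBit_spreadDown.2 (Or.inr h)
  have hsplit : ∃ t0 t1 t2 t3, t = t0 + t1 + t2 + t3 ∧ (t0 = 0 ∨ t0 = 1) ∧ (t1 = 0 ∨ t1 = 2) ∧
      (t2 = 0 ∨ t2 = 4) ∧ (t3 = 0 ∨ t3 = 3) := by
    by_cases h7 : t ≤ 7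
    · exact ⟨t % 2, t / 2 % 2 * 2, t / 4 * 4, 0, by omega, by omega, by omega, by omega, by omega⟩
    · exact ⟨(t - 3) % 2, (t - 3) / 2 % 2 * 2, (t - 3) / 4 * 4, 3, by omega, by omega, by omega,
        by omega, by omega⟩
  obtain ⟨t0, t1, t2, t3, rfl, h0, h1, h2, h3⟩ := hsplit
  refine key h3 (key h2 (key h1 ?_))
  rw [← Nat.one_mul a]
  refine key (c := 1) h0 ?_
  rw [← h]
  congr 1
  ring

theorem testBit_fields {n : ℕ} {f : ℕ → ℕ} (hf : ∀ t q, (f t).testBit q = true → q < 256) {t q : ℕ}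
    (hq : q < 256)
    (h : (fields n f).testBit (256 * t + q) = true) : t < n ∧ (f t).testBit q = true := by
  induction n with
  | zero => simp [fields] at h
  | succ n ih =>
    rw [fields, testBit_lor, Bool.or_eq_true, testBit_shiftLeft'] at h
    rcases h with h | ⟨r, hr, h⟩
    · exact ⟨(ih h).1.trans (Nat.lt_succ_self n), (ih h).2⟩
    · have hr256 : r < 256 := hf n r h
      have hr' : 256 * t + q = r + 256 * n := hr
      obtain rfl : t = n := by omega
      obtain rfl : r = q := by omega
      exact ⟨Nat.lt_succ_self _, h⟩

end Bits

section Propagation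

/-! A partial description of one layer is stored in numbers made of `11 * 11` fields of 256 bits:
field `11 * i + j` concerns the pair of channels `(i, j)`. A field consists of two halves of 128
bits; a bit in position `v` of the lower or upper half asserts that in the `v`-th vector a value
is `0` or `1`, respectively. Values on channel `i` are kept in field `(i, 0)`. -/

def colZero : ℕ := up11 (ones 256) 2816
def lowHalves : ℕ := up11 (up11 (ones 128) 256) 2816
def fieldStarts : ℕ := up11 (up11 1 256) 2816
def diagonal : ℕ := up11 (ones 256) 3072

def lowHalf : ℕ := ones 128
def highHalf : ℕ := Nat.shiftLeft (ones 128) 128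

def compareCases (i j lt gt eq : ℕ) : ℕ :=
  bif Nat.blt i j then lt else bif Nat.blt j i then gt else eq

/-- In field `(i, j)`, the values decided on channel `i` by one of two inputs. -/
def decisive : ℕ :=
  fields 121 fun t => compareCases (Nat.div t 11) (Nat.mod t 11) lowHalf highHalf 0

/-- In field `(i, j)`, the values decided on channel `j` by one of two inputs. -/
def codecisive : ℕ :=
  fields 121 fun t => compareCases (Nat.div t 11) (Nat.mod t 11) highHalf lowHalf (ones 256)

/-- Turn copies of the value of channel `i` in row `i` into copies in column `i`. -/
def colOf (R : ℕ) : ℕ :=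
  up11 (Nat.land (down11 (Nat.land R diagonal) 2816) (ones 2816)) 2816

/-- Fill the fields which have a bit in their lower half. -/
def fillFields (x : ℕ) : ℕ :=
  let y := Nat.land (spreadDown (spreadDown (spreadDown (spreadDown (spreadDown (spreadDown
    (spreadDown x 1) 2) 4) 8) 16) 32) 64) fieldStarts
  spreadUp (spreadUp (spreadUp (spreadUp (spreadUp (spreadUp (spreadUp (spreadUp
    y 1) 2) 4) 8) 16) 32) 64) 128

/-- Values after a layer: `R` and `C` hold the inputs of a comparator, and one input with a value
in `d` suffices. -/
def forward (R C d : ℕ) : ℕ := Nat.lor (Nat.land R C) (Nat.land (Nat.lor R C) d)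

def flipHalves (C : ℕ) : ℕ :=
  Nat.lor (Nat.land (Nat.shiftRight C 128) lowHalves) (Nat.shiftLeft (Nat.land C lowHalves) 128)

/-- Values on channel `i` before a layer: `R'` and `C'` hold the outputs of a comparator, `C` the
input on channel `j`. -/
def backward (R' C' C : ℕ) : ℕ :=
  Nat.lor (Nat.lor (Nat.land C' decisive) (Nat.land R' codecisive))
    (Nat.land (Nat.lor (Nat.land R' decisive) (Nat.land C' codecisive)) (flipHalves C))

/-- The vectors for which `x` and `y` assert different values. -/
def clash (x y : ℕ) : ℕ :=
  Nat.lor (Nat.land (Nat.shiftRight x 128) y) (Nat.land x (Nat.shiftRight y 128))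

/-- The values in `x` common to all possible pairs. -/
def common (A x : ℕ) : ℕ := andNot colZero (down11 (andNot A x) 256)

/-- Propagate through one layer: `A` holds the possible pairs, `r` and `r'` the known values
before and after the layer. -/
def propagate {α : Type} (A r r' : ℕ) (k : ℕ → ℕ → ℕ → α) : α :=
  let R := up11 r 256
  let C := colOf R
  let R' := up11 r' 256
  let C' := colOf R'
  let f := forward R C decisive
  let g := forward R C codecisive
  force (andNot A (fillFields (Nat.land (Nat.lor (clash f R') (clash g C')) lowHalves))) fun A =>
  force (Nat.lor r (common A (backward R' C' C))) fun r =>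
  force (Nat.lor r' (common A f)) fun r' => k A r r'

/-- `q` encodes a vector together with its value on channel `i`. -/
def Lit (val : ℕ → ℕ → Bool) (i q : ℕ) : Prop := val i (q % 128) = decide (128 ≤ q)

/-- All bits of `r` are correct assertions about `val`, in column 0. -/
def ValuesOf (val : ℕ → ℕ → Bool) (r : ℕ) : Prop :=
  ∀ p, r.testBit p = true → ∃ i < 11, ∃ q < 256, p = 2816 * i + q ∧ Lit val i q

/-- The pairs of `μ` are possible according to `A`. -/
def PairsOf (μ : ℕ → ℕ) (A : ℕ) : Prop :=
  ∀ i < 11, ∀ q < 256, A.testBit (2816 * i + 256 * μ i + q) = true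

/-- `val'` is obtained from `val` by the layer `μ`. -/
def IsStep (μ : ℕ → ℕ) (val val' : ℕ → ℕ → Bool) : Prop :=
  ∀ i < 11, μ i < 11 ∧ μ (μ i) = i ∧ ∀ v, val' i v =
    bif decide (i < μ i) then val i v && val (μ i) v else val i v || val (μ i) v

/-- The bits in field `(i, j)` assert only literals satisfying `P i j`. -/
def FieldsSat (X : ℕ) (P : ℕ → ℕ → ℕ → Prop) : Prop :=
  ∀ i < 11, ∀ j < 11, ∀ q < 256, X.testBit (2816 * i + 256 * j + q) = true → P i j q

theorem testBit_colZero {p : ℕ} (h : colZero.testBit p = true) :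
    ∃ i < 11, ∃ q < 256, p = 2816 * i + q := by
  obtain ⟨t, ht, q, rfl, hq⟩ := testBit_up11 h
  exact ⟨t, ht, q, testBit_ones.1 hq, by ring⟩

theorem testBit_lowHalves {p : ℕ} (h : lowHalves.testBit p = true) :
    ∃ i < 11, ∃ j < 11, ∃ v < 128, p = 2816 * i + 256 * j + v := by
  obtain ⟨i, hi, q, rfl, hq⟩ := testBit_up11 h
  obtain ⟨j, hj, v, rfl, hv⟩ := testBit_up11 hq
  exact ⟨i, hi, j, hj, v, testBit_ones.1 hv, by ring⟩

theorem testBit_fieldStarts {p : ℕ} (h : fieldStarts.testBit p = true) :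
    ∃ i < 11, ∃ j < 11, p = 2816 * i + 256 * j := by
  obtain ⟨i, hi, q, rfl, hq⟩ := testBit_up11 h
  obtain ⟨j, hj, v, rfl, hv⟩ := testBit_up11 hq
  obtain rfl := Nat.testBit_one_eq_true_iff_self_eq_zero.1 hv
  exact ⟨i, hi, j, hj, by ring⟩

theorem blt_eq_decide (a b : ℕ) : Nat.blt a b = decide (a < b) := by
  rw [Bool.eq_iff_iff, Nat.blt_eq, decide_eq_true_iff]

theorem testBit_lowHalf {q : ℕ} (h : lowHalf.testBit q = true) : q < 128 := by
  rw [lowHalf] at h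
  exact testBit_ones.1 h

theorem testBit_shiftLeft_ones {n s q : ℕ} (h : (Nat.shiftLeft (ones n) s).testBit q = true) :
    s ≤ q ∧ q < n + s := by
  obtain ⟨r, rfl, hr⟩ := testBit_shiftLeft'.1 h
  have := testBit_ones.1 hr
  omega

theorem testBit_highHalf {q : ℕ} (h : highHalf.testBit q = true) : 128 ≤ q ∧ q < 256 := by
  delta highHalf at h
  exact testBit_shiftLeft_ones h

theorem testBit_compareCases {i j lt gt eq q : ℕ}
    (h : (compareCases i j lt gt eq).testBit q = true) :
    (i < j ∧ lt.testBit q = true) ∨ (j < i ∧ gt.testBit q = true) ∨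
      (i = j ∧ eq.testBit q = true) := by
  rw [compareCases, blt_eq_decide, blt_eq_decide] at h
  rcases lt_trichotomy i j with hij | hij | hij
  · rw [decide_eq_true hij, cond_true] at h
    exact Or.inl ⟨hij, h⟩
  · rw [decide_eq_false hij.not_lt, decide_eq_false hij.not_gt, cond_false, cond_false] at h
    exact Or.inr (Or.inr ⟨hij, h⟩)
  · rw [decide_eq_false hij.not_gt, decide_eq_true hij, cond_false, cond_true] at h
    exact Or.inr (Or.inl ⟨hij, h⟩)

theorem fieldsSat_fields_compareCases {lt gt eq : ℕ} (hlt : ∀ q, lt.testBit q = true → q < 256)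
    (hgt : ∀ q, gt.testBit q = true → q < 256) (heq : ∀ q, eq.testBit q = true → q < 256) :
    FieldsSat (fields 121 fun t => compareCases (Nat.div t 11) (Nat.mod t 11) lt gt eq)
      fun i j q => (i < j ∧ lt.testBit q = true) ∨ (j < i ∧ gt.testBit q = true) ∨
        (i = j ∧ eq.testBit q = true) := by
  intro i hi j hj q hq h
  rw [show 2816 * i + 256 * j + q = 256 * (11 * i + j) + q by ring] at h
  obtain ⟨-, h⟩ := testBit_fields (fun t q hb => by
    rcases testBit_compareCases hb with h | h | h
    exacts [hlt q h.2, hgt q h.2, heq q h.2]) hq h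
  have h1 : Nat.div (11 * i + j) 11 = i := show (11 * i + j) / 11 = i by omega
  have h2 : Nat.mod (11 * i + j) 11 = j := show (11 * i + j) % 11 = j by omega
  rw [h1, h2] at h
  exact testBit_compareCases h

theorem fieldsSat_decisive :
    FieldsSat decisive fun i j q => (i < j ∧ q < 128) ∨ (j < i ∧ 128 ≤ q) := by
  intro i hi j hj q hq h
  rw [decisive] at h
  rcases fieldsSat_fields_compareCases (fun q h => (testBit_lowHalf h).trans (by norm_num))
    (fun q h => (testBit_highHalf h).2) (fun q h => by simp at h) i hi j hj q hq h with h | h | h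
  · exact Or.inl ⟨h.1, testBit_lowHalf h.2⟩
  · exact Or.inr ⟨h.1, (testBit_highHalf h.2).1⟩
  · simp at h

theorem fieldsSat_codecisive :
    FieldsSat codecisive fun i j q => (i < j ∧ 128 ≤ q) ∨ (j < i ∧ q < 128) ∨ i = j := by
  intro i hi j hj q hq h
  rw [codecisive] at h
  rcases fieldsSat_fields_compareCases (fun q h => (testBit_highHalf h).2)
    (fun q h => (testBit_lowHalf h).trans (by norm_num)) (fun q h => testBit_ones.1 h)
    i hi j hj q hq h with h | h | h
  · exact Or.inl ⟨h.1, (testBit_highHalf h.2).1⟩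
  · exact Or.inr (Or.inl ⟨h.1, testBit_lowHalf h.2⟩)
  · exact Or.inr (Or.inr h.1)

theorem ValuesOf.rows {val : ℕ → ℕ → Bool} {r : ℕ} (h : ValuesOf val r) :
    FieldsSat (up11 r 256) fun i _ q => Lit val i q := by
  intro i hi j hj q hq hbit
  obtain ⟨t, ht, p, hp, hbit⟩ := testBit_up11 hbit
  obtain ⟨i', hi', q', hq', rfl, hlit⟩ := h p hbit
  obtain rfl : i = i' := by omega
  obtain rfl : q = q' := by omega
  exact hlit

theorem FieldsSat.colOf {val : ℕ → ℕ → Bool} {R : ℕ}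
    (h : FieldsSat R fun i _ q => Lit val i q) :
    FieldsSat (colOf R) fun _ j q => Lit val j q := by
  intro i hi j hj q hq hbit
  obtain ⟨t, ht, p, hp, hbit⟩ := testBit_up11 hbit
  rw [testBit_land, Bool.and_eq_true, testBit_ones] at hbit
  obtain ⟨hbit, hlt⟩ := hbit
  obtain ⟨s, hs, hbit⟩ := testBit_down11 hbit
  rw [testBit_land, Bool.and_eq_true] at hbit
  obtain ⟨hbit, hdiag⟩ := hbit
  obtain ⟨u, hu, w, hw, hdiag⟩ := testBit_up11 hdiag
  rw [testBit_ones] at hdiag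
  have hpq : p = 256 * j + q := by omega
  have hsu : s = u := by omega
  obtain rfl : s = j := by omega
  subst hpq
  rw [show 256 * s + q + s * 2816 = 2816 * s + 256 * s + q by ring] at hbit
  exact h s hj s hj q hq hbit

theorem exists_of_testBit_spreadUp {x a b p : ℕ} {P : ℕ → Prop}
    (hx : ∀ p, x.testBit p = true → ∃ s, P s ∧ ∃ d < b, p = s + d)
    (h : (spreadUp x a).testBit p = true) : ∃ s, P s ∧ ∃ d < b + a, p = s + d := by
  rcases testBit_spreadUp.1 h with hp | ⟨q, rfl, hq⟩
  · obtain ⟨s, hs, d, hd, rfl⟩ := hx p hp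
    exact ⟨s, hs, d, by omega, rfl⟩
  · obtain ⟨s, hs, d, hd, rfl⟩ := hx q hq
    exact ⟨s, hs, d + a, by omega, by omega⟩

theorem exists_of_testBit_spreadDown {x y a b : ℕ}
    (hx : ∀ p, x.testBit p = true → ∃ d < b, y.testBit (p + d) = true) (p : ℕ)
    (h : (spreadDown x a).testBit p = true) : ∃ d < b + a, y.testBit (p + d) = true := by
  rcases testBit_spreadDown.1 h with h | h
  · obtain ⟨d, hd, h⟩ := hx p h
    exact ⟨d, by omega, h⟩
  · obtain ⟨d, hd, h⟩ := hx _ h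
    exact ⟨a + d, by omega, by rwa [← add_assoc]⟩

theorem testBit_fillFields {x p : ℕ} (h : (fillFields x).testBit p = true) :
    ∃ i < 11, ∃ j < 11, ∃ q < 256, p = 2816 * i + 256 * j + q ∧
      ∃ v < 128, x.testBit (2816 * i + 256 * j + v) = true := by
  have hdown := exists_of_testBit_spreadDown (a := 64) <| exists_of_testBit_spreadDown (a := 32) <|
    exists_of_testBit_spreadDown (a := 16) <| exists_of_testBit_spreadDown (a := 8) <|
    exists_of_testBit_spreadDown (a := 4) <| exists_of_testBit_spreadDown (a := 2) <|
    exists_of_testBit_spreadDown (a := 1) (x := x) (b := 1)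
      fun p hp => ⟨0, Nat.one_pos, hp⟩
  let P s := fieldStarts.testBit s = true ∧ ∃ d < 128, x.testBit (s + d) = true
  obtain ⟨s, ⟨hs, v, hv, hx⟩, d, hd, rfl⟩ := exists_of_testBit_spreadUp (P := P) (b := 128) (a := 128)
    (fun p => exists_of_testBit_spreadUp (b := 64) (a := 64) fun p =>
    exists_of_testBit_spreadUp (b := 32) (a := 32) fun p =>
    exists_of_testBit_spreadUp (b := 16) (a := 16) fun p =>
    exists_of_testBit_spreadUp (b := 8) (a := 8) fun p =>
    exists_of_testBit_spreadUp (b := 4) (a := 4) fun p =>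
    exists_of_testBit_spreadUp (b := 2) (a := 2) fun p =>
    exists_of_testBit_spreadUp (b := 1) (a := 1) fun p hp => by
      rw [testBit_land, Bool.and_eq_true] at hp
      exact ⟨p, ⟨hp.2, hdown p hp.1⟩, 0, Nat.one_pos, rfl⟩) h
  obtain ⟨i, hi, j, hj, rfl⟩ := testBit_fieldStarts hs
  exact ⟨i, hi, j, hj, d, hd, rfl, v, hv, hx⟩

theorem ValuesOf.lor {val : ℕ → ℕ → Bool} {r s : ℕ} (hr : ValuesOf val r) (hs : ValuesOf val s) :
    ValuesOf val (Nat.lor r s) := by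
  intro p hp
  rw [testBit_lor, Bool.or_eq_true] at hp
  exact hp.elim (hr p) (hs p)

theorem valuesOf_common {μ : ℕ → ℕ} {val : ℕ → ℕ → Bool} {A x : ℕ} (hμ : ∀ i < 11, μ i < 11)
    (hA : PairsOf μ A) (hx : FieldsSat x fun i j q => μ i = j → Lit val i q) :
    ValuesOf val (common A x) := by
  intro p hp
  rw [common, testBit_andNot, Bool.and_eq_true, Bool.not_eq_true', ← Bool.not_eq_true] at hp
  obtain ⟨i, hi, q, hq, rfl⟩ := testBit_colZero hp.1
  refine ⟨i, hi, q, hq, rfl, ?_⟩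
  by_contra hlit
  refine hp.2 (testBit_down11_of (hμ i hi) ?_)
  rw [show 2816 * i + q + μ i * 256 = 2816 * i + 256 * μ i + q by ring, testBit_andNot,
    hA i hi q hq, Bool.true_and, Bool.not_eq_true', ← Bool.not_eq_true]
  exact fun h => hlit (hx i hi _ (hμ i hi) q hq h rfl)

theorem IsStep.values {μ : ℕ → ℕ} {val val' : ℕ → ℕ → Bool} (h : IsStep μ val val') {i j : ℕ}
    (hi : i < 11) (hij : μ i = j) (v : ℕ) :
    (i < j ∧ val' i v = (val i v && val j v) ∧ val' j v = (val i v || val j v)) ∨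
      (j < i ∧ val' i v = (val i v || val j v) ∧ val' j v = (val i v && val j v)) ∨
      (i = j ∧ val' i v = val i v) := by
  obtain ⟨hlt, hμ, hi'⟩ := h i hi
  obtain ⟨-, -, hj'⟩ := h _ hlt
  specialize hi' v
  specialize hj' v
  rw [hμ] at hj'
  subst hij
  rcases lt_trichotomy i (μ i) with hlt | heq | hlt
  · simp only [decide_eq_true hlt, decide_eq_false hlt.not_gt, cond_true, cond_false] at hi' hj'
    exact Or.inl ⟨hlt, hi', hj'.trans (Bool.or_comm _ _)⟩
  · rw [← heq] at hi'
    exact Or.inr (Or.inr ⟨heq, by simpa using hi'⟩)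
  · simp only [decide_eq_true hlt, decide_eq_false hlt.not_gt, cond_true, cond_false] at hi' hj'
    exact Or.inr (Or.inl ⟨hlt, hi', hj'.trans (Bool.and_comm _ _)⟩)

theorem fieldsSat_forward_decisive {μ : ℕ → ℕ} {val val' : ℕ → ℕ → Bool} (h : IsStep μ val val')
    {R C : ℕ} (hR : FieldsSat R fun i _ q => Lit val i q)
    (hC : FieldsSat C fun _ j q => Lit val j q) :
    FieldsSat (forward R C decisive) fun i j q => μ i = j → Lit val' i q := by
  intro i hi j hj q hq hbit hij
  replace hR := hR i hi j hj q hq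
  replace hC := hC i hi j hj q hq
  have hd := fieldsSat_decisive i hi j hj q hq
  rw [forward, testBit_lor, testBit_land, testBit_land, testBit_lor] at hbit
  have hval := h.values hi hij (q % 128)
  unfold Lit at *
  grind

theorem fieldsSat_forward_codecisive {μ : ℕ → ℕ} {val val' : ℕ → ℕ → Bool} (h : IsStep μ val val')
    {R C : ℕ} (hR : FieldsSat R fun i _ q => Lit val i q)
    (hC : FieldsSat C fun _ j q => Lit val j q) :
    FieldsSat (forward R C codecisive) fun i j q => μ i = j → Lit val' j q := by
  intro i hi j hj q hq hbit hij
  replace hR := hR i hi j hj q hq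
  replace hC := hC i hi j hj q hq
  have hd := fieldsSat_codecisive i hi j hj q hq
  rw [forward, testBit_lor, testBit_land, testBit_land, testBit_lor] at hbit
  have hval := h.values hi hij (q % 128)
  unfold Lit at *
  grind

theorem FieldsSat.flipHalves {P : ℕ → ℕ → ℕ → Prop} {C : ℕ} (hC : FieldsSat C P) :
    FieldsSat (flipHalves C) fun i j q => P i j ((q + 128) % 256) := by
  intro i hi j hj q hq hbit
  rw [SN.flipHalves, testBit_lor, Bool.or_eq_true, testBit_land, Bool.and_eq_true,
    testBit_shiftRight', testBit_shiftLeft'] at hbit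
  rcases hbit with ⟨hbit, hlow⟩ | ⟨p, hp, hbit⟩
  · obtain ⟨i', hi', j', hj', v, hv, heq⟩ := testBit_lowHalves hlow
    obtain rfl : i = i' := by omega
    obtain rfl : j = j' := by omega
    have hqv : q = v := by omega
    rw [Nat.mod_eq_of_lt (by omega)]
    exact hC i hi j hj _ (by omega) (by rwa [← add_assoc])
  · rw [testBit_land, Bool.and_eq_true] at hbit
    obtain ⟨i', hi', j', hj', v, hv, heq⟩ := testBit_lowHalves hbit.2
    obtain rfl : i = i' := by omega
    obtain rfl : j = j' := by omega
    have hqv : q = v + 128 := by omega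
    have hmod : (q + 128) % 256 = v := by omega
    rw [hmod]
    exact hC i hi j hj _ (by omega) (heq ▸ hbit.1)

theorem fieldsSat_backward {μ : ℕ → ℕ} {val val' : ℕ → ℕ → Bool} (h : IsStep μ val val')
    {R' C' C : ℕ} (hR' : FieldsSat R' fun i _ q => Lit val' i q)
    (hC' : FieldsSat C' fun _ j q => Lit val' j q) (hC : FieldsSat C fun _ j q => Lit val j q) :
    FieldsSat (backward R' C' C) fun i j q => μ i = j → Lit val i q := by
  intro i hi j hj q hq hbit hij
  replace hR' := hR' i hi j hj q hq
  replace hC' := hC' i hi j hj q hq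
  replace hC := hC.flipHalves i hi j hj q hq
  have hd := fieldsSat_decisive i hi j hj q hq
  have hcd := fieldsSat_codecisive i hi j hj q hq
  rw [backward] at hbit
  simp only [testBit_lor, testBit_land] at hbit
  have hval := h.values hi hij (q % 128)
  have hmod : (q + 128) % 256 % 128 = q % 128 := by omega
  have hflip : (128 ≤ (q + 128) % 256) ↔ ¬ 128 ≤ q := by omega
  unfold Lit at *
  simp only [hmod, hflip] at hC
  grind

theorem not_of_testBit_clash {val : ℕ → ℕ → Bool} {k : ℕ → ℕ → ℕ} {P : ℕ → ℕ → Prop} {x y : ℕ}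
    (hx : FieldsSat x fun i j q => P i j → Lit val (k i j) q)
    (hy : FieldsSat y fun i j q => Lit val (k i j) q) {i j v : ℕ}
    (hi : i < 11) (hj : j < 11) (hv : v < 128)
    (h : (clash x y).testBit (2816 * i + 256 * j + v) = true) : ¬ P i j := by
  intro hP
  rw [clash, testBit_lor, testBit_land, testBit_land, testBit_shiftRight', testBit_shiftRight',
    add_assoc _ v 128] at h
  have hx0 := fun h => hx i hi j hj v (by omega) h hP
  have hx1 := fun h => hx i hi j hj (v + 128) (by omega) h hP
  have hy0 := hy i hi j hj v (by omega)
  have hy1 := hy i hi j hj (v + 128) (by omega)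
  have hmod : (v + 128) % 128 = v % 128 := by omega
  have h0 : decide (128 ≤ v) = false := decide_eq_false (by omega)
  have h1 : decide (128 ≤ v + 128) = true := decide_eq_true (by omega)
  unfold Lit at *
  simp only [hmod] at hx1 hy1
  grind

/-- Propagation preserves correctness. -/
theorem exists_propagate_eq (A r r' : ℕ) :
    ∃ A₁ r₁ r₁', (∀ {α : Type} (k : ℕ → ℕ → ℕ → α), propagate A r r' k = k A₁ r₁ r₁') ∧
      ∀ {μ : ℕ → ℕ} {val val' : ℕ → ℕ → Bool}, IsStep μ val val' → PairsOf μ A →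
        ValuesOf val r → ValuesOf val' r' →
        PairsOf μ A₁ ∧ ValuesOf val r₁ ∧ ValuesOf val' r₁' := by
  refine ⟨_, _, _, fun k => by simp only [propagate, force_eq]; rfl, ?_⟩
  intro μ val val' h hA hr hr'
  have hμ : ∀ i < 11, μ i < 11 := fun i hi => (h i hi).1
  have hR := hr.rows
  have hC := hR.colOf
  have hR' := hr'.rows
  have hC' := hR'.colOf
  have hf := fieldsSat_forward_decisive h hR hC
  have hg := fieldsSat_forward_codecisive h hR hC
  have hb := fieldsSat_backward h hR' hC' hC
  refine (fun hA₁ => ⟨hA₁, hr.lor (valuesOf_common hμ hA₁ hb),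
    hr'.lor (valuesOf_common hμ hA₁ hf)⟩ : PairsOf μ _ → _) ?_
  intro i hi q hq
  rw [testBit_andNot, hA i hi q hq, Bool.true_and, Bool.not_eq_true', ← Bool.not_eq_true]
  intro hfill
  obtain ⟨i', hi', j, hj, q', hq', heq, v, hv, hbad⟩ := testBit_fillFields hfill
  have := hμ i hi
  obtain rfl : i = i' := by omega
  obtain rfl : μ i = j := by omega
  rw [testBit_land, Bool.and_eq_true, testBit_lor, Bool.or_eq_true] at hbad
  rcases hbad.1 with hbad | hbad
  · exact not_of_testBit_clash (k := fun i _ => i) hf hR' hi hj hv hbad rfl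
  · exact not_of_testBit_clash (k := fun _ j => j) hg hC' hi hj hv hbad rfl

end Propagation

section Search

/-- Knowledge about five layers: `aₗ` holds the possible pairs of layer `l`, and `rₗ` the known
values before layer `l`. -/
structure Knowledge where
  (a₀ a₁ a₂ a₃ a₄ r₀ r₁ r₂ r₃ r₄ r₅ : ℕ)

namespace Knowledge

def propagateLayer {α : Type} (l : ℕ) (s : Knowledge) (k : Knowledge → α) : α :=
  match s with
  | ⟨a₀, a₁, a₂, a₃, a₄, r₀, r₁, r₂, r₃, r₄, r₅⟩ =>
    bif Nat.beq l 0 then propagate a₀ r₀ r₁ fun a r r' => k ⟨a, a₁, a₂, a₃, a₄, r, r', r₂, r₃, r₄, r₅⟩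
    else bif Nat.beq l 1 then
      propagate a₁ r₁ r₂ fun a r r' => k ⟨a₀, a, a₂, a₃, a₄, r₀, r, r', r₃, r₄, r₅⟩
    else bif Nat.beq l 2 then
      propagate a₂ r₂ r₃ fun a r r' => k ⟨a₀, a₁, a, a₃, a₄, r₀, r₁, r, r', r₄, r₅⟩
    else bif Nat.beq l 3 then
      propagate a₃ r₃ r₄ fun a r r' => k ⟨a₀, a₁, a₂, a, a₄, r₀, r₁, r₂, r, r', r₅⟩
    else propagate a₄ r₄ r₅ fun a r r' => k ⟨a₀, a₁, a₂, a₃, a, r₀, r₁, r₂, r₃, r, r'⟩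

def mapPairs {α : Type} (l : ℕ) (f : ℕ → ℕ) (s : Knowledge) (k : Knowledge → α) : α :=
  match s with
  | ⟨a₀, a₁, a₂, a₃, a₄, r₀, r₁, r₂, r₃, r₄, r₅⟩ =>
    bif Nat.beq l 0 then force (f a₀) fun a => k ⟨a, a₁, a₂, a₃, a₄, r₀, r₁, r₂, r₃, r₄, r₅⟩
    else bif Nat.beq l 1 then force (f a₁) fun a => k ⟨a₀, a, a₂, a₃, a₄, r₀, r₁, r₂, r₃, r₄, r₅⟩
    else bif Nat.beq l 2 then force (f a₂) fun a => k ⟨a₀, a₁, a, a₃, a₄, r₀, r₁, r₂, r₃, r₄, r₅⟩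
    else bif Nat.beq l 3 then force (f a₃) fun a => k ⟨a₀, a₁, a₂, a, a₄, r₀, r₁, r₂, r₃, r₄, r₅⟩
    else force (f a₄) fun a => k ⟨a₀, a₁, a₂, a₃, a, r₀, r₁, r₂, r₃, r₄, r₅⟩

def mapValues {α : Type} (l : ℕ) (f : ℕ → ℕ) (s : Knowledge) (k : Knowledge → α) : α :=
  match s with
  | ⟨a₀, a₁, a₂, a₃, a₄, r₀, r₁, r₂, r₃, r₄, r₅⟩ =>
    bif Nat.beq l 1 then force (f r₁) fun r => k ⟨a₀, a₁, a₂, a₃, a₄, r₀, r, r₂, r₃, r₄, r₅⟩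
    else bif Nat.beq l 2 then force (f r₂) fun r => k ⟨a₀, a₁, a₂, a₃, a₄, r₀, r₁, r, r₃, r₄, r₅⟩
    else bif Nat.beq l 3 then force (f r₃) fun r => k ⟨a₀, a₁, a₂, a₃, a₄, r₀, r₁, r₂, r, r₄, r₅⟩
    else force (f r₄) fun r => k ⟨a₀, a₁, a₂, a₃, a₄, r₀, r₁, r₂, r₃, r, r₅⟩

def values (l : ℕ) (s : Knowledge) : ℕ :=
  match s with
  | ⟨_, _, _, _, _, r₀, r₁, r₂, r₃, r₄, r₅⟩ =>
    bif Nat.beq l 0 then r₀ else bif Nat.beq l 1 then r₁ else bif Nat.beq l 2 then r₂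
    else bif Nat.beq l 3 then r₃ else bif Nat.beq l 4 then r₄ else r₅

/-- The knowledge `s` is correct for the layers `μ` and the intermediate values `val`. -/
def Holds (μ : ℕ → ℕ → ℕ) (val : ℕ → ℕ → ℕ → Bool) (s : Knowledge) : Prop :=
  PairsOf (μ 0) s.a₀ ∧ PairsOf (μ 1) s.a₁ ∧ PairsOf (μ 2) s.a₂ ∧ PairsOf (μ 3) s.a₃ ∧
    PairsOf (μ 4) s.a₄ ∧ ValuesOf (val 0) s.r₀ ∧ ValuesOf (val 1) s.r₁ ∧ ValuesOf (val 2) s.r₂ ∧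
    ValuesOf (val 3) s.r₃ ∧ ValuesOf (val 4) s.r₄ ∧ ValuesOf (val 5) s.r₅

/-- No layers and values are compatible with `s`. -/
def Refuted (s : Knowledge) : Prop :=
  ∀ (μ : ℕ → ℕ → ℕ) (val : ℕ → ℕ → ℕ → Bool),
    (∀ l < 5, IsStep (μ l) (val l) (val (l + 1))) → ¬ s.Holds μ val

theorem exists_propagateLayer_eq (l : ℕ) (s : Knowledge) :
    ∃ t : Knowledge, (∀ {α : Type} (k : Knowledge → α), s.propagateLayer l k = k t) ∧
      (t.Refuted → s.Refuted) := by
  obtain ⟨a₀, a₁, a₂, a₃, a₄, r₀, r₁, r₂, r₃, r₄, r₅⟩ := s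
  simp only [propagateLayer]
  cases Nat.beq l 0 with
  | true =>
    obtain ⟨a, r, r', heq, h⟩ := exists_propagate_eq a₀ r₀ r₁
    refine ⟨⟨a, a₁, a₂, a₃, a₄, r, r', r₂, r₃, r₄, r₅⟩, fun k => heq fun a r r' => k
      ⟨a, a₁, a₂, a₃, a₄, r, r', r₂, r₃, r₄, r₅⟩, fun ht μ val hμ hs => ht μ val hμ ?_⟩
    obtain ⟨h0, h1, h2, h3, h4, k0, k1, k2, k3, k4, k5⟩ := hs
    obtain ⟨ha, hr, hr'⟩ := h (hμ 0 (by norm_num)) h0 k0 k1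
    exact ⟨ha, h1, h2, h3, h4, hr, hr', k2, k3, k4, k5⟩
  | false =>
  cases Nat.beq l 1 with
  | true =>
    obtain ⟨a, r, r', heq, h⟩ := exists_propagate_eq a₁ r₁ r₂
    refine ⟨⟨a₀, a, a₂, a₃, a₄, r₀, r, r', r₃, r₄, r₅⟩, fun k => heq fun a r r' => k
      ⟨a₀, a, a₂, a₃, a₄, r₀, r, r', r₃, r₄, r₅⟩, fun ht μ val hμ hs => ht μ val hμ ?_⟩
    obtain ⟨h0, h1, h2, h3, h4, k0, k1, k2, k3, k4, k5⟩ := hs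
    obtain ⟨ha, hr, hr'⟩ := h (hμ 1 (by norm_num)) h1 k1 k2
    exact ⟨h0, ha, h2, h3, h4, k0, hr, hr', k3, k4, k5⟩
  | false =>
  cases Nat.beq l 2 with
  | true =>
    obtain ⟨a, r, r', heq, h⟩ := exists_propagate_eq a₂ r₂ r₃
    refine ⟨⟨a₀, a₁, a, a₃, a₄, r₀, r₁, r, r', r₄, r₅⟩, fun k => heq fun a r r' => k
      ⟨a₀, a₁, a, a₃, a₄, r₀, r₁, r, r', r₄, r₅⟩, fun ht μ val hμ hs => ht μ val hμ ?_⟩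
    obtain ⟨h0, h1, h2, h3, h4, k0, k1, k2, k3, k4, k5⟩ := hs
    obtain ⟨ha, hr, hr'⟩ := h (hμ 2 (by norm_num)) h2 k2 k3
    exact ⟨h0, h1, ha, h3, h4, k0, k1, hr, hr', k4, k5⟩
  | false =>
  cases Nat.beq l 3 with
  | true =>
    obtain ⟨a, r, r', heq, h⟩ := exists_propagate_eq a₃ r₃ r₄
    refine ⟨⟨a₀, a₁, a₂, a, a₄, r₀, r₁, r₂, r, r', r₅⟩, fun k => heq fun a r r' => k
      ⟨a₀, a₁, a₂, a, a₄, r₀, r₁, r₂, r, r', r₅⟩, fun ht μ val hμ hs => ht μ val hμ ?_⟩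
    obtain ⟨h0, h1, h2, h3, h4, k0, k1, k2, k3, k4, k5⟩ := hs
    obtain ⟨ha, hr, hr'⟩ := h (hμ 3 (by norm_num)) h3 k3 k4
    exact ⟨h0, h1, h2, ha, h4, k0, k1, k2, hr, hr', k5⟩
  | false =>
    obtain ⟨a, r, r', heq, h⟩ := exists_propagate_eq a₄ r₄ r₅
    refine ⟨⟨a₀, a₁, a₂, a₃, a, r₀, r₁, r₂, r₃, r, r'⟩, fun k => heq fun a r r' => k
      ⟨a₀, a₁, a₂, a₃, a, r₀, r₁, r₂, r₃, r, r'⟩, fun ht μ val hμ hs => ht μ val hμ ?_⟩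
    obtain ⟨h0, h1, h2, h3, h4, k0, k1, k2, k3, k4, k5⟩ := hs
    obtain ⟨ha, hr, hr'⟩ := h (hμ 4 (by norm_num)) h4 k4 k5
    exact ⟨h0, h1, h2, h3, ha, k0, k1, k2, k3, hr, hr'⟩

theorem mapPairs_eq {α : Type} (l : ℕ) (f : ℕ → ℕ) (s : Knowledge) (k : Knowledge → α) :
    s.mapPairs l f k = k (s.mapPairs l f id) := by
  obtain ⟨a₀, a₁, a₂, a₃, a₄, r₀, r₁, r₂, r₃, r₄, r₅⟩ := s
  simp only [mapPairs, force_eq, id]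
  cases Nat.beq l 0 <;> cases Nat.beq l 1 <;> cases Nat.beq l 2 <;> cases Nat.beq l 3 <;> rfl

theorem mapValues_eq {α : Type} (l : ℕ) (f : ℕ → ℕ) (s : Knowledge) (k : Knowledge → α) :
    s.mapValues l f k = k (s.mapValues l f id) := by
  obtain ⟨a₀, a₁, a₂, a₃, a₄, r₀, r₁, r₂, r₃, r₄, r₅⟩ := s
  simp only [mapValues, force_eq, id]
  cases Nat.beq l 1 <;> cases Nat.beq l 2 <;> cases Nat.beq l 3 <;> rfl

theorem exists_holds_mapPairs {μ : ℕ → ℕ → ℕ} {val : ℕ → ℕ → ℕ → Bool} {s : Knowledge} (l : ℕ)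
    (hs : s.Holds μ val) : ∃ m < 5, ∀ f : ℕ → ℕ,
      (∀ a, PairsOf (μ m) a → PairsOf (μ m) (f a)) → (s.mapPairs l f id).Holds μ val := by
  obtain ⟨a₀, a₁, a₂, a₃, a₄, r₀, r₁, r₂, r₃, r₄, r₅⟩ := s
  obtain ⟨h0, h1, h2, h3, h4, k0, k1, k2, k3, k4, k5⟩ := hs
  simp only [mapPairs, force_eq, id]
  cases Nat.beq l 0 with
  | true => exact ⟨0, by norm_num, fun f hf => ⟨hf _ h0, h1, h2, h3, h4, k0, k1, k2, k3, k4, k5⟩⟩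
  | false =>
  cases Nat.beq l 1 with
  | true => exact ⟨1, by norm_num, fun f hf => ⟨h0, hf _ h1, h2, h3, h4, k0, k1, k2, k3, k4, k5⟩⟩
  | false =>
  cases Nat.beq l 2 with
  | true => exact ⟨2, by norm_num, fun f hf => ⟨h0, h1, hf _ h2, h3, h4, k0, k1, k2, k3, k4, k5⟩⟩
  | false =>
  cases Nat.beq l 3 with
  | true => exact ⟨3, by norm_num, fun f hf => ⟨h0, h1, h2, hf _ h3, h4, k0, k1, k2, k3, k4, k5⟩⟩
  | false => exact ⟨4, by norm_num, fun f hf => ⟨h0, h1, h2, h3, hf _ h4, k0, k1, k2, k3, k4, k5⟩⟩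

theorem exists_holds_mapValues {μ : ℕ → ℕ → ℕ} {val : ℕ → ℕ → ℕ → Bool} {s : Knowledge} (l : ℕ)
    (hs : s.Holds μ val) : ∃ m, ∀ f : ℕ → ℕ,
      (∀ r, ValuesOf (val m) r → ValuesOf (val m) (f r)) → (s.mapValues l f id).Holds μ val := by
  obtain ⟨a₀, a₁, a₂, a₃, a₄, r₀, r₁, r₂, r₃, r₄, r₅⟩ := s
  obtain ⟨h0, h1, h2, h3, h4, k0, k1, k2, k3, k4, k5⟩ := hs
  simp only [mapValues, force_eq, id]
  cases Nat.beq l 1 with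
  | true => exact ⟨1, fun f hf => ⟨h0, h1, h2, h3, h4, k0, hf _ k1, k2, k3, k4, k5⟩⟩
  | false =>
  cases Nat.beq l 2 with
  | true => exact ⟨2, fun f hf => ⟨h0, h1, h2, h3, h4, k0, k1, hf _ k2, k3, k4, k5⟩⟩
  | false =>
  cases Nat.beq l 3 with
  | true => exact ⟨3, fun f hf => ⟨h0, h1, h2, h3, h4, k0, k1, k2, hf _ k3, k4, k5⟩⟩
  | false => exact ⟨4, fun f hf => ⟨h0, h1, h2, h3, h4, k0, k1, k2, k3, hf _ k4, k5⟩⟩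

theorem Holds.exists_valuesOf {μ : ℕ → ℕ → ℕ} {val : ℕ → ℕ → ℕ → Bool} {s : Knowledge}
    (hs : s.Holds μ val) (l : ℕ) : ∃ m, ValuesOf (val m) (s.values l) := by
  obtain ⟨a₀, a₁, a₂, a₃, a₄, r₀, r₁, r₂, r₃, r₄, r₅⟩ := s
  obtain ⟨h0, h1, h2, h3, h4, k0, k1, k2, k3, k4, k5⟩ := hs
  simp only [values]
  cases Nat.beq l 0
  · cases Nat.beq l 1
    · cases Nat.beq l 2
      · cases Nat.beq l 3
        · cases Nat.beq l 4
          exacts [⟨5, k5⟩, ⟨4, k4⟩]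
        · exact ⟨3, k3⟩
      · exact ⟨2, k2⟩
    · exact ⟨1, k1⟩
  · exact ⟨0, k0⟩

end Knowledge

def rowMask (i : ℕ) : ℕ := Nat.shiftLeft (ones 2816) (Nat.mul 2816 i)
def colMask (j : ℕ) : ℕ := up11 (Nat.shiftLeft (ones 256) (Nat.mul 256 j)) 2816
def cellMask (i j : ℕ) : ℕ := Nat.shiftLeft (ones 256) (Nat.add (Nat.mul 2816 i) (Nat.mul 256 j))

/-- Record that channels `i` and `j` are paired, or that they are not. -/
def restrictPairs (i j : ℕ) (b : Bool) (A : ℕ) : ℕ :=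
  bif b then
    Nat.lor
      (andNot A (Nat.lor (Nat.lor (rowMask i) (rowMask j)) (Nat.lor (colMask i) (colMask j))))
      (Nat.land A (Nat.lor (cellMask i j) (cellMask j i)))
  else andNot A (Nat.lor (cellMask i j) (cellMask j i))

/-- Record that the value on channel `i` of vector `v` is `b`. -/
def insertValue (i v : ℕ) (b : Bool) (r : ℕ) : ℕ :=
  Nat.lor r (Nat.shiftLeft 1 (Nat.add (Nat.mul 2816 i) (bif b then Nat.add v 128 else v)))

theorem testBit_shiftLeft_ones_iff {n s q : ℕ} :
    (Nat.shiftLeft (ones n) s).testBit q = true ↔ s ≤ q ∧ q < n + s := by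
  refine ⟨testBit_shiftLeft_ones, fun h => testBit_shiftLeft'.2 ⟨q - s, by omega, ?_⟩⟩
  exact testBit_ones.2 (by omega)

theorem testBit_rowMask {i x q : ℕ} (hq : q < 2816)
    (h : (rowMask i).testBit (2816 * x + q) = true) : x = i := by
  have h := testBit_shiftLeft_ones h
  change 2816 * i ≤ _ ∧ _ < 2816 + 2816 * i at h
  omega

theorem testBit_colMask {j x y q : ℕ} (hj : j < 11) (hy : y < 11) (hq : q < 256)
    (h : (colMask j).testBit (2816 * x + 256 * y + q) = true) : y = j := by
  obtain ⟨t, ht, p, hp, h⟩ := testBit_up11 h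
  have h := testBit_shiftLeft_ones h
  change 256 * j ≤ _ ∧ _ < 256 + 256 * j at h
  have htx : t = x := by omega
  omega

theorem testBit_cellMask {i j x y q : ℕ} (hj : j < 11) (hy : y < 11) (hq : q < 256) :
    (cellMask i j).testBit (2816 * x + 256 * y + q) = true ↔ x = i ∧ y = j := by
  rw [cellMask, testBit_shiftLeft_ones_iff]
  change 2816 * i + 256 * j ≤ _ ∧ _ < 256 + (2816 * i + 256 * j) ↔ _
  constructor
  · intro h
    have hx : x = i := by omega
    exact ⟨hx, by omega⟩
  · rintro ⟨rfl, rfl⟩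
    omega

theorem pairsOf_restrictPairs {μ : ℕ → ℕ} (hμ : ∀ i < 11, μ i < 11 ∧ μ (μ i) = i) {i j A : ℕ}
    (hi : i < 11) (hj : j < 11) (hA : PairsOf μ A) :
    PairsOf μ (restrictPairs i j (decide (μ i = j)) A) := by
  intro x hx q hq
  have hμx := hμ x hx
  have hμi := hμ i hi
  have hinj : μ x = i → x = μ i := by rintro rfl; exact hμx.2.symm
  have hinj' : μ x = μ i → x = i := fun h => by rw [← hμx.2, h, hμi.2]
  have hcell := testBit_cellMask (i := i) (x := x) hj hμx.1 hq
  have hcell' := testBit_cellMask (i := j) (x := x) hi hμx.1 hq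
  by_cases hij : μ i = j
  · rw [decide_eq_true hij, restrictPairs, cond_true, testBit_lor, testBit_andNot, testBit_land,
      hA x hx q hq, Bool.true_and, Bool.true_and, testBit_lor, testBit_lor, testBit_lor,
      testBit_lor]
    have hrow : ∀ i, (rowMask i).testBit (2816 * x + 256 * μ x + q) = true → x = i := fun i h =>
      testBit_rowMask (q := 256 * μ x + q) (by omega) (by rwa [← add_assoc])
    have hcol := fun h => testBit_colMask (x := x) hi hμx.1 hq h
    have hcol' := fun h => testBit_colMask (x := x) hj hμx.1 hq h
    have hr := hrow i
    have hr' := hrow j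
    subst hij
    grind
  · rw [decide_eq_false hij, restrictPairs, cond_false, testBit_andNot, hA x hx q hq,
      Bool.true_and, testBit_lor]
    grind

theorem valuesOf_insertValue {val : ℕ → ℕ → Bool} {i v r : ℕ} (hi : i < 11) (hv : v < 128)
    (hr : ValuesOf val r) : ValuesOf val (insertValue i v (val i v) r) := by
  refine hr.lor fun p hp => ?_
  obtain ⟨q, rfl, hq⟩ := testBit_shiftLeft'.1 hp
  obtain rfl := Nat.testBit_one_eq_true_iff_self_eq_zero.1 hq
  cases hval : val i v
  · refine ⟨i, hi, v, by omega, Nat.zero_add _, ?_⟩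
    rw [Lit, Nat.mod_eq_of_lt hv, hval, decide_eq_false (by omega)]
  · refine ⟨i, hi, v + 128, by omega, Nat.zero_add _, ?_⟩
    rw [Lit, Nat.add_mod_right, Nat.mod_eq_of_lt hv, hval, decide_eq_true (by omega)]

theorem ValuesOf.no_conflict {val : ℕ → ℕ → Bool} {r : ℕ} (hr : ValuesOf val r) :
    Nat.land r (Nat.shiftRight r 128) = 0 := by
  refine Nat.eq_of_testBit_eq fun p => ?_
  rw [Nat.zero_testBit, ← Bool.not_eq_true, testBit_land, Bool.and_eq_true, testBit_shiftRight']
  rintro ⟨h, h'⟩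
  obtain ⟨i, hi, q, hq, rfl, hlit⟩ := hr _ h
  obtain ⟨i', hi', q', hq', heq, hlit'⟩ := hr _ h'
  obtain rfl : i = i' := by omega
  obtain rfl : q' = q + 128 := by omega
  rw [Lit, Nat.add_mod_right, hlit] at hlit'
  simp at hlit'
  omega

namespace Knowledge

theorem Refuted.of_pair {s : Knowledge} {i j : ℕ} (l : ℕ) (hi : i < 11) (hj : j < 11)
    (h : (s.mapPairs l (restrictPairs i j true) id).Refuted)
    (h' : (s.mapPairs l (restrictPairs i j false) id).Refuted) : s.Refuted := by
  intro μ val hμ hs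
  obtain ⟨m, hm, hmap⟩ := exists_holds_mapPairs l hs
  have hmap := hmap _ fun a => pairsOf_restrictPairs (A := a)
    (fun i hi => ⟨(hμ m hm i hi).1, (hμ m hm i hi).2.1⟩) hi hj
  cases hd : decide (μ m i = j) <;> rw [hd] at hmap
  exacts [h' μ val hμ hmap, h μ val hμ hmap]

theorem Refuted.of_value {s : Knowledge} {i v : ℕ} (l : ℕ) (hi : i < 11) (hv : v < 128)
    (h : (s.mapValues l (insertValue i v true) id).Refuted)
    (h' : (s.mapValues l (insertValue i v false) id).Refuted) : s.Refuted := by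
  intro μ val hμ hs
  obtain ⟨m, hmap⟩ := exists_holds_mapValues l hs
  have hmap := hmap _ fun r => valuesOf_insertValue (r := r) hi hv
  cases hd : val m i v <;> rw [hd] at hmap
  exacts [h' μ val hμ hmap, h μ val hμ hmap]

theorem refuted_of_conflict {s : Knowledge} (l : ℕ)
    (h : Nat.beq (Nat.land (s.values l) (Nat.shiftRight (s.values l) 128)) 0 = false) :
    s.Refuted := by
  intro μ val _ hs
  obtain ⟨m, hm⟩ := hs.exists_valuesOf l
  rw [hm.no_conflict] at h
  exact Bool.noConfusion h

end Knowledge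

/-- Read the next `n` bits of `code`. -/
def readBits {α : Type} (n code : ℕ) (k : ℕ → ℕ → α) : α :=
  force (Nat.land code (ones n)) fun x => force (Nat.shiftRight code n) fun code => k x code

/-- Follow the instructions in `code` to refute `s` and all the alternatives in `stack`. -/
def refute : ℕ → ℕ → Knowledge → List Knowledge → Bool
  | 0, _, _, _ => false
  | n + 1, code, s, stack => readBits 3 code fun op code =>
    bif Nat.blt op 5 then s.propagateLayer op fun s => refute n code s stack
    else readBits 3 code fun l code =>
      bif Nat.beq op 5 then
        bif Nat.beq (Nat.land (s.values l) (Nat.shiftRight (s.values l) 128)) 0 then false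
        else match stack with
          | [] => true
          | t :: stack => refute n code t stack
      else readBits 4 code fun i code => bif Nat.blt i 11 then
        bif Nat.beq op 6 then readBits 4 code fun j code => bif Nat.blt j 11 then
          s.mapPairs l (restrictPairs i j false) fun t =>
            s.mapPairs l (restrictPairs i j true) fun s => refute n code s (t :: stack)
          else false
        else readBits 7 code fun v code =>
          s.mapValues l (insertValue i v false) fun t =>
            s.mapValues l (insertValue i v true) fun s => refute n code s (t :: stack)
      else false

theorem land_ones_lt (x n : ℕ) : Nat.land x (ones n) < 2 ^ n := by
  refine Nat.lt_pow_two_of_testBit _ fun p hp => ?_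
  rw [testBit_land, ← Bool.not_eq_true, Bool.and_eq_true, testBit_ones]
  omega

theorem cond_false_eq_true {b c : Bool} (h : (bif b then c else false) = true) :
    b = true ∧ c = true := by
  cases b
  exacts [Bool.noConfusion h, ⟨rfl, h⟩]

theorem forall_refuted_of_refute (n code : ℕ) (s : Knowledge) (stack : List Knowledge)
    (h : refute n code s stack = true) : s.Refuted ∧ ∀ t ∈ stack, t.Refuted := by
  induction n generalizing code s stack with
  | zero => exact Bool.noConfusion h
  | succ n ih =>
    simp only [refute, readBits, force_eq] at h
    cases h5 : Nat.blt (Nat.land code (ones 3)) 5 <;> simp only [h5, cond_true, cond_false] at h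
    · cases h6 : Nat.beq (Nat.land code (ones 3)) 5 <;> simp only [h6, cond_true, cond_false] at h
      · obtain ⟨hi, h⟩ := cond_false_eq_true h
        cases h7 : Nat.beq (Nat.land code (ones 3)) 6 <;>
          simp only [h7, cond_true, cond_false] at h
        · rw [Knowledge.mapValues_eq, Knowledge.mapValues_eq] at h
          obtain ⟨ht, hstack⟩ := ih _ _ _ h
          rw [List.forall_mem_cons] at hstack
          exact ⟨.of_value _ (Nat.le_of_ble_eq_true hi) (land_ones_lt _ 7) ht hstack.1, hstack.2⟩
        · obtain ⟨hj, h⟩ := cond_false_eq_true h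
          rw [Knowledge.mapPairs_eq, Knowledge.mapPairs_eq] at h
          obtain ⟨ht, hstack⟩ := ih _ _ _ h
          rw [List.forall_mem_cons] at hstack
          exact ⟨.of_pair _ (Nat.le_of_ble_eq_true hi) (Nat.le_of_ble_eq_true hj) ht hstack.1, hstack.2⟩
      · generalize hc : Nat.beq (Nat.land (s.values _) _) 0 = c at h
        cases c
        · refine ⟨Knowledge.refuted_of_conflict _ hc, ?_⟩
          cases stack with
          | nil => exact List.forall_mem_nil _
          | cons t stack => exact List.forall_mem_cons.2 (ih _ _ _ h)
        · exact Bool.noConfusion h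
    · obtain ⟨t, heq, ht⟩ := s.exists_propagateLayer_eq (Nat.land code (ones 3))
      rw [heq] at h
      exact ⟨ht (ih _ _ _ h).1, (ih _ _ _ h).2⟩

theorem Knowledge.Refuted.of_refute {s : Knowledge} (n code : ℕ) (h : refute n code s [] = true) :
    s.Refuted :=
  (forall_refuted_of_refute n code s [] h).1

end Search

section Cores

/-- Column `v` of a table of 128 columns of length 11 whose rows are packed into `Y`. -/
def column (Y v : ℕ) : Fin 11 → Bool := fun i => Y.testBit (128 * i + v)

def columns (Y : ℕ) : Set (Fin 11 → Bool) := {x | ∃ v < 128, x = column Y v}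

/-- The entries of the first `n` rows of the table `Y`, as known values. -/
def knownRows : ℕ → ℕ → ℕ
  | 0, _ => 0
  | n + 1, Y =>
    let c := Nat.land (Nat.shiftRight Y (Nat.mul 128 n)) (ones 128)
    Nat.lor (knownRows n Y)
      (Nat.shiftLeft (Nat.lor (andNot (ones 128) c) (Nat.shiftLeft c 128)) (Nat.mul 2816 n))

theorem testBit_knownRows {n Y p : ℕ} (h : (knownRows n Y).testBit p = true) :
    ∃ i < n, ∃ q < 256, p = 2816 * i + q ∧ Lit (fun i v => Y.testBit (128 * i + v)) i q := by
  induction n with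
  | zero => simp [knownRows] at h
  | succ n ih =>
    simp only [knownRows, testBit_lor, Bool.or_eq_true, testBit_shiftLeft'] at h
    rcases h with h | ⟨q, hp, h | ⟨r, hq, h⟩⟩
    · obtain ⟨i, hi, q, hq, h⟩ := ih h
      exact ⟨i, hi.trans (Nat.lt_succ_self n), q, hq, h⟩
    · rw [testBit_andNot, Bool.and_eq_true, testBit_land, testBit_shiftRight'] at h
      have hq : q < 128 := testBit_ones.1 h.1
      refine ⟨n, Nat.lt_succ_self n, q, by omega, by rw [hp, Nat.add_comm]; rfl, ?_⟩
      have h2 := h.2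
      rw [h.1, Bool.and_true, Bool.not_eq_true'] at h2
      have hd : decide (128 ≤ q) = false := decide_eq_false (by omega)
      rw [Lit, Nat.mod_eq_of_lt hq, hd, ← h2, Nat.add_comm q]
      rfl
    · rw [testBit_land, Bool.and_eq_true, testBit_shiftRight'] at h
      have hr : r < 128 := testBit_ones.1 h.2
      refine ⟨n, Nat.lt_succ_self n, q, by omega, by rw [hp, Nat.add_comm]; rfl, ?_⟩
      have hd : decide (128 ≤ q) = true := decide_eq_true (by omega)
      have hm : q % 128 = r := by omega
      rw [Lit, hm, hd, ← h.1, Nat.add_comm r]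
      rfl

/-- The knowledge that five layers transform the table `Y` into the table `Z`. -/
def Knowledge.ofTables (Y Z : ℕ) : Knowledge :=
  ⟨ones 30976, ones 30976, ones 30976, ones 30976, ones 30976,
    knownRows 11 Y, 0, 0, 0, 0, knownRows 11 Z⟩

theorem not_sortable_columns {Y Z : ℕ}
    (hsort : ∀ v < 128, ∃ w < 128, column Z v = column Y w ∧ BSorted (column Y w) ∧
      wt (column Y v) = wt (column Y w))
    (href : (Knowledge.ofTables Y Z).Refuted) : ¬ Sortable 5 (columns Y) := by
  intro h
  obtain ⟨ms, hlen, hinv, hms⟩ := h.exists_layers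
  let state (l v : ℕ) : Fin 11 → Bool := (ms.take l).foldl (fun y m => ap m y) (column Y v)
  let μ (l i : ℕ) : ℕ := if hi : i < 11 then (ms.getD l id ⟨i, hi⟩).val else i
  let val (l i v : ℕ) : Bool := if hi : i < 11 then state l v ⟨i, hi⟩ else false
  have hpairs (l : ℕ) : PairsOf (μ l) (ones 30976) := by
    intro i hi q hq
    have : μ l i < 11 := by simp only [μ, dif_pos hi]; exact Fin.is_lt _
    exact testBit_ones.2 (by omega)
  have hnone (l : ℕ) : ValuesOf (val l) 0 := fun p hp => by simp at hp
  have hval {T l : ℕ} (hT : ∀ v < 128, state l v = column T v) :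
      ValuesOf (val l) (knownRows 11 T) := by
    intro p hp
    obtain ⟨i, hi, q, hq, hpq, hlit⟩ := testBit_knownRows hp
    refine ⟨i, hi, q, hq, hpq, ?_⟩
    rw [Lit] at hlit ⊢
    rw [← hlit]
    simp only [val, dif_pos hi, hT _ (Nat.mod_lt q (by norm_num : 128 > 0)), column]
  refine href μ val (fun l hl i hi => ?_) ⟨hpairs 0, hpairs 1, hpairs 2, hpairs 3, hpairs 4,
    hval fun v _ => rfl, hnone 1, hnone 2, hnone 3, hnone 4, hval fun v hv => ?_⟩
  · have hl' : l < ms.length := by omega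
    have hmem : ms.getD l id ∈ ms := by
      rw [List.getD_eq_getElem _ _ hl']
      exact List.getElem_mem hl'
    have hμ : μ l i = (ms.getD l id ⟨i, hi⟩).val := dif_pos hi
    have hμ' : μ l i < 11 := by rw [hμ]; exact Fin.is_lt _
    refine ⟨hμ', ?_, fun v => ?_⟩
    · have : μ l (μ l i) = (ms.getD l id ⟨μ l i, hμ'⟩).val := dif_pos hμ'
      rw [this]
      have h2 : (⟨μ l i, hμ'⟩ : Fin 11) = ms.getD l id ⟨i, hi⟩ := Fin.ext hμ
      rw [h2, hinv _ hmem]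
    · have hstate : state (l + 1) v = ap (ms.getD l id) (state l v) := by
        simp only [state]
        rw [List.take_add_one, List.getElem?_eq_getElem hl', List.foldl_append,
          List.getD_eq_getElem _ _ hl']
        rfl
      have h2 : (⟨μ l i, hμ'⟩ : Fin 11) = ms.getD l id ⟨i, hi⟩ := Fin.ext hμ
      have hlt : decide (i < μ l i) = decide ((⟨i, hi⟩ : Fin 11) < ms.getD l id ⟨i, hi⟩) := by
        rw [hμ]
        exact decide_eq_decide.2 Iff.rfl
      simp only [val, dif_pos hi, dif_pos hμ', hstate, h2, hlt, ap]
  · obtain ⟨w, hw, hz, hs, hwt⟩ := hsort v hv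
    have hall : ms.take 5 = ms := by rw [← hlen]; exact List.take_length
    simp only [state, hall]
    rw [hz]
    exact hms _ ⟨v, hv, rfl⟩ _ ⟨w, hw, rfl⟩ hs hwt

theorem not_sortable_columns_of_sorted {Y Z : ℕ}
    (hsort : ∀ v : Fin 128, 117 + wt (column Y v) < 128 ∧
      (∀ k, column Z v k = column Y (117 + wt (column Y v)) k) ∧
      (∀ i j : Fin 11, i ≤ j →
        column Y (117 + wt (column Y v)) i ≤ column Y (117 + wt (column Y v)) j) ∧
      wt (column Y v) = wt (column Y (117 + wt (column Y v))))
    (href : (Knowledge.ofTables Y Z).Refuted) : ¬ Sortable 5 (columns Y) :=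
  not_sortable_columns (fun v hv => ⟨_, (hsort ⟨v, hv⟩).1, funext (hsort ⟨v, hv⟩).2.1,
    (hsort ⟨v, hv⟩).2.2.1, (hsort ⟨v, hv⟩).2.2.2⟩) href

end Cores

section Certificates

/-- A set of vectors that five layers cannot sort, closed under sorting. -/
def tableA : ℕ := 0xffdffffffffffcfffffffffffffff3feffbfffffffffc3ffffffffff0fffcbfdff1ffffe3fc03efffffffff0cfff2ffafe1e0001fffc30fff00fff0caffcb3f4fc01fe01c03328ffff0ff0cafff2c3e8f81fe1e13c2a83f00ccf0caf0fcb03d0f019999833003c0f0aa0caf00f2c03a0e01f5555aabfc0fccffcaf000cb00340c0000001c00000caa00af00002c002808015fffe3fc000aff00f00000b000100001e0000000000f0000000000c000200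

/-- The sorted columns of `tableA`. -/
def tableASorted : ℕ := 0xffffffffffffffffffffffffffffffffff9ffffffffffffffffffffffffffbfeff1ffffffffffeffffffffffefffe3fcfe1fffffffffb8fffffffffe8fff83f8fc1ffffdfffa20ffffefffe80ffe03f0f81ffdd1bfa000fffe8ffe800ff803e0f01fd1013a0000ffe80fe8000fe003c0e01d0000200000fe800e80000f800380c0100000000000e8000800000e0003008000000000000080000000000800020000000000000000000000000000000000

set_option maxHeartbeats 0 in
theorem refuted_tableA : (Knowledge.ofTables tableA tableASorted).Refuted :=
  (.of_value 2 (i := 3) (v := 6) (by decide) (by decide)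
    (.of_value 2 (i := 1) (v := 8) (by decide) (by decide)
      (.of_value 2 (i := 4) (v := 5) (by decide) (by decide)
        (.of_pair 2 (i := 3) (j := 4) (by decide) (by decide)
          (.of_pair 4 (i := 4) (j := 5) (by decide) (by decide)
            (.of_value 2 (i := 2) (v := 7) (by decide) (by decide)
              (.of_pair 4 (i := 2) (j := 3) (by decide) (by decide)
                (.of_pair 3 (i := 1) (j := 2) (by decide) (by decide)
                  (.of_refute 4000 0x2829a20821d68831193440a0a68896345344188d2c68a01c10861414d10c834b1a20a68a6885219d6884119d68a68822070a0a68810193444688 (by decide +kernel))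
                  (.of_value 2 (i := 6) (v := 3) (by decide) (by decide)
                    (.of_value 2 (i := 0) (v := 9) (by decide) (by decide)
                      (.of_refute 4000 0x258d105344d2134480e0450534534414548e4d11414d102829a214866a673ad108829b2bc154410690403268aa9a2a4730a632a8a68bad10534548e61946444688 (by decide +kernel))
                      (.of_refute 4000 0x1a410eb44080c99a534414d49e0aa68875189a5344165382a9a219464d11414d104c4e0eb44188c9c688 (by decide +kernel)))
                    (.of_refute 4000 0x2829a2694e3458ce4d3445053441a5344298c9a2c87022829c68829a2258d10c2314d345d8e02829a688641850534416538505345344328c9c688 (by decide +kernel))))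
                (.of_refute 4000 0x1414e34690510ac0d29c68853193444688 (by decide +kernel)))
              (.of_pair 1 (i := 1) (j := 3) (by decide) (by decide)
                (.of_refute 4000 0x4b1c68829c688 (by decide +kernel))
                (.of_refute 4000 0x258d1044b1a210464414e3441a414d15517639344398c282889634538d108232688531a58d382829a20a72c68820505344080d2c688411938c8f194c8cb1a20a6889634414d10ea30a0a68865194ce06434b1a71a218c69634414e344100d1a21c688 (by decide +kernel))))
            (.of_pair 4 (i := 5) (j := 6) (by decide) (by decide)
              (.of_refute 4000 0x2829a2081410403268829c641a414e344188d1c441a538c14d10538d10694e34414e3453444b8c8431a414e214c881414d10538d11414d10534415338190c2826470a0989c2828470a0a09d1a21c688 (by decide +kernel))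
              (.of_refute 4000 0x50414e31414e34414dd9e444b1a22829a29c71cb1993c8ba1c190696345344328d2c68a71a21d864e3444688 (by decide +kernel))))
          (.of_pair 4 (i := 3) (j := 4) (by decide) (by decide)
            (.of_pair 3 (i := 4) (j := 5) (by decide) (by decide)
              (.of_pair 4 (i := 5) (j := 6) (by decide) (by decide)
                (.of_pair 3 (i := 6) (j := 7) (by decide) (by decide)
                  (.of_pair 4 (i := 7) (j := 8) (by decide) (by decide)
                    (.of_value 2 (i := 5) (v := 4) (by decide) (by decide)
                      (.of_refute 4000 0xd20a2282882885510a233a9c08a0828c39c0d29a20a21d4655105d8e4e342829a2081410623268a22828a99c08a0821544208c9a20a2ea7234829d560694515514d16338298c4104eb8a0a29a288a0a20a2ea7341d8634820d214c64cab3444688 (by decide +kernel))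
                      (.of_refute 4000 0x504220a141041a4200c991620505344102820c464d1445053440a0a6883118a2a6706518d2885319a21c688 (by decide +kernel)))
                    (.of_value 2 (i := 5) (v := 4) (by decide) (by decide)
                      (.of_refute 4000 0x141441a510510c631440a0a21d46469053aac0d28a2aa29a2c6705318d28aa8b19c1d8670505106944144318c510eb44188875191a414eab034a28aa8a68b19c14c614145155149c68b19c1d8672f3234820d214c64cab3444688 (by decide +kernel))
                      (.of_refute 4000 0x504220a34829a20a645881414d1041a510623268a2aa20a2a6706518d2885319a21c688 (by decide +kernel))))
                  (.of_refute 4000 0x2a8821544188cd345134a20b454ce0450534d10414d165381a5344298caa68829a21d864e34eb44105102828841191a515514138320c6905322c0505134a68b21c1d8668d208348531936558821157444688 (by decide +kernel)))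
                (.of_refute 4000 0x6944168829a28aa8b21c08a0a2ec705510ca338282885510a6325510529ac15441455454ce0ca338e2551042a88641938d3b2c282885510a6325510529ac15441455454ce0ca338ed31041b2e88688 (by decide +kernel)))
              (.of_value 2 (i := 5) (v := 4) (by decide) (by decide)
                (.of_pair 4 (i := 5) (j := 6) (by decide) (by decide)
                  (.of_pair 0 (i := 6) (j := 7) (by decide) (by decide)
                    (.of_refute 4000 0xaa2086889634534446884119344d20a20a6a34554c829a2ea7321c1c688 (by decide +kernel))
                    (.of_value 2 (i := 7) (v := 2) (by decide) (by decide)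
                      (.of_value 2 (i := 8) (v := 1) (by decide) (by decide)
                        (.of_pair 1 (i := 6) (j := 7) (by decide) (by decide)
                          (.of_refute 4000 0x282886882154410d1082326885534414d134829a282706419c688 (by decide +kernel))
                          (.of_pair 3 (i := 6) (j := 7) (by decide) (by decide)
                            (.of_refute 4000 0x1a5104168a68a21545344320c450410aa20c464d105345d4e0eb44298c9a21c688 (by decide +kernel))
                            (.of_pair 3 (i := 7) (j := 8) (by decide) (by decide)
                              (.of_refute 4000 0x75a2083484d10ea3221c688 (by decide +kernel))
                              (.of_value 2 (i := 9) (v := 0) (by decide) (by decide)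
                                (.of_refute 4000 0xaa7114d134829a2a6702eb45388829a2ea726aa68829babc154414d14d1553458ce0a63221c688 (by decide +kernel))
                                (.of_refute 4000 0xeb4414e58d1042a9a218c64e19e443ad112e326aa20a68a68829babc1d68829cb1a20855344318c9c33c8bad1053441973931414d10534537578548d1a21c688 (by decide +kernel))))))
                        (.of_refute 4000 0x34a688298a0829a20d20a68829a221466eaf0a0a69c68829a9bc050534538d14d10a630a0a20a68830a7221c688 (by decide +kernel)))
                      (.of_refute 4000 0x1a414d11414d17339a22820d20c46442a9a2258d10c8325319a2ea70269053443ad10e63268887385053453443a8c2829a20bb1c9c688 (by decide +kernel))))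
                  (.of_refute 4000 0x9634414e0a0a68828829c76980a0a71a214c6963443b0c9a21c688 (by decide +kernel)))
                (.of_refute 4000 0x551042a8831193441069042a88311938d110c3271a2154d10690e8314d10538d10a634b1a20896344188c8a70d2081410623268a719664658d1053443ad1080322c505340504188ce34414d91e5338328d2c69c68a688641850538d10ec3109c688 (by decide +kernel))))
            (.of_pair 4 (i := 4) (j := 5) (by decide) (by decide)
              (.of_pair 4 (i := 2) (j := 3) (by decide) (by decide)
                (.of_pair 3 (i := 1) (j := 2) (by decide) (by decide)
                  (.of_value 2 (i := 6) (v := 3) (by decide) (by decide)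
                    (.of_pair 4 (i := 6) (j := 7) (by decide) (by decide)
                      (.of_pair 3 (i := 5) (j := 6) (by decide) (by decide)
                        (.of_refute 4000 0xaa20a22828828a99c0aa8828991c0d288531938d2a882885510510e632141441053aac1545134a2627344298cd2a882050505219a32588725c5051040a0a2190669d961410690623268829c68814140d20c8668a688101883484018d210864a8b3444688 (by decide +kernel))
                        (.of_refute 4000 0x1414d1053441441a510eb4414d10c832214c64aa20a53582a88288a0a2a6706519a1410282886419354591108 (by decide +kernel)))
                      (.of_refute 4000 0xd208348631938d102829a71a20d29c688411a1869634414d38d10690538d10823438c2830e70a0c31c9aa88288a0a2e87022828c39c15443a8c282885510538d144298c850529ac0d28aa8a99c1946209d7685041a4320c9aa2cecf4688708 (by decide +kernel)))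
                    (.of_refute 4000 0xa0829a6881414d175a20a2a670651a58d14d1a51141458ce71a54588761a58d10ea32a889619544430c282e872a8829c68829a21d064658d10510590e02828829c68829a2190671a21c688 (by decide +kernel)))
                  (.of_refute 4000 0x5053441441a4080c52a8829c68829a64582a8828865198a0a20d2040629c141441a4080c538ed310eb4410c8326caf0a0b21c8d20a71a20a69016141441943850510610e14144174393444688 (by decide +kernel)))
                (.of_refute 4000 0x50510aa20c465510a6321414a6b034a2aa2a6706519aa8828855105106432141464b034a2aa262705319b2bca58d1044b1a210464d5168aa20a21545106432141464b034a2aa262705319a96344112c68841192a2ce38954410aa20c464e3442b18cc88688 (by decide +kernel)))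
              (.of_refute 4000 0x4b1a20a71a20a1414e34414e112c68829c688631850538d10eb44188c538c933325a58d10414e344141c9f0282885510c832718a0a71b2bc88531a58d10538d105d4e4e3444688 (by decide +kernel)))))
        (.of_pair 0 (i := 4) (j := 5) (by decide) (by decide)
          (.of_pair 2 (i := 3) (j := 4) (by decide) (by decide)
            (.of_pair 1 (i := 2) (j := 4) (by decide) (by decide)
              (.of_refute 4000 0x50534538e39638d14e34658e34614e7679175a20a71c62829c6a6f22ca74b1c68ba9d154538a532a8a714665514e29cccd29c68a08afc1414e345308b38688 (by decide +kernel))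
              (.of_pair 4 (i := 0) (j := 2) (by decide) (by decide)
                (.of_refute 4000 0x690538d10538d109c688 (by decide +kernel))
                (.of_pair 4 (i := 2) (j := 4) (by decide) (by decide)
                  (.of_refute 4000 0x96345381c688 (by decide +kernel))
                  (.of_pair 4 (i := 3) (j := 6) (by decide) (by decide)
                    (.of_refute 4000 0xd29a31029c688 (by decide +kernel))
                    (.of_value 4 (i := 1) (v := 8) (by decide) (by decide)
                      (.of_refute 4000 0x34a71a29c68829c688688 (by decide +kernel))
                      (.of_pair 2 (i := 0) (j := 2) (by decide) (by decide)
                        (.of_refute 4000 0x50538d1108 (by decide +kernel))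
                        (.of_refute 4000 0x12c68829a29c6889638d106232705053888a089638d10c6326888548e4d105344d2081410ec3229a29a28072710e69634414d14e3427850538d14e34414c394eeb8d10538d4de699a514e220a71a29c642f1088 (by decide +kernel))))))))
            (.of_pair 4 (i := 3) (j := 4) (by decide) (by decide)
              (.of_pair 1 (i := 5) (j := 6) (by decide) (by decide)
                (.of_refute 4000 0x1414d102829c44100c882994d2a9a20828829c68834a688631934a6b4688 (by decide +kernel))
                (.of_pair 0 (i := 6) (j := 7) (by decide) (by decide)
                  (.of_pair 2 (i := 5) (j := 6) (by decide) (by decide)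
                    (.of_refute 4000 0x1a5344d29a2a674688 (by decide +kernel))
                    (.of_pair 4 (i := 5) (j := 6) (by decide) (by decide)
                      (.of_pair 1 (i := 7) (j := 8) (by decide) (by decide)
                        (.of_refute 4000 0x50534534694e34eab4688 (by decide +kernel))
                        (.of_value 2 (i := 8) (v := 1) (by decide) (by decide)
                          (.of_refute 4000 0xeb4515510515339a75a298d62eb458ce6694d14e386792a8829c68a68aa9a2ea743ac44688 (by decide +kernel))
                          (.of_refute 4000 0x34a68a6694d37679d68a71a70cf10eb45345134a68a282734aa68a68a4259aa8a68a68a71a664f15534eb482b142383ad345175a28a11cd2a8a68a68a68a41599a534531078bad14d3ad082c504e8dd68a26944c4e642f234a68bad1313885606434c0c44688 (by decide +kernel))))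
                      (.of_refute 4000 0x12c68a2694d15339c688 (by decide +kernel))))
                  (.of_pair 2 (i := 5) (j := 6) (by decide) (by decide)
                    (.of_refute 4000 0x9634d3ad20ac535534554504e05354784688 (by decide +kernel))
                    (.of_pair 4 (i := 5) (j := 6) (by decide) (by decide)
                      (.of_refute 4000 0x694414d34694e34eab10aa69d694d628d29a75599a5388a6dd5e32c69a2a6731414d8de2694c829a1414d31ac5d8e10e3271a75a21d6886318d29a29a2218642829a86598a0a70cf0a0a6c6f234a6a1d622829a20a68875a218c666944320a6c6f17638104ebc688 (by decide +kernel))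
                      (.of_refute 4000 0x3ad10519634590e42829c68a5359c688 (by decide +kernel))))))
              (.of_pair 4 (i := 2) (j := 3) (by decide) (by decide)
                (.of_pair 3 (i := 0) (j := 2) (by decide) (by decide)
                  (.of_refute 4000 0x14109c688 (by decide +kernel))
                  (.of_pair 1 (i := 0) (j := 4) (by decide) (by decide)
                    (.of_refute 4000 0x4b1a29c69c688 (by decide +kernel))
                    (.of_pair 2 (i := 0) (j := 4) (by decide) (by decide)
                      (.of_refute 4000 0x12c68a71a29c688 (by decide +kernel))
                      (.of_pair 2 (i := 0) (j := 1) (by decide) (by decide)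
                        (.of_refute 4000 0x14109c688 (by decide +kernel))
                        (.of_pair 2 (i := 1) (j := 2) (by decide) (by decide)
                          (.of_refute 4000 0x12c68829c6885534538d10203271c688 (by decide +kernel))
                          (.of_pair 1 (i := 2) (j := 3) (by decide) (by decide)
                            (.of_refute 4000 0x3ad14e34414e221c688 (by decide +kernel))
                            (.of_pair 2 (i := 5) (j := 6) (by decide) (by decide)
                              (.of_refute 4000 0x50538d10538d14e3444688 (by decide +kernel))
                              (.of_pair 1 (i := 5) (j := 6) (by decide) (by decide)
                                (.of_refute 4000 0xd29c68aa9c68a09ce3444688 (by decide +kernel))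
                                (.of_refute 4000 0x1544168aa8a11d1c6694d10538d144d29c68c29ce365792a9c68820a68829c68a7558cb1a29a71a2ea71a414e34414e2282709638d14d14e34554538d15538d1513954534d1533814d10512038190ce3444688 (by decide +kernel))))))))))
                (.of_refute 4000 0x96352c68a71a2905632c68a71a2827381c688 (by decide +kernel)))))
          (.of_pair 0 (i := 5) (j := 6) (by decide) (by decide)
            (.of_pair 2 (i := 3) (j := 4) (by decide) (by decide)
              (.of_refute 4000 0x1414e3441a5344208d1c72c6882258d1062327050534414414e21cc8829c664f229c688 (by decide +kernel))
              (.of_pair 4 (i := 2) (j := 4) (by decide) (by decide)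
                (.of_refute 4000 0x5538d109c688 (by decide +kernel))
                (.of_pair 4 (i := 1) (j := 4) (by decide) (by decide)
                  (.of_refute 4000 0xd28829c688 (by decide +kernel))
                  (.of_pair 4 (i := 1) (j := 3) (by decide) (by decide)
                    (.of_refute 4000 0xeb8d109c688 (by decide +kernel))
                    (.of_pair 4 (i := 4) (j := 6) (by decide) (by decide)
                      (.of_refute 4000 0xeb4e109c688 (by decide +kernel))
                      (.of_pair 4 (i := 4) (j := 7) (by decide) (by decide)
                        (.of_refute 4000 0x3ad10538d109c688 (by decide +kernel))
                        (.of_pair 2 (i := 4) (j := 6) (by decide) (by decide)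
                          (.of_refute 4000 0x2820a20a7138d109c688 (by decide +kernel))
                          (.of_pair 3 (i := 1) (j := 3) (by decide) (by decide)
                            (.of_refute 4000 0x505109c688 (by decide +kernel))
                            (.of_pair 3 (i := 2) (j := 3) (by decide) (by decide)
                              (.of_refute 4000 0x505109c688 (by decide +kernel))
                              (.of_pair 3 (i := 1) (j := 4) (by decide) (by decide)
                                (.of_refute 4000 0x4b1a68829c688 (by decide +kernel))
                                (.of_refute 4000 0x690538e34e3444b1a2aa220746884119a1414d10538d10ac2828829c69c688731938d1a414e34e34410e4b8a0a71a515850538d192c2829c68c561414e3420b4b1a71a6a2f0a0a71b9bd154d10538a532a9ba3caa6a8f2a9b23c690538d38d31033909c688 (by decide +kernel))))))))))))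
            (.of_pair 0 (i := 3) (j := 5) (by decide) (by decide)
              (.of_pair 0 (i := 4) (j := 6) (by decide) (by decide)
                (.of_refute 4000 0x9634d1a414e34cab472c69c767954e43cca58d38d54e365793b2c658d34eb4c6b472c69c6caf2a9c69c76993ae3963547932ac44b1a69d698d68e58d38d95e5538d38ed3275c72c6a8f2655888719d8e09c688 (by decide +kernel))
                (.of_pair 2 (i := 5) (j := 6) (by decide) (by decide)
                  (.of_refute 4000 0x34a68829a68bad1053458ce8cd29c68a6a8f472c6ecf229c688 (by decide +kernel))
                  (.of_pair 4 (i := 3) (j := 5) (by decide) (by decide)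
                    (.of_refute 4000 0x75a71a29c688 (by decide +kernel))
                    (.of_pair 4 (i := 2) (j := 5) (by decide) (by decide)
                      (.of_refute 4000 0x2829c68a71a29c688 (by decide +kernel))
                      (.of_pair 4 (i := 1) (j := 5) (by decide) (by decide)
                        (.of_refute 4000 0x2829c68a29c688 (by decide +kernel))
                        (.of_value 4 (i := 6) (v := 3) (by decide) (by decide)
                          (.of_refute 4000 0x3ad109c68829c68829c688 (by decide +kernel))
                          (.of_pair 4 (i := 6) (j := 9) (by decide) (by decide)
                            (.of_refute 4000 0xd29a20a71a29c688 (by decide +kernel))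
                            (.of_refute 4000 0x2829a20820d226064e34e3469041a4300c9c6991620a8d10694d10410691303271a71a34829c699168d108234b1a29a29c6a6f09634538d10e834b1c694d69638d292d2c71a515a58d38d51e34829c6a4f0a0a71a8bd1d68a71105394d3229c688 (by decide +kernel)))))))))
              (.of_pair 2 (i := 3) (j := 4) (by decide) (by decide)
                (.of_value 4 (i := 5) (v := 4) (by decide) (by decide)
                  (.of_refute 4000 0x2829a20a71a213888 (by decide +kernel))
                  (.of_pair 4 (i := 4) (j := 6) (by decide) (by decide)
                    (.of_refute 4000 0x258d10510538d109c688 (by decide +kernel))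
                    (.of_pair 4 (i := 4) (j := 7) (by decide) (by decide)
                      (.of_refute 4000 0x3ad10510538d109c688 (by decide +kernel))
                      (.of_pair 2 (i := 5) (j := 7) (by decide) (by decide)
                        (.of_refute 4000 0xeb4414d10538d109c688 (by decide +kernel))
                        (.of_pair 2 (i := 5) (j := 8) (by decide) (by decide)
                          (.of_refute 4000 0x50534414d10538d109c688 (by decide +kernel))
                          (.of_pair 3 (i := 5) (j := 7) (by decide) (by decide)
                            (.of_refute 4000 0xeb4414d10538d109c688 (by decide +kernel))
                            (.of_value 4 (i := 6) (v := 3) (by decide) (by decide)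
                              (.of_refute 4000 0xa0a71a20a688 (by decide +kernel))
                              (.of_pair 3 (i := 5) (j := 8) (by decide) (by decide)
                                (.of_refute 4000 0x9634414d10538d109c688 (by decide +kernel))
                                (.of_pair 4 (i := 4) (j := 5) (by decide) (by decide)
                                  (.of_refute 4000 0xa0a20a71a20d20a6887519342829a20a688299a534414d105353781a53443b0ccab0a08298367d109c688 (by decide +kernel))
                                  (.of_refute 4000 0x1414d109c141053444b1a20a6887418a71a20d20a68a71a20a71a21d464e32cc2829c68a7110e630a0a71a29c443b0cd109c688 (by decide +kernel)))))))))))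
                (.of_pair 4 (i := 4) (j := 6) (by decide) (by decide)
                  (.of_refute 4000 0x50534e109c688 (by decide +kernel))
                  (.of_pair 4 (i := 3) (j := 4) (by decide) (by decide)
                    (.of_refute 4000 0x504102829a20c464d38d102829a71108230a0a6905662829a0bc40a0a12c6885119a9634414e3484b10c834b1c68829a6559109c688 (by decide +kernel))
                    (.of_pair 4 (i := 4) (j := 5) (by decide) (by decide)
                      (.of_refute 4000 0x2829c68896344208c534414d112c68a21544208cea3392c68828896344144290d2c6882884219c76990a0a2050506319a6559544268829a20a69babd1909c688 (by decide +kernel))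
                      (.of_refute 4000 0xa0a20a71a20a6885510c6338e221d68896344318d1d4634829c68829c769938d109c688 (by decide +kernel))))))))))
      (.of_pair 0 (i := 1) (j := 2) (by decide) (by decide)
        (.of_pair 1 (i := 2) (j := 3) (by decide) (by decide)
          (.of_pair 2 (i := 3) (j := 4) (by decide) (by decide)
            (.of_refute 4000 0xd29a20a688141442a0c9a22829a2827462829c68a664f472c6a8f2208 (by decide +kernel))
            (.of_pair 4 (i := 4) (j := 6) (by decide) (by decide)
              (.of_refute 4000 0x75a71c688 (by decide +kernel))
              (.of_pair 4 (i := 2) (j := 4) (by decide) (by decide)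
                (.of_refute 4000 0x2829c21c688 (by decide +kernel))
                (.of_pair 4 (i := 1) (j := 3) (by decide) (by decide)
                  (.of_refute 4000 0xa0a71a21c688 (by decide +kernel))
                  (.of_pair 3 (i := 4) (j := 5) (by decide) (by decide)
                    (.of_refute 4000 0x12c69c688 (by decide +kernel))
                    (.of_pair 3 (i := 4) (j := 6) (by decide) (by decide)
                      (.of_refute 4000 0xa0a21c688 (by decide +kernel))
                      (.of_refute 4000 0x34829c6883485319c69c1414e0a08348541938d3442a8a68a685053443ad110e322d29ac14c634829a52585053453442b4329952671d68a68828aa9a2827032c68829a20a71a20a2a8721414414d2a2d1a141442b342829a12d10e61414e374788688 (by decide +kernel))))))))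
          (.of_pair 2 (i := 2) (j := 3) (by decide) (by decide)
            (.of_value 4 (i := 4) (v := 5) (by decide) (by decide)
              (.of_refute 4000 0xa0a71a20a688 (by decide +kernel))
              (.of_pair 4 (i := 1) (j := 3) (by decide) (by decide)
                (.of_refute 4000 0x258d10538d14e3444688 (by decide +kernel))
                (.of_pair 4 (i := 0) (j := 3) (by decide) (by decide)
                  (.of_refute 4000 0xa0a71a28a71a21c688 (by decide +kernel))
                  (.of_pair 3 (i := 1) (j := 4) (by decide) (by decide)
                    (.of_refute 4000 0x2820a68a71a208 (by decide +kernel))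
                    (.of_pair 4 (i := 3) (j := 4) (by decide) (by decide)
                      (.of_refute 4000 0x694d105355105134a29a280702aa20a2a87096344328ca58d1053451042a2ee334829a20c6822bed4de4658d3441a5305345344200d1a28473ad10517114d90bd2c68a6a4f475a20a68a68a714a64658d120384688 (by decide +kernel))
                      (.of_refute 4000 0xa0a71a20a29c34829c68a62828829a32c68829a262728d11414e34450534548e05141380a0a71a29a29a1414e3452a2c42a0c8d29c688290567190bcd19634480e86533444688 (by decide +kernel)))))))
            (.of_pair 4 (i := 2) (j := 4) (by decide) (by decide)
              (.of_refute 4000 0xaa29c21c688 (by decide +kernel))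
              (.of_pair 4 (i := 3) (j := 5) (by decide) (by decide)
                (.of_refute 4000 0x1d68a21c688 (by decide +kernel))
                (.of_pair 4 (i := 3) (j := 6) (by decide) (by decide)
                  (.of_refute 4000 0x1d68a21c688 (by decide +kernel))
                  (.of_pair 4 (i := 1) (j := 3) (by decide) (by decide)
                    (.of_refute 4000 0x1a5109c688 (by decide +kernel))
                    (.of_pair 4 (i := 0) (j := 3) (by decide) (by decide)
                      (.of_refute 4000 0x2829a28a21c688 (by decide +kernel))
                      (.of_pair 4 (i := 2) (j := 3) (by decide) (by decide)
                        (.of_pair 2 (i := 4) (j := 7) (by decide) (by decide)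
                          (.of_refute 4000 0x963453444688 (by decide +kernel))
                          (.of_pair 3 (i := 4) (j := 5) (by decide) (by decide)
                            (.of_refute 4000 0x12c68a21c688 (by decide +kernel))
                            (.of_pair 4 (i := 4) (j := 5) (by decide) (by decide)
                              (.of_pair 2 (i := 4) (j := 5) (by decide) (by decide)
                                (.of_refute 4000 0x69051053453444688 (by decide +kernel))
                                (.of_value 2 (i := 4) (v := 5) (by decide) (by decide)
                                  (.of_refute 4000 0xd20a71102829a214c64d175a220734690510414e220a68856299a534414e344112c6887110c832684f0a0a20a68a69096444688 (by decide +kernel))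
                                  (.of_refute 4000 0x34829a2258d10a6334d0a0a6909621d68a688a0a69a2ca726aa29a20d218c645344d29a22072684f0a0a68a690960a83109c688 (by decide +kernel))))
                              (.of_refute 4000 0x96345468bad10534548e0658d105468aa1ca58d10546951621c688 (by decide +kernel)))))
                        (.of_pair 4 (i := 4) (j := 5) (by decide) (by decide)
                          (.of_refute 4000 0x34a6814e346221c688 (by decide +kernel))
                          (.of_pair 4 (i := 4) (j := 6) (by decide) (by decide)
                            (.of_refute 4000 0x1d68a21c688 (by decide +kernel))
                            (.of_pair 4 (i := 1) (j := 4) (by decide) (by decide)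
                              (.of_refute 4000 0x1a5109c688 (by decide +kernel))
                              (.of_pair 4 (i := 0) (j := 4) (by decide) (by decide)
                                (.of_refute 4000 0x96346221c688 (by decide +kernel))
                                (.of_pair 2 (i := 0) (j := 4) (by decide) (by decide)
                                  (.of_refute 4000 0x4b1a2a3444688 (by decide +kernel))
                                  (.of_pair 2 (i := 1) (j := 4) (by decide) (by decide)
                                    (.of_refute 4000 0x4b1a2a3444688 (by decide +kernel))
                                    (.of_pair 3 (i := 4) (j := 5) (by decide) (by decide)
                                      (.of_refute 4000 0x258d105112c6886319a28cb1a20a8d1051523a58d10514239c141440a0a71a2884019175a20a71a2a6721414e34529acd0a0a21585051486b1a538d1051413954480e7196621c688 (by decide +kernel))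
                                      (.of_refute 4000 0x34a68820d29c68853193445053442a8829c6885319d688541914238d29a20a2a47381c688 (by decide +kernel)))))))))))))))))
        (.of_pair 0 (i := 2) (j := 3) (by decide) (by decide)
          (.of_pair 2 (i := 3) (j := 4) (by decide) (by decide)
            (.of_pair 4 (i := 3) (j := 5) (by decide) (by decide)
              (.of_refute 4000 0x75a20a71a29c688 (by decide +kernel))
              (.of_pair 4 (i := 3) (j := 6) (by decide) (by decide)
                (.of_refute 4000 0xd20a71a29c688 (by decide +kernel))
                (.of_pair 4 (i := 3) (j := 7) (by decide) (by decide)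
                  (.of_refute 4000 0xd20a71a29c688 (by decide +kernel))
                  (.of_refute 4000 0xd29a28828505105105292ce38c50538d1963441533938cc5e444b1a29c688411850538d14e3440b41414d14d1054615275510538d4de34829c6a4f4b1a20a7190bcaa20a71903c2829c6414e41cc6905386330a0a7190538613229c688 (by decide +kernel)))))
            (.of_pair 4 (i := 3) (j := 5) (by decide) (by decide)
              (.of_refute 4000 0xaa29c688 (by decide +kernel))
              (.of_pair 4 (i := 3) (j := 6) (by decide) (by decide)
                (.of_refute 4000 0xaa29c688 (by decide +kernel))
                (.of_pair 4 (i := 3) (j := 7) (by decide) (by decide)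
                  (.of_refute 4000 0xaa29c688 (by decide +kernel))
                  (.of_pair 4 (i := 3) (j := 8) (by decide) (by decide)
                    (.of_refute 4000 0xaa29c688 (by decide +kernel))
                    (.of_pair 2 (i := 0) (j := 2) (by decide) (by decide)
                      (.of_refute 4000 0xaa20a71a29c688 (by decide +kernel))
                      (.of_pair 3 (i := 3) (j := 6) (by decide) (by decide)
                        (.of_refute 4000 0x34a68829c69a29c688 (by decide +kernel))
                        (.of_pair 3 (i := 3) (j := 7) (by decide) (by decide)
                          (.of_refute 4000 0x2a8829c688 (by decide +kernel))
                          (.of_pair 3 (i := 3) (j := 8) (by decide) (by decide)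
                            (.of_refute 4000 0x2829c688 (by decide +kernel))
                            (.of_pair 4 (i := 3) (j := 4) (by decide) (by decide)
                              (.of_refute 4000 0x1a538d10534414d175a20a68a99d1a20d29a21046699a414414e3440a0a221864694d10515339a6a6f0a0a68c5629c688 (by decide +kernel))
                              (.of_refute 4000 0x55382829c6881414e344288ce234a7111414550e08230a0a20a32598a0a7110538278505388829b93caa29c68829b13c2829c4414da93d0ca629c688 (by decide +kernel))))))))))))
          (.of_pair 0 (i := 1) (j := 3) (by decide) (by decide)
            (.of_pair 0 (i := 2) (j := 4) (by decide) (by decide)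
              (.of_pair 1 (i := 4) (j := 5) (by decide) (by decide)
                (.of_refute 4000 0x2829c6850538d192d0d29c69c32992a9c6aa71993c90d629c688 (by decide +kernel))
                (.of_refute 4000 0x75a71a5538d21ad258d10538d38873234a69c72c686f254589a534d34eb4d312d1cb1a7195e9634e2a4c9d71aa9c6a8f265588a0a71a5538d2a2d1d69c54992a9c6aa71aa3c99562ec7075a71a34a71a545a58d38caf4b1a7152652c68a71aa9c68a71aa3c995621d8668a99c9c688 (by decide +kernel)))
              (.of_refute 4000 0x50510eb44290c8d29c68829a20a688294d669c69d68829a2050510ec3271a325a1a5105388829c329954e2a4c954414e0a0a688348761938a93355168834a6884019344142829a2949671993c90d629c688 (by decide +kernel)))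
            (.of_pair 0 (i := 2) (j := 4) (by decide) (by decide)
              (.of_pair 0 (i := 0) (j := 1) (by decide) (by decide)
                (.of_refute 4000 0x5538d0a0a71a435850519634500e71a7151e5538cb325538e58d38d0de4a8b175a20a71a5538d192d258d3865329634414e375c664f2435881414e34aa71a325a3ad3865325538dd71993c90d62194668aa1c9c688 (by decide +kernel))
                (.of_refute 4000 0xa0a6954e3486b472c688963443b0c9c5510538d10aa29c688971938cb33547a58d14e34c31ce9d68829a718a0a71a2258d10a23269c686f254588a0a69c6850538d192d1d68829a70ca64aa718a0a71993c90d668aa1c9c688 (by decide +kernel)))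
              (.of_pair 0 (i := 1) (j := 4) (by decide) (by decide)
                (.of_pair 1 (i := 4) (j := 5) (by decide) (by decide)
                  (.of_refute 4000 0x75a20a71a34829c68c968aa71a70ca652c68829c62829c664f2435881414d4b1a525a39634e36579d69c549889634e39634d2a9a625a365794b1a71a8558aa9a71a30e7076194b1c69d966aa71bb3d1d69c68829c06d3aa9c75992a9a29c6694e34e3547932ac4298c9c688 (by decide +kernel))
                  (.of_refute 4000 0x2829c69c6a58d38d18ad2c68a688551040338d3327a1a5105329c6a30c73bad10534414d10538cd20a71a1bc8c9629c688 (by decide +kernel)))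
                (.of_pair 0 (i := 0) (j := 1) (by decide) (by decide)
                  (.of_refute 4000 0x5538d15538d15338142829c694566a352c69a315a31414e34cc9e92c69c6a30c73a9638e58d0de464b109c688 (by decide +kernel))
                  (.of_pair 2 (i := 2) (j := 3) (by decide) (by decide)
                    (.of_refute 4000 0xeb4410aa21a215064e2718a0a7014e34379109c688 (by decide +kernel))
                    (.of_refute 4000 0xa081410803271a71c6aa20a705053841a53441a532144684032a4c0d29c6885419a7198bc9d68820504298c9c71a71a315850538c14e32179d71a4459d71aa459d71a9459d71a8459d71a7459d71a6459d71a5459d71a405a2a9c3199109c688 (by decide +kernel))))))))))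
    (.of_pair 0 (i := 3) (j := 4) (by decide) (by decide)
      (.of_pair 1 (i := 4) (j := 5) (by decide) (by decide)
        (.of_pair 0 (i := 5) (j := 6) (by decide) (by decide)
          (.of_pair 1 (i := 6) (j := 7) (by decide) (by decide)
            (.of_refute 4000 0x154d0a0a694968e58d38d95e5538d38ed325538c50538d51e4cab19634414d3ad20ad1cb1a71a1bd2c69c54993ae39634414e3327921ac4c8e688 (by decide +kernel))
            (.of_refute 4000 0xeb8d14d38d0a0a71a655a1a538d34e3b4d2c69c70ef29634414e35538d95e4ecb19634d3ad20ad1cb1a71a1bd2c69c54993ae39634414e3327921ac4c8e688 (by decide +kernel)))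
          (.of_pair 0 (i := 5) (j := 7) (by decide) (by decide)
            (.of_refute 4000 0x5534414d0a0a688a0a68bb1ca4b472c68a71b2bc694d14e34e3b4ca58d14e375c68a71a32c68829c68bb1cecf26558aa9a29a1414d29ad1cb1a29c6caf3ad14e34e3b4c954e39634414e3547932ac4c8e688 (by decide +kernel))
            (.of_pair 2 (i := 5) (j := 6) (by decide) (by decide)
              (.of_refute 4000 0x1414d3445053458ce8e58d3547a3963444b1a221464e1a514d38cb3220a71bb3c88 (by decide +kernel))
              (.of_refute 4000 0x1410694d110e3271a71a34820d21c464e34e34c8b105392c69a21d69a22829c461ce10a338cb30a0a71a875850538e15e8eb4414e28ccaa29c4e294c2829c70cf3ad38e29cc2829c68829c69c8699d68829c6ecf0a0a71d66688 (by decide +kernel)))))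
        (.of_pair 2 (i := 4) (j := 5) (by decide) (by decide)
          (.of_pair 1 (i := 4) (j := 6) (by decide) (by decide)
            (.of_refute 4000 0x50538d14e39634414e345d71a20a71a2a6721bc42a9a69175a262734414e3445053454ce71cb1a20a71a1bc88761850534414e3327910694e34658e352c68c962a6745538d10538873221946688 (by decide +kernel))
            (.of_pair 4 (i := 3) (j := 5) (by decide) (by decide)
              (.of_refute 4000 0x12c68a68a71c688 (by decide +kernel))
              (.of_pair 3 (i := 1) (j := 5) (by decide) (by decide)
                (.of_refute 4000 0x2829c688 (by decide +kernel))
                (.of_pair 3 (i := 2) (j := 5) (by decide) (by decide)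
                  (.of_refute 4000 0x2829c688 (by decide +kernel))
                  (.of_pair 3 (i := 3) (j := 5) (by decide) (by decide)
                    (.of_refute 4000 0x2829c688 (by decide +kernel))
                    (.of_pair 4 (i := 5) (j := 6) (by decide) (by decide)
                      (.of_refute 4000 0x5041a4288c8a71a22828a68896344288ca670a0a20a6a34534594e0694e34538d10ea31a538e34538d10ca31a534414e34534658d1a538d192d2c68a698968d14238108c9c688 (by decide +kernel))
                      (.of_refute 4000 0x963444b1a29c68887193869041a4308c9c68a71a20a68aa8829c68ba1d2c68829c68c31c0d28a71a221861414538d110e31a538d105468829c681b3e2829c68a99c9c7699c688 (by decide +kernel))))))))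
          (.of_pair 4 (i := 4) (j := 5) (by decide) (by decide)
            (.of_pair 0 (i := 5) (j := 6) (by decide) (by decide)
              (.of_pair 1 (i := 2) (j := 3) (by decide) (by decide)
                (.of_refute 4000 0xd29a20a71a68d29a2aa2a073441453486b4688 (by decide +kernel))
                (.of_refute 4000 0x34a69a75a4258a1414d14534e8b355105374789a534d1a534e8b187381a53453469053484b14694d10534c8b334a6c8f175a29a75a4258ba1c21c68cd29c68a2694d16439bb3ca58d10534450534590e76588a0a71a20a65342829c699162ec74688 (by decide +kernel)))
              (.of_pair 0 (i := 1) (j := 2) (by decide) (by decide)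
                (.of_refute 4000 0x1a5345342829a29a2158a5514ca68a29a5259aa8a6a4f134a69a34a694962ca746eb45134a68a11ccc9e4694d175a2847192c5544d2c8702994e34d2a8829c68aa8a89ce229c690d626474688 (by decide +kernel))
                (.of_pair 0 (i := 6) (j := 7) (by decide) (by decide)
                  (.of_refute 4000 0x9634538d14e344d29c68a2ea734694d14d14e344d29a2c672699162eb4d151a2c874b1c68a69d961414d3aad2c68829a5158505375789a510534694d14d322d1bad14dd9e4aa29c68a69d962ca74688 (by decide +kernel))
                  (.of_pair 1 (i := 2) (j := 3) (by decide) (by decide)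
                    (.of_refute 4000 0x69442a8829c688511934d1a53486b4688 (by decide +kernel))
                    (.of_pair 0 (i := 5) (j := 7) (by decide) (by decide)
                      (.of_refute 4000 0x1a515513139c72c68a2694d13139a1414d14c8b175a2c874642f234a68a2159aa8a68a71a93c850538d14d1553454ce3258bad38d34554e34590e699a534d49e24274688 (by decide +kernel))
                      (.of_refute 4000 0x75a20a68aa8989ce4b1a289a5344c4e68505345322c5d68b21ce234a2aa2c87345d68829a20a11d110ac65335514d14e3527850538633275a29a2aa68b21c0a6694d15534594e4d4de464b134a2aa2c8734694d10414d10538d1484b31414d0de24274688 (by decide +kernel)))))))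
            (.of_pair 4 (i := 5) (j := 6) (by decide) (by decide)
              (.of_pair 1 (i := 4) (j := 8) (by decide) (by decide)
                (.of_refute 4000 0x4b1a29c69c688 (by decide +kernel))
                (.of_pair 2 (i := 4) (j := 8) (by decide) (by decide)
                  (.of_refute 4000 0x12c68a71a29c688 (by decide +kernel))
                  (.of_pair 4 (i := 3) (j := 4) (by decide) (by decide)
                    (.of_pair 1 (i := 4) (j := 7) (by decide) (by decide)
                      (.of_refute 4000 0x5053888 (by decide +kernel))
                      (.of_pair 2 (i := 1) (j := 4) (by decide) (by decide)
                        (.of_refute 4000 0x50534414414e3453888 (by decide +kernel))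
                        (.of_refute 4000 0xa083487519345334a20829a20a2eb4594e5510538d17538114145d8e02829a219464d0a0a71a208365e58d17338505105432c2828828a2a6737678d20a68829a29d969634534e34539ac690510538d1484b0a0a68b8d12139c688 (by decide +kernel))))
                    (.of_refute 4000 0x34829a29a22829a2ca7034a2886519c551053885325510538d192c658d105104c4e52c68a4359c688 (by decide +kernel)))))
              (.of_refute 4000 0x9638d14658d14e34658d1533a34590e0450517639352c68a71a29c68820d9792c68a71a29c688298369e58d14e345d0e71c688 (by decide +kernel))))))
      (.of_pair 0 (i := 4) (j := 5) (by decide) (by decide)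
        (.of_pair 0 (i := 2) (j := 3) (by decide) (by decide)
          (.of_pair 1 (i := 5) (j := 6) (by decide) (by decide)
            (.of_refute 4000 0x154d4b1a415a39634e3547954d38cb321414e35538d38d0de4a8b155352c690968e58d38d51e5534e32cc850538dd68829c69c686f25458909c9c688 (by decide +kernel))
            (.of_refute 4000 0x258d112c688101938d38c50538c85e4eb8d14e38d18ad2c69c620f234828829c6aa71993c885632c6882a34d3ad182d1cb1a71993c2829c43992a9c62829c686f23258909c9c688 (by decide +kernel)))
          (.of_pair 1 (i := 5) (j := 6) (by decide) (by decide)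
            (.of_refute 4000 0xaa6414d0a0a690968e58d10538d38a8f0a0a69c439954e3a4ca58d10538d2a2d1d71a7192642829a718a0a71b2bc9d962154e352c69c72c71993c909692c69c43992a9c6eb4414e34379192c43b0c9c688 (by decide +kernel))
            (.of_pair 0 (i := 1) (j := 3) (by decide) (by decide)
              (.of_refute 4000 0x4b1a2a34eb453462b472c68a71993c690534538d3843329634538cd29c688a0a71a242710bc8c9629c688 (by decide +kernel))
              (.of_pair 0 (i := 1) (j := 2) (by decide) (by decide)
                (.of_pair 2 (i := 2) (j := 3) (by decide) (by decide)
                  (.of_refute 4000 0x694e352c71a545a1a534538a93229c688 (by decide +kernel))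
                  (.of_refute 4000 0x12c68828a2aa71a29a220738dd68a68aa9a220738d38cc9e4694e38d14d212c694e37278d29c6c6f1a538d89e34a71a9bc694e34538d49e34a7190bc2829c660f1a538c81e8694d38e531a538e731a538e314c2829c68a718e675a71c5398d29c714a629c688 (by decide +kernel)))
                (.of_pair 1 (i := 1) (j := 2) (by decide) (by decide)
                  (.of_refute 4000 0x75a71a5538d212d154e21cca58e34a8b45538d38853275a718a0a71a1bc8c9629c688 (by decide +kernel))
                  (.of_refute 4000 0x1414e34eb89c6aa7190bc8c968694e34e34c394eeb8d212d154e324c954e31414e3547932ac43ad38d4b1a2154e344080c9c4e3442b2a9c69993d0d29c69c698819c50538538d54e32179192c4318c9c688 (by decide +kernel)))))))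
        (.of_pair 0 (i := 3) (j := 5) (by decide) (by decide)
          (.of_pair 0 (i := 2) (j := 4) (by decide) (by decide)
            (.of_pair 1 (i := 1) (j := 2) (by decide) (by decide)
              (.of_refute 4000 0x258e34414d34eb460b472c69c664f0a0a69c43992a9c62829c686f23258aa9a963484b472c69c6a8f2a9a719664eb8d54e343792a2c42a9a75a425a39634e2a3caa719664eb8e58d0de4a8b10ec3329c9c688 (by decide +kernel))
              (.of_refute 4000 0x963444b1a204064e34d4b1a315a31414e34c85e8eb8d14d38d461ca742829c68a29c69c62829c664f22158aa9a963482b472c69c6a8f2a9a719664eb8d54e343792a2c42a9a963482b472c69c5479d69c65993ae35538d0de4a8b10ec3329c9c688 (by decide +kernel)))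
            (.of_pair 0 (i := 4) (j := 6) (by decide) (by decide)
              (.of_pair 0 (i := 1) (j := 2) (by decide) (by decide)
                (.of_refute 4000 0x34a68a71c9634538d34694d2a2d10e64eb4534538d39ad2c68a6938d082d2c68a71a635a58d14e34a6b434a71ce69634538c731a538d384133ad38e29cca58e229c72c68a70d28a69c329990bc8c9629c688 (by decide +kernel))
                (.of_refute 4000 0x75a6a58d10aa71a204064d4688568cd29c69993d0d29c69c698819d1a538538d54e32179192c5d69c68d29c690965538d38a8f4b1a719664694e38e34a8b45538d38853275a29c72c686f23258909c9c688 (by decide +kernel)))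
              (.of_pair 1 (i := 5) (j := 6) (by decide) (by decide)
                (.of_refute 4000 0x2a9c69d71a645a1a414e2719664eb8d38d2a2d1d69c75993ad38c50538d95e4ecb10aa6954d212d1cb1a71aa3c2829c4e21cc9d719a414e343792a2c43b0c9c688 (by decide +kernel))
                (.of_refute 4000 0xaa20a71a71a1414414e34c8b4b1a545a0a0a69c69a7152634a71a71b23c2829c644f0a0a71d13c2829c724f0a0a71c13c2829c6e4f4b1a71a93c2829c640f1a414e34414e32179d69c714e652c68829a29c68d29c695168282994e34e2a4c8c9629c688 (by decide +kernel)))))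
          (.of_pair 0 (i := 2) (j := 3) (by decide) (by decide)
            (.of_pair 2 (i := 4) (j := 5) (by decide) (by decide)
              (.of_refute 4000 0x34829a29c68855108232688a0a68a91d18a0a71a29a1bd1c72c6caf229c688 (by decide +kernel))
              (.of_pair 4 (i := 4) (j := 6) (by decide) (by decide)
                (.of_refute 4000 0xa0a29c688 (by decide +kernel))
                (.of_refute 4000 0x690538d102829c688751a58d10538d10ca32718a0a20d219464dd9e4e0a0a7050510aa2144629a2690534484e8d10694515512039a2104696344320cd0a0a68a68c96887332cd2c69a20a71b23c2829c6eaf4b1c690969638d20ad050534e388533ad38eb3229c688 (by decide +kernel))))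
            (.of_pair 2 (i := 4) (j := 5) (by decide) (by decide)
              (.of_value 4 (i := 2) (v := 7) (by decide) (by decide)
                (.of_refute 4000 0x12c68829a20a71a29c688 (by decide +kernel))
                (.of_pair 4 (i := 2) (j := 4) (by decide) (by decide)
                  (.of_refute 4000 0x12c68828829c71a29c688 (by decide +kernel))
                  (.of_pair 4 (i := 1) (j := 4) (by decide) (by decide)
                    (.of_refute 4000 0x1d68828829c71a29c688 (by decide +kernel))
                    (.of_pair 2 (i := 1) (j := 3) (by decide) (by decide)
                      (.of_refute 4000 0x1d68829a20a71a29c688 (by decide +kernel))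
                      (.of_pair 3 (i := 0) (j := 3) (by decide) (by decide)
                        (.of_refute 4000 0x12c68829a20a71a29c688 (by decide +kernel))
                        (.of_pair 3 (i := 1) (j := 3) (by decide) (by decide)
                          (.of_refute 4000 0x1d68829a20a71a29c688 (by decide +kernel))
                          (.of_value 4 (i := 1) (v := 8) (by decide) (by decide)
                            (.of_refute 4000 0xa0a68829c688 (by decide +kernel))
                            (.of_pair 4 (i := 3) (j := 4) (by decide) (by decide)
                              (.of_refute 4000 0xa0829a2154414e344288c9a5510538d1053441464b31414e353783ad14d1042322154e34414d175a20a68b29c19061414416840bf1a29c688 (by decide +kernel))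
                              (.of_refute 4000 0x2829a21382829c68a68896344208c538d112c68829a21d688401a344188c9c329850538d14e2214461414e34538882119a29c688 (by decide +kernel))))))))))
              (.of_pair 4 (i := 2) (j := 4) (by decide) (by decide)
                (.of_refute 4000 0x2829a71a29c688 (by decide +kernel))
                (.of_pair 3 (i := 3) (j := 4) (by decide) (by decide)
                  (.of_refute 4000 0xa0a71a71a29c688 (by decide +kernel))
                  (.of_pair 4 (i := 4) (j := 5) (by decide) (by decide)
                    (.of_pair 2 (i := 0) (j := 3) (by decide) (by decide)
                      (.of_refute 4000 0xd20a71c688 (by decide +kernel))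
                      (.of_pair 2 (i := 3) (j := 6) (by decide) (by decide)
                        (.of_refute 4000 0xa0a71c688 (by decide +kernel))
                        (.of_pair 2 (i := 3) (j := 7) (by decide) (by decide)
                          (.of_refute 4000 0xa0a71c688 (by decide +kernel))
                          (.of_pair 3 (i := 3) (j := 6) (by decide) (by decide)
                            (.of_refute 4000 0x2829c69c688 (by decide +kernel))
                            (.of_pair 3 (i := 3) (j := 7) (by decide) (by decide)
                              (.of_refute 4000 0x2829c69c688 (by decide +kernel))
                              (.of_pair 0 (i := 2) (j := 4) (by decide) (by decide)
                                (.of_refute 4000 0x4b1a685041a4328c9a6458875a20c4662829babceb4414d95e29c688 (by decide +kernel))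
                                (.of_refute 4000 0x2829aa8829a20875a208464414e2a8829a68834829a204061414d10423220a71da6647954414414d322d18a0a650367c50534e8b0a0a6e8f01414d3443b0ce31414e3327a58d10538433229c688 (by decide +kernel))))))))
                    (.of_pair 4 (i := 3) (j := 4) (by decide) (by decide)
                      (.of_pair 4 (i := 5) (j := 6) (by decide) (by decide)
                        (.of_pair 0 (i := 1) (j := 2) (by decide) (by decide)
                          (.of_refute 4000 0x2829a29c688 (by decide +kernel))
                          (.of_pair 3 (i := 1) (j := 3) (by decide) (by decide)
                            (.of_refute 4000 0xa0a20a68829a29c688 (by decide +kernel))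
                            (.of_refute 4000 0x505102828851191551051213814d102829a20814144100c8b4450512138208c510538d10aa29a68d29a5358829c68834a289a534480e6884218c461414d192d18a0a650817c50510534414d18ac2828829a20a68c1629c688 (by decide +kernel))))
                        (.of_refute 4000 0x690538d102829c6883118a688963444b1a21cc64219cb1a218c6444b1a2886419a29c688 (by decide +kernel)))
                      (.of_refute 4000 0x50414e352c68896344188c5322c44b1a2190671a29c688 (by decide +kernel))))))))))))

theorem not_sortable_tableA : ¬ Sortable 5 (columns tableA) :=
  not_sortable_columns_of_sorted (by decide +kernel) refuted_tableA

/-- Another set of vectors that five layers cannot sort, closed under sorting. -/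
def tableB : ℕ := 0xfff0fffffffffff00fffffff0ffff3feffbc0ffffffff00f0ffffff0cfffcbfdff3ffffffff00f0ccfffff0cafff2ffafe0ff00fffff0ccaaffff0cafffcb3f4fc3acf0ff00ccaafffff0caf0ff2c3e8f830acc00f0aaff00ff0caf00fcb03d0f0300aaf0ccff0000f0caf000f2c03a0e00ff00ccaa0000000caf0000cb00340c0200ffaaff000000caf000002c002808000000ff00000000af000000b00010000300000000000000f0000000c000200

/-- The sorted columns of `tableB`. -/
def tableBSorted : ℕ := 0xffffffffffffffffffffffffffffffffffbfffffffffffffefffffffeffffbfeff3fffffffffffee8ffffffe8fffe3fcfe3effffffffee880fffffe80fff83f8fc38efeffffe88000ffffe800ffe03f0f8308e8fffe800000fffe8000ff803e0f030080fee8000000ffe80000fe003c0e020000e880000000fe800000f800380c0000008000000000e8000000e0003008000000000000000080000000800020000000000000000000000000000000000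

set_option maxHeartbeats 0 in
theorem refuted_tableB : (Knowledge.ofTables tableB tableBSorted).Refuted :=
  (.of_pair 0 (i := 2) (j := 3) (by decide) (by decide)
    (.of_pair 0 (i := 4) (j := 5) (by decide) (by decide)
      (.of_pair 1 (i := 3) (j := 4) (by decide) (by decide)
        (.of_refute 4000 0x4b1a71a9634a8b41414e34414e34e234a712a2ccb34b1a719a538d51e4cab155352c690568e58d38d51e5534e32cc954e375a71a1bc95162aa6a58d212d1cb1a71aa3ceb4e32cc954e31414e30538d0de4a8b1213994e688 (by decide +kernel))
        (.of_pair 2 (i := 3) (j := 4) (by decide) (by decide)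
          (.of_pair 0 (i := 6) (j := 7) (by decide) (by decide)
            (.of_refute 4000 0x3ad14e344d29c68a99d0d29c4554538d14e22a6732cc690534538d134a71cb1c6a8f22a6749634538cb322694e39634538d51e458ce655a58d14e35538d51e4594e688 (by decide +kernel))
            (.of_refute 4000 0x694e34554538d14e3454ce8694d14e34538a9329634538d175c68bae3458ce8d1753a3ad14e229c6599134a71cb1aa3c8bb1ccab134a719a538d51e4594e688 (by decide +kernel)))
          (.of_pair 4 (i := 3) (j := 4) (by decide) (by decide)
            (.of_pair 0 (i := 6) (j := 7) (by decide) (by decide)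
              (.of_refute 4000 0x258d144d29a2a67382829a1414d31ac53ad14e350cb375a29c70cf15534eb4a6b185394b1a29a2694d1753a1d62694e34534694e34eab1873a32cca58d14d11414d153399562eb45352c694d62ca74688 (by decide +kernel))
              (.of_refute 4000 0x1d68a2694d15339c34a69a75a3158a5514d34514d31acd54536378cb1a20a68d29a6358bb1caa29a68d28a68c962427465994b1a29a2694d153399562eb45342829c694d62ca74688 (by decide +kernel)))
            (.of_refute 4000 0x9634658d16339332c6a58d14e34c6b32a67434a688963443b0c9c9634538d14658d10516339c76991a534534534cab19634538d1653a58d14e345cce9634538d15339c5499c688 (by decide +kernel)))))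
      (.of_pair 1 (i := 3) (j := 4) (by decide) (by decide)
        (.of_pair 2 (i := 4) (j := 5) (by decide) (by decide)
          (.of_refute 4000 0x1414d14e3441a5344208cd19634414d1523a334a71a29a1bd1cb1b2bc88 (by decide +kernel))
          (.of_pair 4 (i := 4) (j := 6) (by decide) (by decide)
            (.of_refute 4000 0x2829c688 (by decide +kernel))
            (.of_pair 4 (i := 5) (j := 7) (by decide) (by decide)
              (.of_refute 4000 0x1d69c688 (by decide +kernel))
              (.of_pair 4 (i := 2) (j := 4) (by decide) (by decide)
                (.of_refute 4000 0x75a71c688 (by decide +kernel))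
                (.of_pair 2 (i := 1) (j := 4) (by decide) (by decide)
                  (.of_refute 4000 0x12c71c688 (by decide +kernel))
                  (.of_refute 4000 0x50538d102829c688751a58d14e344328c9c1414e0a0a71a20a6850538d1041a4328c8834a20834a204064d10c832694d622829a20505344080cd109c2829a2840be2829a29a325a21cccb34b1a68829c6c8f0a0a71babceb4414e3657a58e3484b4688 (by decide +kernel)))))))
        (.of_pair 2 (i := 3) (j := 4) (by decide) (by decide)
          (.of_pair 1 (i := 4) (j := 5) (by decide) (by decide)
            (.of_refute 4000 0xa0a71c71a2050538e38d1082341414e39634414e3443547a58d10538d15510534538d12139a2194684330a0a71a20a611679638d1313a0a0a68a71d66688 (by decide +kernel))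
            (.of_value 4 (i := 5) (v := 4) (by decide) (by decide)
              (.of_refute 4000 0xa0a71a20a688 (by decide +kernel))
              (.of_value 3 (i := 5) (v := 4) (by decide) (by decide)
                (.of_refute 4000 0x2829a29c68829c688 (by decide +kernel))
                (.of_pair 4 (i := 2) (j := 4) (by decide) (by decide)
                  (.of_refute 4000 0x75a29a29c688 (by decide +kernel))
                  (.of_pair 4 (i := 4) (j := 5) (by decide) (by decide)
                    (.of_refute 4000 0x963444b1a210464e4b1a29c3299175c68a68834a688511a3440a0a68bad105468a11c19466a674688 (by decide +kernel))
                    (.of_refute 4000 0x258d105382828829c688963444b8c9a29c6599c44d29c68829c68829c71a32c68829c68a11d1a2050534e34658d10538d16438328d14ce688 (by decide +kernel)))))))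
          (.of_pair 4 (i := 3) (j := 4) (by decide) (by decide)
            (.of_pair 4 (i := 5) (j := 6) (by decide) (by decide)
              (.of_pair 0 (i := 5) (j := 6) (by decide) (by decide)
                (.of_refute 4000 0x1d68a69a688a0a68bb1d2c68829a4258a6282881414e344208c9a9bc2829a29a53585053488b0a0a6a9161414d4a2c2829a8459544168a71a20a699161414d20ac2829a4058d29a8bc694d49e2694d145544c0e0534414d0a0a68a694d62a874688 (by decide +kernel))
                (.of_pair 0 (i := 4) (j := 6) (by decide) (by decide)
                  (.of_refute 4000 0x505345134a288a0a2a47028989cd1a534534529ac5d68829a2a67352c68a68829a20896345344438c9bb2d2c68a698969634534c8b1a514e59e34a29a28a6c8f0a0a71a29c33c4d29a685053464b14690534a6b355105353790a0a699562ec74688 (by decide +kernel))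
                  (.of_refute 4000 0x2a9a75a3158a34a694d66eb4535378aa9a20989c85053482b334a682f11414d0a0a690962a8725510510aa225c64d345342820a68a68a99c2829c68828a688a0a68aa1c9a13c42b175a29a20a68bad15339a141455454ce68828a68c9624274688 (by decide +kernel))))
              (.of_refute 4000 0x1414d105345d68829a2c67375a29b2bc4d29a8d2a9a20a68c962a67096345352c695162954414d14d29accd29a2a34535378aa8a6954538d29ac550e0ca34688 (by decide +kernel)))
            (.of_pair 4 (i := 4) (j := 5) (by decide) (by decide)
              (.of_pair 1 (i := 3) (j := 7) (by decide) (by decide)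
                (.of_refute 4000 0x4b1a29c69c688 (by decide +kernel))
                (.of_pair 1 (i := 3) (j := 8) (by decide) (by decide)
                  (.of_refute 4000 0x4b1a29c69c688 (by decide +kernel))
                  (.of_pair 1 (i := 3) (j := 9) (by decide) (by decide)
                    (.of_refute 4000 0x4b1a29c69c688 (by decide +kernel))
                    (.of_refute 4000 0x5041a4320c88a0a21544320ca8734694d10529ac4d20a68828a99ce58d14e344145345382829c68828a688a0a68a99c9c769a58d14d029d566caf4b1a29c68aa35a58d14e34549ad2c68a71a2a0d69634538d14e6b4b1a29c68d19d1c688 (by decide +kernel)))))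
              (.of_refute 4000 0x963444b1a2104689c75a20a71a20a70ca64519634538d19638d142394ce71c688 (by decide +kernel)))))))
    (.of_pair 1 (i := 2) (j := 3) (by decide) (by decide)
      (.of_pair 0 (i := 3) (j := 4) (by decide) (by decide)
        (.of_pair 0 (i := 1) (j := 2) (by decide) (by decide)
          (.of_pair 1 (i := 4) (j := 5) (by decide) (by decide)
            (.of_refute 4000 0x5534aa71a645a39634e34e32bcaa71a71da64aa71cb1aa3c99562258d351a69d690568e58d38d0de75a715264aa71cb1aa3c90d621946688 (by decide +kernel))
            (.of_refute 4000 0x1414e34e34690534554544e7138d21ad050538d14d38873234a719a538d0de4a8b034a71a71a34a68834a688701938e3486b475a2a34e21cc8d29c6694e343792a2c1946688 (by decide +kernel)))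
          (.of_pair 1 (i := 4) (j := 5) (by decide) (by decide)
            (.of_pair 0 (i := 5) (j := 6) (by decide) (by decide)
              (.of_refute 4000 0x5534aa68c568e58d38d0de5538d38653275a71cb1a71993c90d6688 (by decide +kernel))
              (.of_refute 4000 0x258d34aa71a645a39634e3444b1a2144671d6882850538d31ace3b4c9b2bd0d20a71a20a69c721a642829a718a0a71a20a71aa3c99562154d34aa71a635a375a71a5538d322ccaf275a71cb1aa3c995621486688 (by decide +kernel)))
            (.of_pair 0 (i := 2) (j := 5) (by decide) (by decide)
              (.of_refute 4000 0x2a9a29c62829c68a6a8f232c68b8d1a538d20ac544e70d29c69a75a435a194c694e3327a58d34e3527a58d14e35178d29c69c682f3ad388533ad38d34e20cc694d38e18cc954e35514e344d29c68a09ce332791a538d182d154e31cceb4e29cc8856688 (by decide +kernel))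
              (.of_refute 4000 0x690690ca3229c69c6850538d21ac44b1a20a68a69c68d29c690d60c43455144d28881cc14d10538d38a58d38d10694d104034435952634a69c62828834a2080671a1bc9516688 (by decide +kernel)))))
        (.of_pair 0 (i := 2) (j := 4) (by decide) (by decide)
          (.of_pair 0 (i := 1) (j := 3) (by decide) (by decide)
            (.of_pair 1 (i := 4) (j := 5) (by decide) (by decide)
              (.of_refute 4000 0x5534d3ad20ad1cb1a71a1bcaa7138a93275c6aa71993c90d62258d351a69d690568e58d38d0de75a715264aa71cb1aa3c90d621946688 (by decide +kernel))
              (.of_refute 4000 0x50538d38d4b1a20a68aa8a89ce271a435a0a0a71a29a710e64694e334a71a1bc951612c69c6a58d21ad154554590e0d388d29a2694d14d151383453890d6549a58d38cd29c686f25459946688 (by decide +kernel)))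
            (.of_pair 0 (i := 3) (j := 5) (by decide) (by decide)
              (.of_refute 4000 0x12c68a71a34a71c698d692c69c54991a538d21ad1d71a714e64eb4538e58d51e4cab15538d2a9c68c5692c69c32994b1a29c690d68eb4e18cc9d69c6aa6538cc9e442b16438d29c68d29c690d68694d3887325538d54e343792a2c594e688 (by decide +kernel))
              (.of_pair 1 (i := 4) (j := 5) (by decide) (by decide)
                (.of_refute 4000 0x50534aa71a645a39634e3444b1a2144671d68829c68d20a6991671da6657850538d34e434c9d69c62829a71aa3c99562154d2a9a315a39634e3437954e34e194c9d71cb1a71993c90d621946688 (by decide +kernel))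
                (.of_refute 4000 0xaa21545344288cca71a20a71a71a34a71a435a1a510534e21cc2829c65994b1a20a71aa9a20a71a1bc9516688 (by decide +kernel)))))
          (.of_pair 0 (i := 1) (j := 2) (by decide) (by decide)
            (.of_pair 0 (i := 3) (j := 5) (by decide) (by decide)
              (.of_refute 4000 0x258d34eb4a6b462829c68a71a71a5538ca71a4259c4379d71a719264eb4538e58d51e486b175a20a71a9634a6b41414d38a9321414e3963547921ac594e688 (by decide +kernel))
              (.of_pair 0 (i := 4) (j := 5) (by decide) (by decide)
                (.of_pair 2 (i := 3) (j := 4) (by decide) (by decide)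
                  (.of_refute 4000 0x1414d14e34450532c87471cb1aa3c88 (by decide +kernel))
                  (.of_pair 4 (i := 4) (j := 6) (by decide) (by decide)
                    (.of_refute 4000 0xd29c69c688 (by decide +kernel))
                    (.of_pair 4 (i := 4) (j := 7) (by decide) (by decide)
                      (.of_refute 4000 0x34a71c688 (by decide +kernel))
                      (.of_pair 4 (i := 1) (j := 3) (by decide) (by decide)
                        (.of_refute 4000 0x1d71a29c688 (by decide +kernel))
                        (.of_pair 4 (i := 4) (j := 8) (by decide) (by decide)
                          (.of_refute 4000 0x34a71c688 (by decide +kernel))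
                          (.of_refute 4000 0x34a71c68834a71c688761938d1a538e34529ac0a7154d10538d34694d212d0ca675a20a71993c2829c662f1a538cc1e34a7114e34e6b4b1a29c699569638d19ad2c71aa35a58e3526b4b1c6a0d61414e3464b4b1c68c569638d182d0d29c7252634a70c26688 (by decide +kernel)))))))
                (.of_pair 1 (i := 4) (j := 5) (by decide) (by decide)
                  (.of_refute 4000 0xa0a71a71cb1a71a1bc954e38d29ad154e31ccaa714e64694e30538e58d38cc9e486b10aa71a9634a6b46aa71a7195e9634e3b4c850538e38d32ad154e29cc8d29c60a71cb1a71993c90d621946688 (by decide +kernel))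
                  (.of_refute 4000 0xa0a71a8d38d1a538d10ace4b1a20d29a20c0669a75a29a425a21ccaa714e652c68829c71cb1aa3c90d6688 (by decide +kernel)))))
            (.of_pair 0 (i := 1) (j := 3) (by decide) (by decide)
              (.of_pair 2 (i := 3) (j := 4) (by decide) (by decide)
                (.of_refute 4000 0x4b1a20a715442a886418834a215064d155140a71a2050532150628a09d18a0a71a29993d0d3029c71cb1aa3c88 (by decide +kernel))
                (.of_pair 4 (i := 4) (j := 6) (by decide) (by decide)
                  (.of_refute 4000 0x75a71c688 (by decide +kernel))
                  (.of_pair 4 (i := 2) (j := 4) (by decide) (by decide)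
                    (.of_refute 4000 0x4b1a20a71c688 (by decide +kernel))
                    (.of_pair 4 (i := 1) (j := 3) (by decide) (by decide)
                      (.of_refute 4000 0x12c68829c69c688 (by decide +kernel))
                      (.of_pair 2 (i := 0) (j := 3) (by decide) (by decide)
                        (.of_refute 4000 0x12c71c688 (by decide +kernel))
                        (.of_pair 2 (i := 1) (j := 3) (by decide) (by decide)
                          (.of_refute 4000 0x12c71c688 (by decide +kernel))
                          (.of_pair 3 (i := 0) (j := 4) (by decide) (by decide)
                            (.of_refute 4000 0x2829c688 (by decide +kernel))
                            (.of_pair 3 (i := 1) (j := 4) (by decide) (by decide)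
                              (.of_refute 4000 0x12c68829c688 (by decide +kernel))
                              (.of_pair 3 (i := 4) (j := 5) (by decide) (by decide)
                                (.of_refute 4000 0x12c69c688 (by decide +kernel))
                                (.of_pair 3 (i := 4) (j := 6) (by decide) (by decide)
                                  (.of_refute 4000 0x12c68829c688 (by decide +kernel))
                                  (.of_pair 3 (i := 4) (j := 7) (by decide) (by decide)
                                    (.of_refute 4000 0x2829c688 (by decide +kernel))
                                    (.of_pair 3 (i := 4) (j := 8) (by decide) (by decide)
                                      (.of_refute 4000 0x2829c688 (by decide +kernel))
                                      (.of_refute 4000 0x34829c6883485219c69c718a0834854193444b1a2081410a83222829a20a69a282746882019c684f0a0a7050534410690a83271a6881414d14d0a0a68829c694d60a432a8a694961414d14d10ad0ca6549850538d11e1414e3a47850538e51e688 (by decide +kernel))))))))))))))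
              (.of_pair 0 (i := 3) (j := 5) (by decide) (by decide)
                (.of_pair 1 (i := 5) (j := 6) (by decide) (by decide)
                  (.of_refute 4000 0xeb4e342829c694d68eb4d38a93275a20a71cb1c68820a71a71993c90d6688 (by decide +kernel))
                  (.of_refute 4000 0x34a20a71c68d29c68834a71a208068d31ac2829c68c694d68aa714e634a718e64694e3486b39634e3547a3ad14e34530a93a1414e342829c68a71cb1a29c68cb1a2a87468834a0538d11414e34550e0c432a3c90d68aa68829c698639d956688 (by decide +kernel)))
                (.of_pair 2 (i := 3) (j := 4) (by decide) (by decide)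
                  (.of_refute 4000 0x34829a20505344288caa20a1414a4b344208c2829a215064e3441a534450534594e71a2258d14e38694e34554550e6e38eb3221486631a0a0a71966688 (by decide +kernel))
                  (.of_pair 4 (i := 3) (j := 5) (by decide) (by decide)
                    (.of_refute 4000 0x2a9c688 (by decide +kernel))
                    (.of_pair 4 (i := 1) (j := 3) (by decide) (by decide)
                      (.of_refute 4000 0x2829c69c688 (by decide +kernel))
                      (.of_pair 4 (i := 2) (j := 4) (by decide) (by decide)
                        (.of_refute 4000 0x2a9c688 (by decide +kernel))
                        (.of_pair 2 (i := 0) (j := 3) (by decide) (by decide)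
                          (.of_refute 4000 0x2829c71c688 (by decide +kernel))
                          (.of_pair 2 (i := 1) (j := 5) (by decide) (by decide)
                            (.of_refute 4000 0x34829c71c688 (by decide +kernel))
                            (.of_pair 3 (i := 2) (j := 3) (by decide) (by decide)
                              (.of_refute 4000 0x2a9c688 (by decide +kernel))
                              (.of_pair 4 (i := 0) (j := 2) (by decide) (by decide)
                                (.of_refute 4000 0x2829c69c688 (by decide +kernel))
                                (.of_pair 3 (i := 3) (j := 6) (by decide) (by decide)
                                  (.of_refute 4000 0x2a9c688 (by decide +kernel))
                                  (.of_pair 4 (i := 3) (j := 4) (by decide) (by decide)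
                                    (.of_refute 4000 0x258d105342829c68834a2aa2a87029a20a71a218c631583ad14d10ca30a0a698961414d292d18a0a20a08afbad31ac2829b13c2829a93d18a0829c4c85e1414e34414c484e9c688 (by decide +kernel))
                                    (.of_pair 4 (i := 4) (j := 5) (by decide) (by decide)
                                      (.of_refute 4000 0x34829a2258d1082325514554440e0a8338d0a0829c688215171414d10e83275a645a3442a9a29a2eb4544e0a43334829c69a93c0a71a20a20d208348641934c5041a4288c9c69a685040a0a6884119212ccaf1040338d0a0a662b4688 (by decide +kernel))
                                      (.of_refute 4000 0xd208348511938cd20a71a20d214864d95e441405041a4208c9c6882019c69c688 (by decide +kernel))))))))))))))))))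
      (.of_pair 0 (i := 5) (j := 6) (by decide) (by decide)
        (.of_pair 1 (i := 4) (j := 5) (by decide) (by decide)
          (.of_pair 0 (i := 3) (j := 4) (by decide) (by decide)
            (.of_refute 4000 0xeb4414e34eb8d14e3484b434829c69a70ca69634e321791a414d38d54e34379192c554d4b1a525a39634e3657954d38ed321414e39634414e3547932ac5d8e688 (by decide +kernel))
            (.of_pair 0 (i := 2) (j := 4) (by decide) (by decide)
              (.of_refute 4000 0x75a20a71a34a69c68c968694d38d3865329638d54538cc9e486b19634d2a9c6a1968e58d38d390ef2a9c69c98992a9c72c6ecf2875885534d3ad312d1cb1a71b2bc694e2a4c9d71aa9c6a8f2655888719d8e688 (by decide +kernel))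
              (.of_pair 1 (i := 6) (j := 7) (by decide) (by decide)
                (.of_refute 4000 0x154e34aa71a855a2a9c76993ae38e34cab45538d390d3275a71aa9c6ecf2875885534534eb4e4b472c68a71c3bd2c69c69c98992a9c6aa71bb3ca1d6225c65534eb4a4b472c69c6caf1a538a93275c6aa71aa3c9956221c6688 (by decide +kernel))
                (.of_refute 4000 0xd29c69c6a58d38d21ad154e2a4c9d71a5259d71a535a2a9c75992a9c6aa71b2bc9d9621d69c68d29c68c9634a71a71a5538d192c86f0a0a71c6aa71993c90d621d06688 (by decide +kernel)))))
          (.of_pair 2 (i := 4) (j := 5) (by decide) (by decide)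
            (.of_pair 1 (i := 3) (j := 5) (by decide) (by decide)
              (.of_refute 4000 0x2a9a2aa2c47020a20a71a29c72c68a71a22829c68b21c0a71b2bc8875a29c72c68a71b2bc9cb1a29c6ecf11414e345d8e8eb8ed32210c6688 (by decide +kernel))
              (.of_pair 4 (i := 1) (j := 4) (by decide) (by decide)
                (.of_refute 4000 0xd29a28a71c688 (by decide +kernel))
                (.of_pair 4 (i := 1) (j := 3) (by decide) (by decide)
                  (.of_refute 4000 0xa0a71a20a71a29c688 (by decide +kernel))
                  (.of_pair 4 (i := 3) (j := 5) (by decide) (by decide)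
                    (.of_refute 4000 0x690538dc688 (by decide +kernel))
                    (.of_pair 4 (i := 3) (j := 6) (by decide) (by decide)
                      (.of_refute 4000 0x2829a29c688 (by decide +kernel))
                      (.of_pair 4 (i := 4) (j := 6) (by decide) (by decide)
                        (.of_refute 4000 0x75a29c688 (by decide +kernel))
                        (.of_pair 4 (i := 4) (j := 7) (by decide) (by decide)
                          (.of_refute 4000 0x34a68a29c688 (by decide +kernel))
                          (.of_value 4 (i := 2) (v := 7) (by decide) (by decide)
                            (.of_refute 4000 0x34a71a20a71a688 (by decide +kernel))
                            (.of_refute 4000 0x50538d14e58e34538d95e4538690538d112c688431938d14cd20a68814144108c9a29a29b1bd10e634829c6c8f0a0a6882a310339a534534538a530a0a29c682f375a20a7198bc99a5029a20a68a71993c88 (by decide +kernel))))))))))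
            (.of_pair 4 (i := 4) (j := 5) (by decide) (by decide)
              (.of_pair 1 (i := 6) (j := 7) (by decide) (by decide)
                (.of_refute 4000 0xa0a65342829c688963443a0cc8b4688 (by decide +kernel))
                (.of_pair 2 (i := 6) (j := 7) (by decide) (by decide)
                  (.of_refute 4000 0x75a20a72c71a29b23caa68aa8a91c0a6caf4688 (by decide +kernel))
                  (.of_pair 4 (i := 6) (j := 7) (by decide) (by decide)
                    (.of_pair 0 (i := 7) (j := 8) (by decide) (by decide)
                      (.of_refute 4000 0x14145352c68a6991628d29a21d688301938d21acdd68a71a686f15534eb4a4b153383ad34eb484b14694d10accd29a2990bc5d68a68d29a29a2158a91c154d3ad292c53ad14d3aaccd29babc5d68a69d69a29a2158a91c08468dd68a2694508e664f234a68bad14238c9608634688 (by decide +kernel))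
                      (.of_pair 0 (i := 3) (j := 4) (by decide) (by decide)
                        (.of_refute 4000 0x1a5345d68a09ccd29a29a34a690962c874b1a20a6c8f134a6850534c8b186382a9a34a6949629d68a690966eb4534278bad14d3ad3453442b15238108d1bad144d28a11ccc9e4694e34414d134a68a99c64b4688 (by decide +kernel))
                        (.of_pair 0 (i := 2) (j := 4) (by decide) (by decide)
                          (.of_refute 4000 0x4b1a29a6a58d14d322c51a53443ad10603271a4359bad14e34d0de2aa69d694962a674688 (by decide +kernel))
                          (.of_refute 4000 0x75a29a29a1414d21ac53ad14e34534c8b334a6c8f15534eb4c8b186381a5345d68a11caa69a2aa68a91cc87334a6c8f15534eb4c8b186384b8c694d175a28474b1a2c8734eb45432ccd29b23c554d3ad322c618e13034688 (by decide +kernel)))))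
                    (.of_refute 4000 0x6905344505345d4e8d3ad106944218ca1962690510518639c688 (by decide +kernel)))))
              (.of_pair 4 (i := 3) (j := 4) (by decide) (by decide)
                (.of_pair 1 (i := 1) (j := 5) (by decide) (by decide)
                  (.of_refute 4000 0x12c69c688 (by decide +kernel))
                  (.of_pair 2 (i := 1) (j := 5) (by decide) (by decide)
                    (.of_refute 4000 0x4b1a29c688 (by decide +kernel))
                    (.of_pair 3 (i := 1) (j := 3) (by decide) (by decide)
                      (.of_refute 4000 0x34829c688 (by decide +kernel))
                      (.of_pair 2 (i := 2) (j := 3) (by decide) (by decide)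
                        (.of_refute 4000 0x1414d10694d10423271c688 (by decide +kernel))
                        (.of_refute 4000 0x694e345134a68828b21ce352c68896344210c538d150cb19634534e34618e34a69c68829a2a474b1a29a0510ad2c68b11d258d1445053450ce0694510863271da634a29c68a6558d29c68aa9c68a91cec70a0a71a20a71a29d9671c688 (by decide +kernel))))))
                (.of_refute 4000 0x12c6a58d14a4b19634548e71c688 (by decide +kernel))))))
        (.of_pair 0 (i := 4) (j := 5) (by decide) (by decide)
          (.of_pair 1 (i := 5) (j := 6) (by decide) (by decide)
            (.of_pair 0 (i := 6) (j := 7) (by decide) (by decide)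
              (.of_refute 4000 0x258d14d38d0a0a71a765a4b1a711a5389d96879a58d14e35538dd9e50eb15534eb4c4b472c69c6ecf2a9a721e64aa71cb1a71b2bc9d962aa69d698d68e58d38dd9e75a721e64aa71bad38d95e4ecb1423a1ce688 (by decide +kernel))
              (.of_pair 0 (i := 6) (j := 8) (by decide) (by decide)
                (.of_refute 4000 0x5534414d3ad312d1cb1a22829c68ba1ce34e3b3c694e34e4bcca58d15518739c72c68a7154e3b4ce1de4ecb15534534eb4c6b472c68a71bb3ceb4414e34e43cc954e31414e365793b2c508e688 (by decide +kernel))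
                (.of_pair 2 (i := 6) (j := 7) (by decide) (by decide)
                  (.of_refute 4000 0x34a69a26905345d0e8e58d3657a352c6aa71b2bc8829c6a58d14e4b1a29c7699a2258687788 (by decide +kernel))
                  (.of_refute 4000 0x12c69a2258d14d1a5350cb112c338c5053441a53444c0c9c69c6954e3441a538d110e3271a7558829c767850538e5de75a20a718a69634414e31cceb4e38c933ad10538e1de1414e34e34414c13ce2829c68829c69c725e6688 (by decide +kernel)))))
            (.of_pair 2 (i := 5) (j := 6) (by decide) (by decide)
              (.of_pair 1 (i := 5) (j := 7) (by decide) (by decide)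
                (.of_refute 4000 0xa0a71a20834a688861938d15534eb464b10532c87472c68a71a2aa71a286738d51e441a538d1a538e58e3767943ad258e345390f3221d86688 (by decide +kernel))
                (.of_value 4 (i := 7) (v := 2) (by decide) (by decide)
                  (.of_refute 4000 0x2a8a71a20a71a20a688 (by decide +kernel))
                  (.of_pair 4 (i := 4) (j := 6) (by decide) (by decide)
                    (.of_refute 4000 0x12c68a68a71c688 (by decide +kernel))
                    (.of_pair 3 (i := 2) (j := 6) (by decide) (by decide)
                      (.of_refute 4000 0x2a8829c688 (by decide +kernel))
                      (.of_pair 3 (i := 3) (j := 6) (by decide) (by decide)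
                        (.of_refute 4000 0x2a8829c688 (by decide +kernel))
                        (.of_pair 3 (i := 4) (j := 6) (by decide) (by decide)
                          (.of_refute 4000 0xa0829c688 (by decide +kernel))
                          (.of_pair 4 (i := 6) (j := 7) (by decide) (by decide)
                            (.of_refute 4000 0x690538d112c6886219382820a71a20505104232715264554414d14d112c6886219345d8e0694e38d14e3443b0c9c688 (by decide +kernel))
                            (.of_refute 4000 0x258d112c68a71a226064e1a534414d155345d0e71a2aa20a71a2050538d110e33b1c258d14e3443b0c9c8799c688 (by decide +kernel)))))))))
              (.of_pair 4 (i := 5) (j := 6) (by decide) (by decide)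
                (.of_refute 4000 0x4b1a20a68cb1a2a4738d1a4268896344310c9a269053454ce8cc9675a20a69a1bd154e214ca58e345345d69a2a67029cb1c68a6c8f243588a0a2aa262734e34414e34d1a534a8b1423850511414548e69a34a6951628674688 (by decide +kernel))
                (.of_pair 4 (i := 6) (j := 7) (by decide) (by decide)
                  (.of_pair 1 (i := 1) (j := 5) (by decide) (by decide)
                    (.of_refute 4000 0x4b1a29c69c688 (by decide +kernel))
                    (.of_pair 2 (i := 1) (j := 5) (by decide) (by decide)
                      (.of_refute 4000 0x12c68a71a29c688 (by decide +kernel))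
                      (.of_pair 2 (i := 5) (j := 9) (by decide) (by decide)
                        (.of_refute 4000 0x4b1a29c688 (by decide +kernel))
                        (.of_pair 4 (i := 4) (j := 5) (by decide) (by decide)
                          (.of_pair 3 (i := 7) (j := 8) (by decide) (by decide)
                            (.of_pair 1 (i := 2) (j := 5) (by decide) (by decide)
                              (.of_refute 4000 0x12c68829c688 (by decide +kernel))
                              (.of_refute 4000 0x2a8829c6885514d11303229c1414d1041a5344310c9a2aa20a29a2154d10423211cd0a0a20a68829a290d62aa20a69a28670a0a71a20a28a54581a538d10534414e345112630a0a68a20a7259c989a58d18439c688 (by decide +kernel)))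
                            (.of_refute 4000 0x69041a4430c8b445041a4430c9a20a2ea71a534414d18539c688 (by decide +kernel)))
                          (.of_refute 4000 0x694e334a71a1bc8a6658d10534658d10aa21d867539a2c874688 (by decide +kernel))))))
                  (.of_refute 4000 0x963444688348761919634538d19634590e8d105d4e4d4b1a29c688209d792c68a71a20a609e79634614e71c688 (by decide +kernel))))))
          (.of_pair 1 (i := 4) (j := 5) (by decide) (by decide)
            (.of_pair 0 (i := 4) (j := 6) (by decide) (by decide)
              (.of_pair 0 (i := 3) (j := 5) (by decide) (by decide)
                (.of_refute 4000 0x75a20a71a75c68a71a425a1a414e34d4b1a425a194c690534e35538d0de464b155352c694968e58d38d95e5534e3b4c850538d54e34e3547932ac5d8e688 (by decide +kernel))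
                (.of_pair 0 (i := 2) (j := 5) (by decide) (by decide)
                  (.of_refute 4000 0x3ad10538d1a534e3464b434a69c69c32994b1c6aa29c664f24358aa9a69d698968e58d38d95e9634e3b4c9d71aa9c6a8f2655885534d3ad312d1cb1a71b2bc694e2a4c9d71aa9c6a8f2655888719d8e688 (by decide +kernel))
                  (.of_refute 4000 0x1d69a5538d10690423268a71a325a31414e34e34694e3464b21bc850538e35538cc9e486b10eb4e34694e3464b1a538d38d1a538d192c86f0a0a71c6aa71993c90d621d46 (by decide +kernel))))
              (.of_pair 0 (i := 3) (j := 4) (by decide) (by decide)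
                (.of_pair 0 (i := 2) (j := 5) (by decide) (by decide)
                  (.of_refute 4000 0x4b1a68d29a645a31414d106910e3271a71a1414d112c688871938d38d322ccaf234a688a0a68b19d1cb1a6a8f472c6ecf265588 (by decide +kernel))
                  (.of_pair 2 (i := 5) (j := 6) (by decide) (by decide)
                    (.of_refute 4000 0x4b1a2258d10e432a8829c688621938dd68829a2258d110c33444b1a21d864e0a0a69c6599bb3c88 (by decide +kernel))
                    (.of_refute 4000 0x5538cd20a20a69c664f26aa6a8f2a9a2a34d4de8c5053441a4438c9c69c685040a08621938d322c414e34e32bceb4e294c2829c68829a71c8699d69c714e6688 (by decide +kernel))))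
                (.of_pair 0 (i := 2) (j := 4) (by decide) (by decide)
                  (.of_pair 0 (i := 3) (j := 5) (by decide) (by decide)
                    (.of_refute 4000 0x9634d1a534c8b462829a20d29a221c64e34e342829a20d29c688871938d38d322ccaf255345345d68b11d1cb1a6a8f472c6ecf265588 (by decide +kernel))
                    (.of_pair 2 (i := 5) (j := 6) (by decide) (by decide)
                      (.of_refute 4000 0x4b1a2258d10ec344aa20a71a26905345d8e0c6338e58d10aa21d46718a0a71aa3c8a7050534e32cc0a71bb3c88 (by decide +kernel))
                      (.of_refute 4000 0x3ad14e35538d0de4cd20a68829c69b23d18a0a68834a688871938d10538d4b18a0a0538d0de4c8b38caf4b1a71a20a69c721a6688 (by decide +kernel))))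
                  (.of_pair 0 (i := 3) (j := 5) (by decide) (by decide)
                    (.of_refute 4000 0x9634414e344112c6888719352c694968e58d1963441633938d102829a20d29a221c64e34e342820d29c688621938d322c4208ce32bceb4e390d32963444b1a21c8696344310c9c71cb1bb3c9956688 (by decide +kernel))
                    (.of_pair 0 (i := 2) (j := 5) (by decide) (by decide)
                      (.of_refute 4000 0x9634538d3ad21ad2c694d68c5053441a5344438c9c68829c6a58c505029c686f26459c6579d69c721a652c68896344498ca58d1551763906319c71cb1bb3c9956688 (by decide +kernel))
                      (.of_refute 4000 0x6905312c688621946a58d29ace58d3647a31414e3657850538ed33ad38a533ad38a7321410690403271a71a75c690d68eb4e21cc9956688 (by decide +kernel)))))))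
            (.of_pair 1 (i := 5) (j := 6) (by decide) (by decide)
              (.of_pair 0 (i := 6) (j := 7) (by decide) (by decide)
                (.of_pair 2 (i := 4) (j := 5) (by decide) (by decide)
                  (.of_refute 4000 0x50538d10694d10a434718a0a718a0a6814e34450538d17439c6caf21bc88 (by decide +kernel))
                  (.of_refute 4000 0x690534414d1044b1a68834a68853190864e342829c694d61414e34e34aa71a5258829c547850538d09e1414e4accaa20a71a20a7216675a71c7599d71a710a6688 (by decide +kernel)))
                (.of_pair 0 (i := 4) (j := 6) (by decide) (by decide)
                  (.of_pair 0 (i := 5) (j := 7) (by decide) (by decide)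
                    (.of_refute 4000 0x12c69c68d29c69d968694e34534e3b4c8d29c6aa71bb3ca1d612c69c68d29c69d968694e34534e3b4c8d29c6aa71bb3ca1d6130315534d3ad3a2d1cb1a71bb3d2c69c87993ae35538d95e4ecb10694d34eb4e8b472c69c6ecf2a9a721e64eb8cd29c6caf276588981a1ce688 (by decide +kernel))
                    (.of_pair 0 (i := 3) (j := 5) (by decide) (by decide)
                      (.of_refute 4000 0x258d352c68829a755a31414d10694d11303271a71a9634414d10aa71a21c864e34e34e34eab3b3ca58d112c68887191a538d15518738390d1c72c70ef276588 (by decide +kernel))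
                      (.of_pair 0 (i := 2) (j := 5) (by decide) (by decide)
                        (.of_refute 4000 0x34a71a34a71a435a4b1a710e64eb8d29ad154e4b4caa721a64aa71a20a688963444c0c9a6aa71c2bd1c72c70ef27658aa9c6a58d322d1aa9c6954e34eab3b3ceb8d2a2d154e4b4caa721a64eb4e31414e365793b2c50ce688 (by decide +kernel))
                        (.of_refute 4000 0x258d38d0a08348871938c5041a4438c9c730f2865a58d19634414e8738d38ecf3ad38d4979954d14e334a71a29c6caf4b1c3bc9d96688 (by decide +kernel)))))
                  (.of_pair 0 (i := 5) (j := 7) (by decide) (by decide)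
                    (.of_refute 4000 0x258d34eb4a4b472c68829c6885510538d10c4338d38d3ad1053444b1a2188671a525951e4eb44102829a208464e396343792a2c44b1a71cb1a69c69c6a8f29634e34a4b45538a73234a71a71cb1a1bc951622186688 (by decide +kernel))
                    (.of_pair 2 (i := 4) (j := 5) (by decide) (by decide)
                      (.of_pair 4 (i := 5) (j := 7) (by decide) (by decide)
                        (.of_refute 4000 0x14105389c688 (by decide +kernel))
                        (.of_pair 4 (i := 5) (j := 6) (by decide) (by decide)
                          (.of_refute 4000 0x1414e3442688298a0a71a2050538d10e83270af0a0a68829a20a69babc28299050277c50534414d432c2829a20a70cf4688 (by decide +kernel))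
                          (.of_refute 4000 0x5053440a0a68852188a0a68896344380c50c64e3440a08348211914e34e34414e344298d050534414e21cc44b1a218c682820a721e669c688 (by decide +kernel))))
                      (.of_pair 4 (i := 3) (j := 5) (by decide) (by decide)
                        (.of_refute 4000 0x34829c688 (by decide +kernel))
                        (.of_pair 4 (i := 2) (j := 5) (by decide) (by decide)
                          (.of_refute 4000 0xa0829c68829c688 (by decide +kernel))
                          (.of_pair 3 (i := 2) (j := 5) (by decide) (by decide)
                            (.of_refute 4000 0x2829c688 (by decide +kernel))
                            (.of_pair 3 (i := 5) (j := 6) (by decide) (by decide)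
                              (.of_refute 4000 0xa0a69c688 (by decide +kernel))
                              (.of_pair 4 (i := 4) (j := 5) (by decide) (by decide)
                                (.of_refute 4000 0xa0a68820505344210c9a71a20d20a69c44290c2829a5259c688 (by decide +kernel))
                                (.of_pair 4 (i := 6) (j := 7) (by decide) (by decide)
                                  (.of_refute 4000 0x12c68829a20a69c688 (by decide +kernel))
                                  (.of_refute 4000 0x50538d112c6885218a68829c6889634414e3444a8ce342829c68896344290c534414e350cb10aa20a71a71a221465510534414e34a4b0a0a6881414d110830a0a6882a3443a0c2829a221864e34ecb4688 (by decide +kernel))))))))))))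
              (.of_pair 2 (i := 4) (j := 5) (by decide) (by decide)
                (.of_pair 4 (i := 5) (j := 6) (by decide) (by decide)
                  (.of_pair 4 (i := 7) (j := 8) (by decide) (by decide)
                    (.of_pair 4 (i := 3) (j := 4) (by decide) (by decide)
                      (.of_pair 3 (i := 2) (j := 3) (by decide) (by decide)
                        (.of_refute 4000 0x1a4220a68829c688551051042314d102829a20a6881414d106033a8ceb44298c9a20d20a20a71a22820a68a11c190634829a20b21ceb44288c9c688 (by decide +kernel))
                        (.of_pair 0 (i := 6) (j := 7) (by decide) (by decide)
                          (.of_refute 4000 0x5053441a4180c8a688a0a68ba9c2829a20d29a210866439c688 (by decide +kernel))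
                          (.of_pair 1 (i := 6) (j := 7) (by decide) (by decide)
                            (.of_refute 4000 0x3ad1053440a0a68842185053443ad1086326886218d29a20d29a21d466886419c688 (by decide +kernel))
                            (.of_refute 4000 0x505344102829a221864d102829a2081414d1042326888518d29a20a68875a210864d13484d102829a208464d185383a8c6905345110e3262820d221061410418738d221c64d114164380a0829a219064dd5e1414d10534410690c8326ecf4688 (by decide +kernel)))))
                      (.of_refute 4000 0x963441a5344210c50963443ad10a43243198a0a20834864193869053440a0a6884219a20d29a219064e194c86f4688 (by decide +kernel)))
                    (.of_pair 4 (i := 3) (j := 4) (by decide) (by decide)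
                      (.of_pair 3 (i := 2) (j := 3) (by decide) (by decide)
                        (.of_refute 4000 0x1545345d68a19c0a6885514d175a284702118bad10504e75a20a89ceb44288ceb44208c98a0a6a2f096345344428c9c688 (by decide +kernel))
                        (.of_refute 4000 0xeb44102829a221864c50510690e8314050507519c3bc9bad10534410690c8326ecf134829a21d6887418a688551053443ad10e43344320d1a76381a5344505187393445053441a5344210cc8707619c688 (by decide +kernel)))
                      (.of_refute 4000 0x12c68875a21086284b1a21d6885219218cdd68829a20834864193869053440a0a6884219a20d29a219064e194c86f4688 (by decide +kernel))))
                  (.of_pair 4 (i := 6) (j := 7) (by decide) (by decide)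
                    (.of_pair 1 (i := 2) (j := 5) (by decide) (by decide)
                      (.of_refute 4000 0x2829c688 (by decide +kernel))
                      (.of_pair 1 (i := 3) (j := 5) (by decide) (by decide)
                        (.of_refute 4000 0x2829c688 (by decide +kernel))
                        (.of_pair 1 (i := 1) (j := 5) (by decide) (by decide)
                          (.of_refute 4000 0x2829c688 (by decide +kernel))
                          (.of_pair 4 (i := 4) (j := 5) (by decide) (by decide)
                            (.of_refute 4000 0x2829c6881414d1084314e3440a0a71a20505344218c9a2260629c688348208348301914d10538d102829a29a22606521a0a0a688348421934d10538d102820d218864d14e22260653193888 (by decide +kernel))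
                            (.of_refute 4000 0x50510538e58d10538d0de441a538cd29c686f22190696344218c9c688 (by decide +kernel))))))
                    (.of_refute 4000 0x50510690e83271909c1414e22050538888519434c2828896344430c9c1414e34554414cbb1d21a641d469634538d10ec3389c688 (by decide +kernel))))
                (.of_pair 4 (i := 4) (j := 5) (by decide) (by decide)
                  (.of_pair 3 (i := 5) (j := 6) (by decide) (by decide)
                    (.of_pair 3 (i := 7) (j := 8) (by decide) (by decide)
                      (.of_pair 4 (i := 8) (j := 9) (by decide) (by decide)
                        (.of_pair 3 (i := 3) (j := 4) (by decide) (by decide)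
                          (.of_refute 4000 0x2828cb1a20b21c0aa8828c31c9d6882882a1960aa29a20a2690510514238320ceb4414410690c8327658d20a2050510c833b1cd0a0a20814144290cd192d1b888 (by decide +kernel))
                          (.of_refute 4000 0x1a538d105102828843194b1a20a71a20a43581a511414e34618e0c830a0a20a21d6882886419d8e71b888 (by decide +kernel)))
                        (.of_pair 3 (i := 3) (j := 4) (by decide) (by decide)
                          (.of_refute 4000 0x1a41442a8a221864282882a196069088289a414414508e0c8338d1a410690c8327658cb1a20a2050510c8334ec709634519634414590e683b0d2c6882089634410a4323259c688 (by decide +kernel))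
                          (.of_refute 4000 0x69441440a0a210c64aa208290d60694450518638320ce3469041a4320c9d9622829a20a71902829c68a2190676384b1a28cb1a20a2c8707619c688 (by decide +kernel))))
                      (.of_pair 3 (i := 3) (j := 4) (by decide) (by decide)
                        (.of_refute 4000 0xa0a205053210864aa21905212c0505105a2690510514238320d1a1414432258d10c8327658cb1a20a2050510c8334ec709634519634414590e683b0d2c6882089634410a4323259c688 (by decide +kernel))
                        (.of_pair 0 (i := 6) (j := 7) (by decide) (by decide)
                          (.of_refute 4000 0x9634519634414d16439c688 (by decide +kernel))
                          (.of_refute 4000 0xaa20a7190aa20a71908632141486b01414cc688a0a7194238320ccd2882e3440a0a71a210c64aa21c688290d60282882e344d20a20a286706419c6282882258d10c832765850510538c896344171a2886419d8e684f4688 (by decide +kernel)))))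
                    (.of_pair 4 (i := 6) (j := 7) (by decide) (by decide)
                      (.of_pair 4 (i := 2) (j := 3) (by decide) (by decide)
                        (.of_pair 0 (i := 6) (j := 7) (by decide) (by decide)
                          (.of_refute 4000 0xaa20814144210c9a29a26905340504210cd10534554d105345d4e6439c688 (by decide +kernel))
                          (.of_pair 1 (i := 6) (j := 7) (by decide) (by decide)
                            (.of_refute 4000 0xa0826905344185393440a0863193440a0a6886419c688 (by decide +kernel))
                            (.of_pair 2 (i := 2) (j := 3) (by decide) (by decide)
                              (.of_refute 4000 0x75a20a6882050534414d1084326282882050510a432686f4688 (by decide +kernel))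
                              (.of_refute 4000 0x1414d0a0a6909620a71a20505342829a4258896193443ad14dd68829a269053461ce4e19e10c33ad10538d10534618e1414d105396780a0a68875a2148675a21d464d134a68821d688751934618e9634537578320c9c688 (by decide +kernel)))))
                        (.of_refute 4000 0x75a20a68820d29a20a6884219396344112c6885219343793963441a51042314258d106944188c9486664f4688 (by decide +kernel)))
                      (.of_refute 4000 0x4b1a20896344210c9a208963441a5344430cea3262829c68834829c688861910694e34414e3444b1a221c6641954414e3443b0c9bb3c9c688 (by decide +kernel))))
                  (.of_pair 4 (i := 5) (j := 6) (by decide) (by decide)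
                    (.of_pair 4 (i := 3) (j := 4) (by decide) (by decide)
                      (.of_pair 3 (i := 2) (j := 3) (by decide) (by decide)
                        (.of_pair 3 (i := 6) (j := 7) (by decide) (by decide)
                          (.of_pair 4 (i := 7) (j := 8) (by decide) (by decide)
                            (.of_pair 2 (i := 5) (j := 6) (by decide) (by decide)
                              (.of_refute 4000 0x14102820d210864d10538d110a322eb4414d104186381a4430c2829c688751850414d14d104108c6905d8e34876193888 (by decide +kernel))
                              (.of_refute 4000 0x2a8829c68820d225863488618d20829a29a208a91911414414d10590e428298961414c6b034a71a28aa8b11c190634828834a71a219067638d288a0a2c8707619c688 (by decide +kernel)))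
                            (.of_pair 4 (i := 7) (j := 9) (by decide) (by decide)
                              (.of_refute 4000 0x3ad14450538d16438175a21544420c5186393ad105344150cb034a71a28aa8b11c19062eb441443ad10c833b1c1545271a288a0a20a2c8707619a75a21544428c8bad1763810694e344430caa2938d10ec326559c688 (by decide +kernel))
                              (.of_refute 4000 0xa0a2aa20b21c0aa8820a30c721414414d105432c6905176381a538d14554588e0c83342829a205044c0c41a4430c690ec326559c688 (by decide +kernel))))
                          (.of_refute 4000 0x5051053441441a515516238320ca58d105322c050511414590e0ec334282050510ea326cab4688 (by decide +kernel)))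
                        (.of_pair 0 (i := 6) (j := 8) (by decide) (by decide)
                          (.of_refute 4000 0x4b1a29c68a29c688 (by decide +kernel))
                          (.of_refute 4000 0x1414414539634414e0a0a20a721e676788141443a8c6904230a0a71a2a344438c8875a2138d10c8326aa20829b1bc6905350cb0a0a20b21c2820a68a20a69d9614175391a414e34414d28ac2828832a70a0a20c29c258d1444b0c9c688 (by decide +kernel))))
                      (.of_refute 4000 0xaa20a21544144218c850521ac0d28aa8a11c19066a58d1044b1a214864d9568aa2085510843271a62828814144218c850521ac0d28aa8a11c19066a58d1044b1a214864cab38d993d10a6688 (by decide +kernel)))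
                    (.of_refute 4000 0x1414e3441444b1a20a71a21d067050538d10eb44210c538eb332050538d10aa21d464e31414e37679108634b1a20829c6882831be282885510ea32719a538d10538dd9e44320d2c68829c68830c7271c688 (by decide +kernel)))))))))))

theorem not_sortable_tableB : ¬ Sortable 5 (columns tableB) :=
  not_sortable_columns_of_sorted (by decide +kernel) refuted_tableB

end Certificates

section Tables

/-- The hexadecimal digit number `k` of `code`. -/
def digit (code k : ℕ) : ℕ := Nat.land (Nat.shiftRight code (Nat.mul 4 k)) 15

/-- The table whose row `k < n` is the row of `Y` given by digit `k` of `code`. -/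
def selectRows (code Y : ℕ) : ℕ → ℕ
  | 0 => 0
  | n + 1 => Nat.lor (selectRows code Y n) (Nat.shiftLeft
      (Nat.land (Nat.shiftRight Y (Nat.mul 128 (digit code n))) (ones 128)) (Nat.mul 128 n))

def digitSet (code : ℕ) : ℕ → ℕ
  | 0 => 0
  | n + 1 => Nat.lor (digitSet code n) (Nat.shiftLeft 1 (digit code n))

def swapRows (i j W : ℕ) : ℕ :=
  force (Nat.land (Nat.xor (Nat.shiftRight W (Nat.mul 128 i)) (Nat.shiftRight W (Nat.mul 128 j)))
    (ones 128)) fun d =>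
  Nat.xor W (Nat.xor (Nat.shiftLeft d (Nat.mul 128 i)) (Nat.shiftLeft d (Nat.mul 128 j)))

theorem testBit_selectRows {code Y n k v : ℕ} (hk : k < n) (hv : v < 128) :
    (selectRows code Y n).testBit (128 * k + v) = Y.testBit (128 * digit code k + v) := by
  have key (n : ℕ) : (selectRows code Y n).testBit (128 * k + v) = true ↔
      k < n ∧ Y.testBit (128 * digit code k + v) = true := by
    induction n with
    | zero => simp [selectRows]
    | succ n ih =>
      rw [selectRows, testBit_lor, Bool.or_eq_true, ih, testBit_shiftLeft']
      constructor
      · rintro (⟨h, h'⟩ | ⟨q, hq, h⟩)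
        · exact ⟨by omega, h'⟩
        · rw [testBit_land, Bool.and_eq_true, testBit_ones, testBit_shiftRight'] at h
          have hq' : 128 * k + v = q + 128 * n := hq
          obtain rfl : k = n := by omega
          obtain rfl : q = v := by omega
          refine ⟨Nat.lt_succ_self k, ?_⟩
          rw [← h.1, Nat.add_comm]
          rfl
      · rintro ⟨h, h'⟩
        rcases Nat.lt_succ_iff_lt_or_eq.1 h with h | rfl
        · exact Or.inl ⟨h, h'⟩
        · refine Or.inr ⟨v, Nat.add_comm _ _, ?_⟩
          rw [testBit_land, Bool.and_eq_true, testBit_ones, testBit_shiftRight']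
          refine ⟨?_, hv⟩
          rw [← h', Nat.add_comm]
          rfl
  rw [Bool.eq_iff_iff, key]
  exact and_iff_right hk

theorem testBit_digitSet {code n t : ℕ} :
    (digitSet code n).testBit t = true ↔ ∃ k < n, digit code k = t := by
  induction n with
  | zero => simp [digitSet]
  | succ n ih =>
    rw [digitSet, testBit_lor, Bool.or_eq_true, ih, testBit_shiftLeft']
    constructor
    · rintro (⟨k, hk, h⟩ | ⟨q, hq, h⟩)
      · exact ⟨k, by omega, h⟩
      · have : q = 0 := by
          by_contra hne
          rw [Nat.testBit_one_eq_true_iff_self_eq_zero] at h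
          exact hne h
        exact ⟨n, Nat.lt_succ_self n, by omega⟩
    · rintro ⟨k, hk, rfl⟩
      rcases Nat.lt_succ_iff_lt_or_eq.1 hk with hk | rfl
      · exact Or.inl ⟨k, hk, rfl⟩
      · exact Or.inr ⟨0, by simp, by simp⟩

/-- The permutation described by the digits of `code`. -/
theorem exists_perm_of_digitSet {code : ℕ} (h : digitSet code 11 = ones 11) :
    ∃ π : Equiv.Perm (Fin 11), ∀ k : Fin 11, (π k).val = digit code k := by
  have hlt (k : Fin 11) : digit code k < 11 := by
    rw [← testBit_ones, ← h, testBit_digitSet]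
    exact ⟨k, k.is_lt, rfl⟩
  have hsurj : Function.Surjective fun k : Fin 11 => (⟨digit code k, hlt k⟩ : Fin 11) := by
    intro t
    obtain ⟨k, hk, hkt⟩ := testBit_digitSet.1 (h ▸ testBit_ones.2 t.is_lt)
    exact ⟨⟨k, hk⟩, Fin.ext hkt⟩
  exact ⟨Equiv.ofBijective _ (Finite.injective_iff_bijective.1
    (Finite.injective_iff_surjective.2 hsurj)), fun k => rfl⟩

theorem column_selectRows {code : ℕ} (Y : ℕ) {π : Equiv.Perm (Fin 11)}
    (hπ : ∀ k : Fin 11, (π k).val = digit code k) {v : ℕ} (hv : v < 128) :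
    column (selectRows code Y 11) v = column Y v ∘ π := by
  funext k
  rw [column, testBit_selectRows k.is_lt hv, ← hπ]
  rfl

theorem Sortable.columns_of_selectRows {k code Y : ℕ} (hc : digitSet code 11 = ones 11)
    (h : Sortable k (columns (selectRows code Y 11))) : Sortable k (columns Y) := by
  obtain ⟨π, hπ⟩ := exists_perm_of_digitSet hc
  refine (h.image_comp π.symm).mono ?_
  rintro _ ⟨v, hv, rfl⟩
  refine ⟨_, ⟨v, hv, rfl⟩, ?_⟩
  funext i
  simp [column_selectRows Y hπ hv]

def reflectTable (Y : ℕ) : ℕ := Nat.xor (selectRows 0x0123456789a Y 11) (ones 1408)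

theorem column_reflectTable (Y : ℕ) {v : ℕ} (hv : v < 128) :
    column (reflectTable Y) v = refl (column Y v) := by
  have hd : ∀ k : Fin 11, digit 0x0123456789a k = k.rev.val := by decide
  funext k
  have h := Nat.testBit_xor (selectRows 0x0123456789a Y 11) (ones 1408) (128 * k + v)
  change column (reflectTable Y) v k = _ at h
  rw [h, testBit_selectRows k.is_lt hv, hd, testBit_ones.2 (by omega : 128 * k.val + v < 1408),
    Bool.xor_true]
  rfl

theorem not_sortable_reflectTable {k Y : ℕ} (h : ¬ Sortable k (columns Y)) :
    ¬ Sortable k (columns (reflectTable Y)) := by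
  refine fun h' => h (h'.image_refl.mono ?_)
  rintro _ ⟨v, hv, rfl⟩
  exact ⟨_, ⟨v, hv, rfl⟩, by rw [column_reflectTable Y hv, refl_refl]⟩

theorem testBit_swapRows (i j W k : ℕ) {v : ℕ} (hv : v < 128) :
    (swapRows i j W).testBit (128 * k + v) =
      W.testBit (128 * (bif k == i then j else bif k == j then i else k) + v) := by
  have hshift (d s : ℕ) (hd : ∀ q, d.testBit q = true → q < 128) :
      (Nat.shiftLeft d (Nat.mul 128 s)).testBit (128 * k + v) = (k == s && d.testBit v) := by
    rw [Bool.eq_iff_iff, testBit_shiftLeft', Bool.and_eq_true, beq_iff_eq]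
    constructor
    · rintro ⟨q, hq, h⟩
      have hq' : 128 * k + v = q + 128 * s := hq
      have := hd q h
      obtain rfl : k = s := by omega
      obtain rfl : q = v := by omega
      exact ⟨rfl, h⟩
    · rintro ⟨rfl, h⟩
      exact ⟨v, Nat.add_comm _ _, h⟩
  rw [swapRows, force_eq]
  generalize hd : Nat.land (Nat.xor (Nat.shiftRight W (Nat.mul 128 i))
    (Nat.shiftRight W (Nat.mul 128 j))) (ones 128) = d
  have hlt (q : ℕ) (h : d.testBit q = true) : q < 128 := by
    rw [← hd, testBit_land, Bool.and_eq_true] at h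
    exact testBit_ones.1 h.2
  have hdv : d.testBit v = (W.testBit (128 * i + v) ^^ W.testBit (128 * j + v)) := by
    have h := Nat.testBit_xor (Nat.shiftRight W (Nat.mul 128 i)) (Nat.shiftRight W (Nat.mul 128 j)) v
    change (Nat.xor _ _).testBit v = _ at h
    rw [← hd, testBit_land, h, testBit_ones.2 hv, Bool.and_true, testBit_shiftRight',
      testBit_shiftRight', Nat.add_comm v, Nat.add_comm v]
    rfl
  have h1 := Nat.testBit_xor W (Nat.xor (Nat.shiftLeft d (Nat.mul 128 i))
    (Nat.shiftLeft d (Nat.mul 128 j))) (128 * k + v)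
  have h2 := Nat.testBit_xor (Nat.shiftLeft d (Nat.mul 128 i))
    (Nat.shiftLeft d (Nat.mul 128 j)) (128 * k + v)
  change (Nat.xor _ _).testBit _ = _ at h1
  change (Nat.xor _ _).testBit _ = _ at h2
  change _ = (_ ^^ (Nat.xor _ _).testBit _) at h1
  rw [h1, h2, hshift d i hlt, hshift d j hlt, hdv]
  generalize ha : W.testBit (128 * i + v) = a
  generalize hb : W.testBit (128 * j + v) = b
  by_cases hi : k = i
  · subst hi
    rw [ha, beq_self_eq_true, cond_true, hb]
    by_cases hj : k = j
    · subst hj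
      rw [beq_self_eq_true, ← ha, ← hb]
      cases W.testBit (128 * k + v) <;> rfl
    · rw [beq_false_of_ne hj]
      cases a <;> cases b <;> rfl
  · rw [beq_false_of_ne hi, cond_false]
    by_cases hj : k = j
    · subst hj
      rw [beq_self_eq_true, cond_true, hb, ha]
      cases a <;> cases b <;> rfl
    · rw [beq_false_of_ne hj]
      exact Bool.xor_false _

theorem column_swapRows (i j : Fin 11) (W : ℕ) {v : ℕ} (hv : v < 128) :
    column (swapRows i j W) v = column W v ∘ Equiv.swap i j := by
  funext k
  rw [column, testBit_swapRows _ _ _ _ hv, Function.comp_apply, column]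
  congr 3
  by_cases hi : k = i
  · subst hi
    simp
  · have hi' : (k.val == i.val) = false := by simpa using fun h => hi (Fin.ext h)
    by_cases hj : k = j
    · subst hj
      simp [hi']
    · have hj' : (k.val == j.val) = false := by simpa using fun h => hj (Fin.ext h)
      rw [Equiv.swap_apply_of_ne_of_ne hi hj, hi', hj']
      rfl

end Tables

section SecondLayer

/-- Whether `i` occurs in one of the pairs. -/
def isUsed (pairs : List (ℕ × ℕ)) (i : ℕ) : Bool :=
  pairs.any fun p => Nat.beq p.1 i || Nat.beq p.2 i

def Extends (m : Fin 11 → Fin 11) (pairs : List (ℕ × ℕ)) : Prop :=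
  ∀ p ∈ pairs, ∃ k : Fin 11, k.val = p.1 ∧ (m k).val = p.2

/-- No second layer containing the given pairs leaves a set sortable by five more layers. -/
def Excluded (pairs : List (ℕ × ℕ)) : Prop :=
  ∀ m : Fin 11 → Fin 11, m.Involutive → Extends m pairs → ¬ Sortable 5 (ap m '' pairSorted)

theorem isUsed_eq_true {pairs : List (ℕ × ℕ)} {i : ℕ} :
    isUsed pairs i = true ↔ ∃ p ∈ pairs, p.1 = i ∨ p.2 = i := by
  simp [isUsed]

theorem isUsed_eq_false {pairs : List (ℕ × ℕ)} {i : ℕ} :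
    isUsed pairs i = false ↔ ∀ p ∈ pairs, p.1 ≠ i ∧ p.2 ≠ i := by
  rw [← Bool.not_eq_true, isUsed_eq_true]
  push Not
  rfl

theorem Extends.exists_pair {m : Fin 11 → Fin 11} {pairs : List (ℕ × ℕ)} (hm : m.Involutive)
    (h : Extends m pairs) {k : Fin 11} (hk : isUsed pairs k = true) :
    (k.val, (m k).val) ∈ pairs ∨ ((m k).val, k.val) ∈ pairs := by
  obtain ⟨p, hp, hpk⟩ := isUsed_eq_true.1 hk
  obtain ⟨l, hl, hml⟩ := h p hp
  rcases hpk with hpk | hpk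
  · obtain rfl : l = k := Fin.ext (hl.trans hpk)
    left
    rwa [hl, hml]
  · obtain rfl : m l = k := Fin.ext (hml.trans hpk)
    right
    rwa [hm l, hl, hml]

theorem Extends.cons {m : Fin 11 → Fin 11} {pairs : List (ℕ × ℕ)} (h : Extends m pairs)
    (k : Fin 11) : Extends m ((k.val, (m k).val) :: pairs) := by
  intro p hp
  rcases List.mem_cons.1 hp with rfl | hp
  exacts [⟨k, rfl, rfl⟩, h p hp]

section Symmetry

/-- The permutation exchanging the pairs of channels containing `i` and `j`. -/
def swapPairs (i j : Fin 11) : Equiv.Perm (Fin 11) :=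
  Equiv.swap j i * Equiv.swap (mate j) (mate i)

theorem swapPairs_symm_mate : ∀ i j : Fin 11, i.val < 10 → j.val < 10 → i.val % 2 = j.val % 2 →
    ∀ k, (swapPairs i j).symm (mate k) = mate ((swapPairs i j).symm k) ∧
      (k < mate k → (swapPairs i j).symm k < mate ((swapPairs i j).symm k)) := by
  decide +kernel

theorem swapPairs_symm_apply : ∀ i j : Fin 11, i.val < 10 → j.val < 10 →
    i.val % 2 = j.val % 2 → (swapPairs i j).symm j = i := by
  decide +kernel

theorem swapPairs_of_ne {i j k : Fin 11} (hi : k ≠ i) (hj : k ≠ j) (hi' : k ≠ mate i)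
    (hj' : k ≠ mate j) : swapPairs i j k = k := by
  rw [swapPairs, Equiv.Perm.mul_apply, Equiv.swap_apply_of_ne_of_ne hj' hi',
    Equiv.swap_apply_of_ne_of_ne hj hi]

theorem mate_val : ∀ i : Fin 11, i.val < 10 → (mate i).val = Nat.xor i 1 := by
  decide +kernel

/-- Whether `j` and its partner in the first layer are untouched by `pairs` and by `c`. -/
def isFresh (pairs : List (ℕ × ℕ)) (c j : ℕ) : Bool :=
  Nat.blt j 10 && (!Nat.beq c j && (!Nat.beq c (Nat.xor j 1) &&
    (!isUsed pairs j && !isUsed pairs (Nat.xor j 1))))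

theorem Excluded.of_isFresh {pairs : List (ℕ × ℕ)} {c i j : ℕ} (hi : isFresh pairs c i = true)
    (hj : isFresh pairs c j = true) (hij : i % 2 = j % 2) (h : Excluded ((c, i) :: pairs)) :
    Excluded ((c, j) :: pairs) := by
  intro m hm hext hs
  have key {j : ℕ} (hj : isFresh pairs c j = true) : ∃ l : Fin 11, l.val = j ∧ j < 10 ∧
      ∀ k : Fin 11, (k.val = c ∨ isUsed pairs k = true) → k ≠ l ∧ k ≠ mate l := by
    simp only [isFresh, Bool.and_eq_true, Bool.not_eq_true', Nat.blt_eq] at hj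
    obtain ⟨h10, h1, h2, h3, h4⟩ := hj
    refine ⟨⟨j, by omega⟩, rfl, h10, fun k hk => ⟨?_, ?_⟩⟩
    · rintro rfl
      rcases hk with rfl | hk
      · exact Bool.false_ne_true (h1.symm.trans (Nat.beq_refl j))
      · exact Bool.false_ne_true (h3.symm.trans hk)
    · rintro rfl
      rw [mate_val _ h10] at hk
      rcases hk with rfl | hk
      · exact Bool.false_ne_true (h2.symm.trans (Nat.beq_refl _))
      · exact Bool.false_ne_true (h4.symm.trans hk)
  obtain ⟨i, rfl, hi10, hi⟩ := key hi
  obtain ⟨j, rfl, hj10, hj⟩ := key hj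
  have hfix (k : Fin 11) (hk : k.val = c ∨ isUsed pairs k = true) : swapPairs i j k = k :=
    swapPairs_of_ne (hi k hk).1 (hj k hk).1 (hi k hk).2 (hj k hk).2
  refine h ((swapPairs i j).symm ∘ m ∘ swapPairs i j) (fun k => by simp [hm _]) (fun p hp => ?_)
    (hs.image_ap_conj hm (swapPairs i j) fun x hx k hk => ?_)
  · rcases List.mem_cons.1 hp with rfl | hp
    · obtain ⟨k, hk, hmk⟩ := hext _ (List.mem_cons_self ..)
      obtain rfl : m k = j := Fin.ext hmk
      refine ⟨k, hk, ?_⟩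
      rw [Function.comp_apply, Function.comp_apply, hfix k (Or.inl hk),
        swapPairs_symm_apply i (m k) hi10 hj10 hij]
    · obtain ⟨k, hk, hmk⟩ := hext _ (List.mem_cons_of_mem _ hp)
      refine ⟨k, hk, ?_⟩
      have hmk' : swapPairs i j (m k) = m k :=
        hfix _ (Or.inr (isUsed_eq_true.2 ⟨p, hp, Or.inr hmk.symm⟩))
      rw [Function.comp_apply, Function.comp_apply,
        hfix k (Or.inr (isUsed_eq_true.2 ⟨p, hp, Or.inl hk.symm⟩)),
        (Equiv.symm_apply_eq _).2 hmk'.symm, hmk]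
  · obtain ⟨h1, h2⟩ := swapPairs_symm_mate i j hi10 hj10 hij k
    rw [Function.comp_apply, Function.comp_apply, h1]
    exact hx _ (h2 hk)

end Symmetry

/-- Whether row `a` of `W` lies below row `b`. -/
def rowLe (W a b : ℕ) : Bool :=
  Nat.beq (Nat.land (andNot (Nat.shiftRight W (Nat.mul 128 a)) (Nat.shiftRight W (Nat.mul 128 b)))
    (ones 128)) 0

def rowsSorted (W : ℕ) (pairs : List (ℕ × ℕ)) : Bool :=
  pairs.all fun p => bif Nat.blt p.1 p.2 then rowLe W p.1 p.2 else rowLe W p.2 p.1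

/-- The columns of `W` not sorted by the first layer. -/
def unsortedColumns (W : ℕ) : ℕ :=
  force (andNot W (Nat.shiftRight W 128)) fun V =>
    Nat.lor V (Nat.lor (Nat.shiftRight V 256) (Nat.lor (Nat.shiftRight V 512)
      (Nat.lor (Nat.shiftRight V 768) (Nat.shiftRight V 1024))))

/-- The columns in `need` that are unsorted by the first layer however rows are exchanged along
the given pairs. -/
def missing : List (ℕ × ℕ) → ℕ → ℕ → ℕ
  | [], W, need => Nat.land need (unsortedColumns W)
  | p :: pairs, W, need => bif Nat.beq p.1 p.2 then missing pairs W need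
    else force (missing pairs W need) fun need => bif Nat.beq need 0 then 0
    else force (swapRows p.1 p.2 W) fun W => missing pairs W need

theorem le_of_rowLe {W a b : ℕ} (h : rowLe W a b = true) {v : ℕ} (hv : v < 128) :
    W.testBit (128 * a + v) ≤ W.testBit (128 * b + v) := by
  have h0 := congrArg (Nat.testBit · v) (Nat.eq_of_beq_eq_true h)
  simp only [testBit_land, testBit_andNot, testBit_shiftRight', testBit_ones.2 hv, Bool.and_true,
    Nat.zero_testBit, Nat.mul_eq, Nat.add_comm v] at h0
  revert h0
  cases W.testBit (128 * a + v) <;> cases W.testBit (128 * b + v) <;> simp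

theorem ap_column_of_rowsSorted {m : Fin 11 → Fin 11} (hm : m.Involutive)
    {pairs : List (ℕ × ℕ)} (hext : Extends m pairs) (hall : ∀ k < 11, isUsed pairs k = true)
    {W : ℕ} (h : rowsSorted W pairs = true) {v : ℕ} (hv : v < 128) :
    ap m (column W v) = column W v := by
  have hle (k : Fin 11) (hk : k < m k) : column W v k ≤ column W v (m k) := by
    rw [rowsSorted, List.all_eq_true] at h
    rcases hext.exists_pair hm (hall k k.is_lt) with hp | hp
    · have h1 := h _ hp
      have h2 : Nat.blt k.val (m k).val = true := by simpa using hk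
      rw [h2, cond_true] at h1
      exact le_of_rowLe h1 hv
    · have h1 := h _ hp
      have h2 : Nat.blt (m k).val k.val = false := by
        rw [← Bool.not_eq_true, Nat.blt_eq]
        exact (Fin.lt_def.1 hk).not_gt
      rw [h2, cond_false] at h1
      exact le_of_rowLe h1 hv
  funext k
  rw [ap]
  rcases lt_or_ge k (m k) with hk | hk
  · rw [decide_eq_true hk, cond_true]
    have := hle k hk
    revert this
    cases column W v k <;> cases column W v (m k) <;> simp
  · rw [decide_eq_false hk.not_gt, cond_false]
    rcases hk.lt_or_eq with hk | hk
    · have := hle (m k) (by rwa [hm k])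
      rw [hm k] at this
      revert this
      cases column W v k <;> cases column W v (m k) <;> simp
    · rw [hk, Bool.or_self]

theorem ap_comp_swap {m : Fin 11 → Fin 11} (hm : m.Involutive) (i : Fin 11) (x : Fin 11 → Bool) :
    ap m (x ∘ Equiv.swap i (m i)) = ap m x := by
  funext k
  by_cases hi : k = i
  · subst hi
    simp [ap, Bool.and_comm, Bool.or_comm]
  · by_cases hj : k = m i
    · subst hj
      simp [ap, hm i, Bool.and_comm, Bool.or_comm]
    · have h1 : m k ≠ i := fun h => hj (by rw [← h, hm k])
      have h2 : m k ≠ m i := fun h => hi (hm.injective h)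
      simp only [ap, Function.comp_apply, Equiv.swap_apply_of_ne_of_ne hi hj,
        Equiv.swap_apply_of_ne_of_ne h1 h2]

theorem column_mem_pairSorted {W v : ℕ} (h : (unsortedColumns W).testBit v = false) :
    column W v ∈ pairSorted := by
  have key (r : ℕ) (hr : (andNot W (Nat.shiftRight W 128)).testBit (v + 128 * r) = false) :
      W.testBit (128 * r + v) ≤ W.testBit (128 * (r + 1) + v) := by
    rw [testBit_andNot, testBit_shiftRight', show v + 128 * r = 128 * r + v by omega,
      show 128 * r + v + 128 = 128 * (r + 1) + v by omega] at hr
    revert hr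
    cases W.testBit (128 * r + v) <;> cases W.testBit (128 * (r + 1) + v) <;> simp
  simp only [unsortedColumns, force_eq, testBit_lor, testBit_shiftRight', Bool.or_eq_false_iff] at h
  obtain ⟨h0, h2, h4, h6, h8⟩ := h
  intro k hk
  fin_cases k
  · exact key 0 h0
  · exact absurd hk (by decide)
  · exact key 2 h2
  · exact absurd hk (by decide)
  · exact key 4 h4
  · exact absurd hk (by decide)
  · exact key 6 h6
  · exact absurd hk (by decide)
  · exact key 8 h8
  · exact absurd hk (by decide)
  · exact absurd hk (by decide)

theorem exists_mem_pairSorted {m : Fin 11 → Fin 11} (hm : m.Involutive) {v : ℕ} (hv : v < 128)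
    (pairs : List (ℕ × ℕ)) (hext : Extends m pairs) (W need : ℕ) (hneed : need.testBit v = true)
    (h : (missing pairs W need).testBit v = false) :
    ∃ w ∈ pairSorted, ap m w = ap m (column W v) := by
  induction pairs generalizing W need with
  | nil =>
    rw [missing, testBit_land, hneed, Bool.true_and] at h
    exact ⟨_, column_mem_pairSorted h, rfl⟩
  | cons p pairs ih =>
    have hext' : Extends m pairs := fun q hq => hext q (List.mem_cons_of_mem p hq)
    rw [missing] at h
    cases hp : Nat.beq p.1 p.2 <;> rw [hp] at h
    · rw [cond_false, force_eq, force_eq] at h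
      cases hb : (missing pairs W need).testBit v
      · exact ih hext' W need hneed hb
      · have hne : Nat.beq (missing pairs W need) 0 = false := by
          rw [← Bool.not_eq_true]
          intro h0
          rw [Nat.eq_of_beq_eq_true h0] at hb
          simp at hb
        rw [hne, cond_false] at h
        obtain ⟨w, hw, hwm⟩ := ih hext' _ _ hb h
        obtain ⟨k, hk, hmk⟩ := hext p (List.mem_cons_self ..)
        refine ⟨w, hw, ?_⟩
        rw [hwm, ← hk, ← hmk, column_swapRows k (m k) W hv, ap_comp_swap hm]
    · exact ih hext' W need hneed h

/-- A table that is not sortable, and whose columns are outputs of the two layers. -/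
def checkTable (Y code : ℕ) (pairs : List (ℕ × ℕ)) : Bool :=
  bif Nat.beq (digitSet code 11) (ones 11) then
    force (selectRows code Y 11) fun W =>
      bif rowsSorted W pairs then Nat.beq (missing pairs W (ones 128)) 0 else false
  else false

theorem Excluded.of_checkTable {Y code : ℕ} {pairs : List (ℕ × ℕ)}
    (hY : ¬ Sortable 5 (columns Y)) (hall : ∀ k < 11, isUsed pairs k = true)
    (h : checkTable Y code pairs = true) : Excluded pairs := by
  intro m hm hext hs
  rw [checkTable, force_eq] at h
  obtain ⟨hd, h⟩ := cond_false_eq_true h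
  obtain ⟨hr, h⟩ := cond_false_eq_true h
  refine hY (Sortable.columns_of_selectRows (Nat.eq_of_beq_eq_true hd) (hs.mono ?_))
  rintro _ ⟨v, hv, rfl⟩
  obtain ⟨w, hw, hwm⟩ := exists_mem_pairSorted hm hv pairs hext _ _ (testBit_ones.2 hv)
    (by rw [Nat.eq_of_beq_eq_true h, Nat.zero_testBit])
  exact ⟨w, hw, hwm.trans (ap_column_of_rowsSorted hm hext hall hr hv)⟩

/-- The largest number below the bound that satisfies `p`. -/
def findBelow (p : ℕ → Bool) : ℕ → Option ℕ
  | 0 => none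
  | n + 1 => bif p n then some n else findBelow p n

theorem findBelow_eq_some {p : ℕ → Bool} {n k : ℕ} (h : findBelow p n = some k) :
    k < n ∧ p k = true := by
  induction n with
  | zero => simp [findBelow] at h
  | succ n ih =>
    rw [findBelow] at h
    cases hp : p n <;> rw [hp] at h
    · exact ⟨(ih h).1.trans (Nat.lt_succ_self n), (ih h).2⟩
    · obtain rfl : n = k := Option.some.inj h
      exact ⟨Nat.lt_succ_self n, hp⟩

theorem findBelow_eq_none {p : ℕ → Bool} {n : ℕ} (h : findBelow p n = none) {k : ℕ}
    (hk : k < n) : p k = false := by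
  induction n with
  | zero => omega
  | succ n ih =>
    rw [findBelow] at h
    cases hp : p n <;> rw [hp] at h
    · rcases Nat.lt_succ_iff_lt_or_eq.1 hk with hk | rfl
      exacts [ih h hk, hp]
    · exact absurd h (Option.some_ne_none n)

/-- The next channel to branch on, preferably one whose partner is already used. -/
def nextChannel (pairs : List (ℕ × ℕ)) : Option ℕ :=
  match findBelow (fun k => !isUsed pairs k &&
      isUsed pairs (bif Nat.blt k 10 then Nat.xor k 1 else k)) 11 with
  | some k => some k
  | none => findBelow (fun k => !isUsed pairs k) 11

theorem nextChannel_eq_some {pairs : List (ℕ × ℕ)} {c : ℕ} (h : nextChannel pairs = some c) :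
    c < 11 ∧ isUsed pairs c = false := by
  rw [nextChannel] at h
  split at h
  · rename_i k hk
    obtain rfl : k = c := Option.some.inj h
    have := findBelow_eq_some hk
    rw [Bool.and_eq_true, Bool.not_eq_true'] at this
    exact ⟨this.1, this.2.1⟩
  · have := findBelow_eq_some h
    rwa [Bool.not_eq_true'] at this

theorem nextChannel_eq_none {pairs : List (ℕ × ℕ)} (h : nextChannel pairs = none) :
    ∀ k < 11, isUsed pairs k = true := by
  intro k hk
  rw [nextChannel] at h
  split at h
  · exact absurd h (Option.some_ne_none _)
  · simpa using findBelow_eq_none h hk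

/-- Branch over the partners of channel `c`, up to exchanging pairs of untouched channels. -/
def branch (visit : ℕ → ℕ → (ℕ → Bool) → Bool) (pairs : List (ℕ × ℕ)) (c : ℕ) :
    List ℕ → List ℕ → ℕ → (ℕ → Bool) → Bool
  | [], _, code, k => k code
  | j :: js, tried, code, k =>
    bif isUsed pairs j then branch visit pairs c js tried code k
    else bif isFresh pairs c j then
      bif tried.any fun i => Nat.beq (Nat.mod i 2) (Nat.mod j 2) then
        branch visit pairs c js tried code k
      else visit j code fun code => branch visit pairs c js (j :: tried) code k
    else visit j code fun code => branch visit pairs c js tried code k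

theorem excluded_of_branch {visit : ℕ → ℕ → (ℕ → Bool) → Bool} {pairs : List (ℕ × ℕ)} {c : ℕ}
    (hvisit : ∀ j code k, visit j code k = true →
      Excluded ((c, j) :: pairs) ∧ ∃ code', k code' = true)
    (js tried : List ℕ)
    (htried : ∀ i ∈ tried, isFresh pairs c i = true ∧ Excluded ((c, i) :: pairs))
    (code : ℕ) (k : ℕ → Bool) (h : branch visit pairs c js tried code k = true) :
    (∀ j ∈ js, isUsed pairs j = false → Excluded ((c, j) :: pairs)) ∧ ∃ code', k code' = true := by
  induction js generalizing tried code with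
  | nil => exact ⟨by simp, code, h⟩
  | cons j js ih =>
    rw [branch] at h
    cases hu : isUsed pairs j <;> rw [hu] at h
    · rw [cond_false] at h
      cases hf : isFresh pairs c j <;> rw [hf] at h
      · obtain ⟨hj, code', h⟩ := hvisit _ _ _ h
        obtain ⟨h, hk⟩ := ih tried htried code' h
        exact ⟨List.forall_mem_cons.2 ⟨fun _ => hj, h⟩, hk⟩
      · rw [cond_true] at h
        cases ht : tried.any fun i => Nat.beq (Nat.mod i 2) (Nat.mod j 2) <;> rw [ht] at h
        · obtain ⟨hj, code', h⟩ := hvisit _ _ _ h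
          obtain ⟨h, hk⟩ := ih (j :: tried) (List.forall_mem_cons.2 ⟨⟨hf, hj⟩, htried⟩) code' h
          exact ⟨List.forall_mem_cons.2 ⟨fun _ => hj, h⟩, hk⟩
        · obtain ⟨i, hi, hij⟩ := List.any_eq_true.1 ht
          obtain ⟨hif, hie⟩ := htried i hi
          obtain ⟨h, hk⟩ := ih tried htried code h
          exact ⟨List.forall_mem_cons.2
            ⟨fun _ => hie.of_isFresh hif hf (Nat.eq_of_beq_eq_true hij), h⟩, hk⟩
    · obtain ⟨h, hk⟩ := ih tried htried code h
      exact ⟨List.forall_mem_cons.2 ⟨fun h' => absurd h' (by simp [hu]), h⟩, hk⟩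

/-- Go through the second layers containing `pairs`, up to symmetry, reading from `code` for each
of them a table of the family `T` and an arrangement of its rows. -/
def cover (T : ℕ → ℕ) : ℕ → List (ℕ × ℕ) → ℕ → (ℕ → Bool) → Bool
  | 0, _, _, _ => false
  | n + 1, pairs, code, k =>
    match nextChannel pairs with
    | some c => branch (fun j => cover T n ((c, j) :: pairs)) pairs c
        [0, 1, 2, 3, 4, 5, 6, 7, 8, 9, 10] [] code k
    | none => readBits 4 code fun t code => readBits 44 code fun rows code =>
        bif checkTable (T t) rows pairs then k code else false

theorem excluded_of_cover {T : ℕ → ℕ} (hT : ∀ t, ¬ Sortable 5 (columns (T t))) (n : ℕ)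
    (pairs : List (ℕ × ℕ)) (code : ℕ) (k : ℕ → Bool) (h : cover T n pairs code k = true) :
    Excluded pairs ∧ ∃ code', k code' = true := by
  induction n generalizing pairs code k with
  | zero => exact Bool.noConfusion h
  | succ n ih =>
    rw [cover] at h
    split at h
    · rename_i c hc
      obtain ⟨hc, hu⟩ := nextChannel_eq_some hc
      obtain ⟨hj, hk⟩ := excluded_of_branch (fun j => ih ((c, j) :: pairs)) _ [] (by simp) _ _ h
      refine ⟨fun m hm hext => ?_, hk⟩
      let κ : Fin 11 := ⟨c, hc⟩
      refine hj (m κ) ?_ ?_ m hm (hext.cons κ)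
      · have : ∀ j : Fin 11, j.val ∈ [0, 1, 2, 3, 4, 5, 6, 7, 8, 9, 10] := by decide
        exact this _
      · rw [← Bool.not_eq_true]
        intro hmu
        have := hext.exists_pair hm hmu
        rw [hm κ] at this
        rw [isUsed_eq_false] at hu
        rcases this with h | h
        exacts [(hu _ h).2 rfl, (hu _ h).1 rfl]
    · rename_i hnone
      simp only [readBits, force_eq] at h
      obtain ⟨h, hk⟩ := cond_false_eq_true h
      exact ⟨.of_checkTable (hT _) (nextChannel_eq_none hnone) h, _, hk⟩

end SecondLayer

section LowerBound

/-- Two tables that five layers cannot sort, and their reflections. -/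
def tables (t : ℕ) : ℕ :=
  bif Nat.beq t 0 then tableA else bif Nat.beq t 1 then tableB
  else bif Nat.beq t 2 then reflectTable tableA else reflectTable tableB

theorem not_sortable_tables (t : ℕ) : ¬ Sortable 5 (columns (tables t)) := by
  rw [tables]
  cases Nat.beq t 0
  · cases Nat.beq t 1
    · cases Nat.beq t 2
      exacts [not_sortable_reflectTable not_sortable_tableB,
        not_sortable_reflectTable not_sortable_tableA]
    · exact not_sortable_tableB
  · exact not_sortable_tableA

/-- For each second layer, in the order of `cover`, the table used to exclude it and the
arrangement of its rows. -/
def coverCode : ℕ := 0x7938450a16207938450a162058193a4672009628340a75127938450a16207938450a16207938450a16209628340a75127938450a16204a75183962025a4627893010562918a734005a79138620405a79138620401958473a26004a75183962021a78495623001a78495623007938450a16207938450a162058193a4672009628340a75127938450a16207938450a16207938450a16209628340a75127938450a16204a751839620269173a5824017618392a540169584a13072069584a13072069350a84172049260a8357128736195a04218736195a04211a78495623001a78495623005936281a470058193a46720069584a13072069584a13072069350a841720584a37916202962a78340512184a6739052079562a83041079562a83041068457a3910205846973a021068457a39102068457a3910206847a91352005918a67234004a78962531004a7896253100395a8706241039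5a87062410650789a243117628a9530140395a87062410395a870624107628a95301407628a9530140395a87062410650789a243113629784a0512184a673905209518462a37029518462a370258193a46720048357960a21258193a46720058193a467200493a78162500493a78162500481a59723603962a78340512493a78162500493a78162500962a78340512962a78340512962a78340512481a597236037938450a16207938450a162058193a4672009628340a75127938450a16207938450a16207938450a16209628340a75127938450a16204a75183962025a4627893010562918a734005a79138620405a79138620401958473a26004a75183962021a78495623001a78495623007938450a16207938450a162058193a4672009628340a75127938450a16207938450a16207938450a16209628340a75127938450a16204a751839620269173a5824017618392a540169584a13072069584a13072069350a84172049260a8357128736195a04218736195a04211a78495623001a78495623005936281a470058193a46720069584a13072069584a13072069350a841720584a37916202962a78340512184a6739052079562a83041079562a8304107a58491623026928357a14027a58491623027a584916230218492a673500683a2791540118492a67350018492a673500962a78340512962a78340512481a59723603962a78340512962a78340512962a78340512962a78340512962a78340512962a78340512481a5972360358497a60231076298a314500784a9531062058497a6023107629a841350076298a3145007629a84135007629a84135007629a84135007629a8413500962a7834051248196a572300692a57830411692a5783041147295a680310692a7845130247295a68031047295a68031047295a68031047295a680310962a78340512962a78340512481a59723603962a78340512962a78340512962a78340512962a7834051296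2a78340512962a78340512481a597236036739482a0511184a673905209628340a75129628340a751258193a467200584a3791620258193a46720058193a4672004a69350817204a69350817203a58496207121958467a23004a69350817204a6935081720962a78340512962a783405121a78495623003a5849620712672a893415005a4698702311784a9531062038469a701522672a893415005a46987023117629a84135007629a8413500672a85049130672a85049130962a78340512762a598301403a584962071248195a720630692a78451302530a69872140493a78162500493a781625003629784a05123629784a0512395a87062410395a87062410650789a243117628a9530140395a87062410395a870624107628a95301407628a9530140395a87062410650789a2431156784a19320053976a28401056784a19320056784a19320076a9135802403597826a10433598476a20103598476a201056784a19320056784a1932005678a149320067a95308124056784a19320056784a19320067a95308124067a95308124056784a1932005678a149320076983a25410118a73905642094862a37501294862a375012769a158342025a869271430258a91672340058a91672340056a83409721256a8340972125678a149320056a83409721256a83409721256a83409721256a83409721256a83409721276a8392541015678a149320079a84625013079a84625013059a84672013046983a57102279a84625013079a84625013046983a57102246983a57102246983a571022578609a4213159a6782130415a869732041069a87501324169a87501324147986a15032358a936720140687a49250311687a4925031179a84625013079a84625013059a84672013046983a57102279a84625013079a84625013046983a57102246983a57102246983a571022578609a42131687a49250311479a08651233687a49250311687a49250311396a81475202496a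8357120268a95703241068a957032410687a49250311687a4925031146983a57102259a84672013079a84625013079a84625013038a7905621405a968073124147986a15032347986a15032369a87501324169a8750132413958460a27123958460a27125936281a47005936281a4700485a176923003846925a17021958467a23001958467a23005936281a47005936281a47006738a4192500483a672915005936281a47005936281a4700483a67291500483a672915003958460a27126738a419250059381a46720047683905a12059381a46720059381a467200584a379162025a467183920157630981a42057630981a4204a75183962024a75183962026548731a92015a78430692124a75183962024a75183962027a58043692125a78430692125a78430692126548731a92015936281a47005936281a47003a58496207124a68153907205936281a47005936281a47009a76283405129a76283405125936281a47003a58496207121a68794235036849a57213027938a62145007938a62145004a68591307203a5849620712493a78162500493a781625005936281a47005936281a47003a58496207124a68153907205936281a47005936281a47009a76283405129a76283405125936281a47003a58496207126a5839240712683a29751402493a78162500493a781625006a7890243512384a925716024a79580316204a7958031620493a78162500493a781625009a76283405123a58496207124a69350817204a69350817207839a15624026a47839215014a69350817204a78590316207938a62145007938a62145007938450a16207938450a162058193a4672009628340a75127938450a16207938450a16207938450a16209628340a75127938450a16204a75183962025a4627893010562918a734005a79138620405a79138620401958473a26004a75183962021a78495623001a78495623007938450a16207938450a162058193a4672009628340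a75127938450a16207938450a16207938450a16209628340a75127938450a16204a751839620269173a5824017618392a540169584a13072069584a13072069350a84172049260a8357128736195a04218736195a04211a78495623001a78495623005936281a470058193a46720069584a13072069584a13072069350a8417205a4739618021962a78340512184a6739052079562a83041079562a83041068457a3910205846973a021068457a39102068457a3910206847a91352005918a67234004a78962531004a7896253100395a87062410395a87062410650789a243117628a9530140395a87062410395a870624107628a95301407628a9530140395a87062410650789a243113629784a0512184a673905209518462a37029518462a370258193a46720048357960a212783a54069212783a54069212493a78162500493a78162500481a59723603962a78340512493a78162500493a78162500962a78340512962a78340512962a78340512481a597236037938450a16207938450a16204a75183962029628340a75127938450a16207938450a16207938450a16209628340a75127938450a16204a75183962025a4627893010562918a734005a79138620405a79138620401958473a26004a75183962021a78495623001a78495623007938450a16207938450a16204a75183962029628340a75127938450a16207938450a16207938450a16209628340a75127938450a16204a751839620269173a5824017618392a540169584a13072069584a13072069350a84172049260a8357128736195a04218736195a04211a78495623001a78495623005936281a47004a751839620269584a13072069584a13072069350a8417205a4739618021962a783405126843097a152279562a83041079562a8304107a58491623026928357a14027a58491623027a584916230218492a673500683a2791540118492a67350018492a673500962a78340512962a7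8340512481a59723603962a78340512962a78340512962a78340512962a78340512962a78340512962a78340512481a5972360358497a60231076298a314500784a9531062058497a6023107629a8413500584a967213027629a84135007629a84135007629a84135007629a8413500962a7834051248196a572300692a57830411692a5783041147295a680310692a7845130247295a68031047295a68031047295a68031047295a680310962a78340512962a78340512481a59723603962a78340512962a78340512962a78340512962a78340512962a78340512962a78340512481a597236036739482a05119628347a05129628340a75129628340a751267382a059413694a25807311783a54069212783a540692124a69350817204a69350817203a5849620712962a783405124a69350817204a6935081720962a78340512962a783405121a78495623003a5849620712672a893415005a4698702311784a9531062038469a701522672a893415005a46987023117629a84135007629a8413500672a85049130672a85049130962a78340512762a598301403a584962071248195a720630692a78451302530a69872140493a78162500493a781625006739482a05116739482a0511395a87062410395a87062410650789a243117628a9530140395a87062410395a870624107628a95301407628a9530140395a87062410650789a243117a584916230259167a28430069173a58240169173a5824017a29135806405a48913706204a68153907204a68153907207a29350846107a29350846107839a15624027a29350846107a29350846107a29350846107a29350846107a29350846105a39162847024a56920837126a39280475124a18590367206a39280475126a3928047512691a278453006917a28453003a08469275123a0846927512491a67285300491a672853006928a1473500491a67285300491a67285300491a67285300491a67285300491a6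72853005a39162847026928a14735004a69350817204a69350817203a58496207129a76283405124a69350817204a69350817209a76283405129a76283405121a78495623003a58496207121a68794235036849a57213027938a62145007938a62145004a68591307203a5849620712493a78162500493a781625004a69350817204a69350817203a58496207129a76283405124a69350817204a69350817209a76283405129a76283405121a78495623003a58496207126a5839240712683a29751402493a78162500493a781625006a7890243512684a927513024a79580316204a7958031620493a78162500493a781625009a76283405123a58496207124a69350817204a69350817207839a15624026a47839215014a69350817204a78590316207938a62145007938a6214500586a791024326a98573214017a8539041620586a791024325a78493206103a69784205125a78493206105a784932061079862a51430079862a5143007a89135406204a896351072078a69253140278a6925314025a78493206103a69784205127a98435106207a984351062058962a70143258962a7014325a98470136207a85390416205a98173046235a9817304623798a263145003a86925047125a83096147205a83096147207a89530146207a89530146205a86902347127a89530146207a89530146207a89530146207a89530146207a89530146207a89530146205a8690234712697a18423500697a184235004a89602357126a9834025712697a18423500697a184235006a98340257126a9834025712697a184235004a896023571269584a17032049685a1723006a79480315226a79480315226a792834051249685a17230019584a67032019584a67032019584a67032019584a670320793a26840510495a67810320695783a20411695783a204115a68439027104a57689103206a47398105216a47398105216a47398105216a47398105213a58460917223a5846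0917221a78495623001a7849562300495a176803204958a16703201a78495623001a78495623009a76283405129a76283405126a58731904216a58340917229a76283405129a76283405126a58340917226a58340917224a76092815326a58731904214a76092815324a76092815326a58731904216a58340917224a76092815324a76092815326a58340917226a58340917224a76092815326a58731904214a69350817204a69350817203a58496207129a76283405124a69350817204a69350817209a76283405129a76283405129a76283405123a58496207121a68794235036849a57213027938a62145007938a62145004a68591307203a5849620712493a78162500493a781625004a69350817204a69350817203a58496207129a76283405124a69350817204a69350817209a76283405129a76283405129a76283405123a58496207126a5839240712683a29751402493a78162500493a781625006a7890243512684a927513024a79580316204a7958031620493a78162500493a781625009a76283405123a58496207124a69350817204a69350817207839a15624026a47839215014a69350817204a78590316207938a62145007938a62145006739482a05117845390a26105936281a47005936281a4700584a176923007846a25903106927385a04116927385a04117938450a16207938450a16206a58731904217819350a26407938450a16207938450a16207819350a26407819350a26407938450a16206a587319042178361a05942158463a07921278361a05942178361a059421694a258073115a46718392019a54067183219a54067183214a75183962024a75183962025849a13672005a38470692124a75183962024a75183962027a58043692125a7843069212783a540692125849a13672007938450a16207938450a162069350a84172067382a4509117938450a16207938450a162069584a13072067382a45091169584a13072069350a8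4172078469a3215003849a671250078469a32150078469a32150049573a260810973458a20611692a78451302692a784513027938450a16207938450a162069350a84172067382a4509117938450a16207938450a162069584a13072067382a45091169584a13072069350a841720692a78451302495a27360810692a78451302692a78451302491a80375622384a925716021a69370528401a6937052840692a78451302692a7845130269584a1307209a58437016227938450a16207938450a1620693a841507206a478392150149576a23081038496a271500672a89341500672a8934150058a9461207315a68973012417a853904162067895a032411596a384207125a6789410321596a38420712596a384207125a97368401215a973684012159a834710622678a94530211589672310a40389a72510640596a384207125a67894103217a98435106207a984351062049873a62150349873a62150379861a0235416a87590143207a86293145007a862931450067a9248150315a86927340125a89367142005a893671420078a93621450078a9362145005a98713426017a895301462078a93621450078a9362145007a89530146207a895301462078a9362145005a987134260158970621a34058970621a34057986103a423679a4501823158970621a34058970621a340679a45018231679a4501823158970621a34057986103a42369584a13072048679a25031349576a230810693a78140522783a2915064048796a35120269584a13072069584a13072079562a83041079562a8304109a5843701622597864a31022496580a217335a7860921432475a38910620495768a310229a58437016229a584370162268492a71053268492a71053269584a1307204a683907251069584a13072069584a1307205a7913862040564a827903115647389a02115647389a021169584a13072069584a130720693a841507209a784305162269584a13072069584a1307209a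78430516229a784305162269584a130720693a841507204839562a07104839562a07106a5873190421485a762903104839562a07104839562a0710485a76290310485a762903104839562a07106a587319042179a84625013079a84625013059a84672013046983a57102279a84625013079a84625013046983a57102246983a57102246983a571022578609a4213159a6782130415a869732041069a87501324169a87501324147986a15032358a936720140687a49250311687a4925031179a84625013079a84625013059a84672013046983a57102279a84625013079a84625013046983a57102246983a57102246983a571022578609a42131687a49250311479a08651233687a49250311687a49250311396a81475202496a8357120268a95703241068a957032410687a49250311687a4925031146983a57102259a84672013079a84625013079a84625013038a7905621405a968073124147986a15032347986a15032369a87501324169a875013241a94738260513a64907183521673a59482011673a594820119a16580724338672590a341085076a29341085076a29341087361a59402187361a594021a680173925439a650738241387361a59402187361a5940219a65073824139a650738241387361a594021a68017392543973a256804138759036a2140962a47380510962a473805108953706a24108962705a14329846723a05109846723a05108953076a24108953076a24108962057a14328953076a24108953076a24108953076a24108953076a24108953076a24109736185a04218962057a14329a75062843109a75062843107a5681094233781a560942339a75062843109a7506284310781a56094233781a56094233781a560942337a56810942338976210a54328795320a64108976210a54328976210a5432a759230816407a56810942339a75062843109a75062843109a75062843109a75062843107a5681094233781a560942339a7506284310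9a7506284310781a56094233781a56094233781a560942337a56810942338a59460731238a07632954109a75062843109a75062843108a91465730239a70632845109a7506284310a957032816409a75062843109a7506284310781a560942337a56810942339a75062843109a7506284310a87236194503a791620845329a75062843108759032a64108976210a54328976210a543289473a265103876a29135400872a69135400872a691354008a1769235400a6923804751298453a07612098453a07612098430a17652098430a17652089620a3754128a672913540098430a17652098430a1765208a67291354008a672913540098430a17652089620a375412981a46725300897a15624302a62834907512a62834907512a83460927512678392a45101673892a45101673892a451018a57196243028a5719624302a792358064138a57196243028a57196243028a57196243028a57196243028a57196243028a5719624302a79235806413a93508176420a93508176420a84692157300984a67253100a93508176420a93508176420981a26475300984a67253100984a672531009628a4175300a96842057312a96842057312a96842057312a96842057312897a251643029678a42531009a68472531009a6847253100a93508176420a93508176420a84692157300984a67253100a93508176420a93508176420981a26475300984a67253100a829173654039628a41753009a2816475300a918350764209a68472531009a68472531008a91257634028a92571634028a79152643028a79152643029a68472531009a6847253100981a26475300a84692157300a93508176420a9350817642089a275163402a87391265401a93508176420897a15264302a96842057312a968420573129a75062843109a75062843109a3846720150862a395701409a75062843109a75062843108a67290534108a7629530410862a39570140a84716902532a8469702135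29845a6702130962a87041350962a8704135086095a2713428a3756920410862a39570140862a395701409a75062843109a75062843109a3846720150862a395701409a75062843109a75062843108a67290534108a7629530410862a39570140a84716902532862a39570140862a39570140862a39570140862a395701408a6970253410895a70632410a62849031752a62849031752862a39570140862a3957014086290a5713429a38467201508a79350621408a79350621408a59620714328a57609213428a7935062140a81759032460962a87041350962a87041350a9760813254386957a120342a97608132543a97608132543859a36702140867a9352014089a50763214089a507632140896a75120432896a75120432a79680123453896a75120432896a75120432896a75120432896a75120432896a75120432896a75120432a7968012345396784a03215089567a2304108a76295304108a76295304108a69537024108a57609213429a38467201509a38467201508a79350621408a79350621408a36925701408a79350621408a79350621408a79350621408a79350621408a79350621408a79350621408a59620714329a75062843109a7506284310a60847912352862a395701409a75062843109a75062843108a672905341089062a571432862a39570140a84716902532a846970213529845a6702130962a87041350962a8704135086095a2713428a3756920410862a39570140862a395701409a75062843109a7506284310a60847912352862a395701409a75062843109a75062843108a672905341089062a571432862a39570140a84716902532862a39570140862a39570140862a39570140862a395701408a6970253410895a70632410a62849031752a62849031752862a39570140862a3957014086290a571342891a576024328a79350621408a79350621408a59620714328a57609213428a7935062140a81759032460962a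87041350962a870413508a760925134289567a2304108a76092513428a7609251342892a673504108a3692570140892a67350410892a673504108a79350621408a79350621408a59620714328a79350621408a79350621408a79350621408a79350621408a79350621408a79350621408a5962071432897a602534108a6970251342897a60253410897a60253410a987214503609a78623501438a96012574328a9601257432897a62530410897a625304108a79350621408a69532704108a79620514328a79620514328a79350621408a57690321408a79350621408a7935062140a95847032610a958470326108a79350621408a79350621408a59620714328a79350621408a79350621408a79350621408a79350621408a79350621408a79350621408a59620714328a672905341089567a23041089062a57143289062a571432891a576024328a5760921342a60847912352a608479123529a75062843109a75062843109a65801723438a79350621409a75062843109a75062843108a79350621408a7935062140a628451907327a5681094233a69842170532a7968301245398a674250130869a72150342a69832140752a78691420532a69842170532a69842170532a68730921543a68730921543895a27160432897a651204329a65801723438a697025341087693a250410a846970213529a75062843109a750628431098762a03415098762a034150896a75120432896a75120432a79680123453896a75120432896a75120432896a75120432896a75120432896a75120432a97608132543a796801234539738261a05437539081a46209507382a16439507382a16436915380a472076925a1834027843590a16207843590a16205936281a47005936281a47007960284a35127953084a16205936281a47005936281a47007953084a16207953084a16205936281a47007960284a3512584a176923006938047a15229628347a05129628347a05126843905a1722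6783924a05118736914a05218736914a05216843097a15226843097a15226a81473905206843097a15226843097a15226843097a15226843097a15226843097a15228736195a04216a81473905207938450a16207938450a16207845901a36209628340a75127938450a16207938450a16209628340a75129628340a75127938450a16206738912a45016897312a45036895310a47206897312a45036897312a4503697a251843027538910a46207938450a16207938450a16207938450a16207938450a16207845901a36209628340a75127938450a16207938450a16209628340a75129628340a75127938450a16206738912a45017938450a16206a29571843027938450a16207938450a16206a91275834026981530a47206a79152834026a79152834027938450a16207938450a16209628340a75127845901a36207938450a16207938450a16206891530a47206973821a45037648092a3512697a152834026897312a45036897312a450367382a059413657a1834902265184a37902265184a3790226a357814902276914a05823189265a04713189265a04713198451a37602298451a3760226a841953702068340a57912298451a37602298451a37602268340a57912268340a57912298451a3760226a8419537020694a258073116a5904827311694a25807311694a258073116a05947382135783a29461015a46718392015a46718392019a54067183219a54067183217a94256081319a54067183219a54067183219a54067183219a54067183219a5406718321593a478261037a94256081314a75183962024a7518396202684a931570205a38470692124a75183962024a75183962027a58043692125a7843069212783a54069212684a9315702059a84236701269a5420873116a89314570206a89314570205a78430692126578a3149022783a54069212783a540692124a75183962024a7518396202684a931570205a38470692124a7518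3962024a75183962027a5804369212792a54068131783a54069212684a93157020783a540692125a3847069212783a54069212783a5406921278a0543692129a8375146022895a04267131895a04267131783a54069212783a540692127a5804369212684a931570204a75183962024a751839620296a14507832168a4931570204a7518396202765a041982316a89314570206a89314570207938450a16207938450a162069350a841720962a783405127938450a16207938450a162069584a130720962a7834051269584a13072069350a84172078469a321500784a953106207629a84135007629a8413500962a78340512973458a20611962a78340512962a783405127938450a16207938450a162069350a841720962a783405127938450a16207938450a162069584a130720962a7834051269584a13072069350a841720684a37051922984a07531622684a37051922684a370519226718a3540922973a61450821684a37051922684a37051922692a78451302692a7845130269584a1307209a58437016227938450a16207938450a1620693a841507206a4783921501684a3705192238496a2715007629a84135007629a841350076a8491235007a853904162076a93842150076a93842150065a834710922769a834205127a98435106207a984351062078a93621450078a9362145005a98713426017a895301462078a93621450078a9362145007a89530146207a895301462078a9362145005a987134260169584a13072097584a03162269584a13072069584a1307209a5843701622753981a406209a58437016229a584370162269584a13072069584a130720693a841507209a784305162269584a13072069584a1307209a78430516229a784305162269584a130720693a841507207938450a16207938450a162069350a841720962a783405127938450a16207938450a162069584a130720962a7834051269584a13072069350a84172078469a321500784a9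53106207629a84135007629a8413500962a78340512973458a20611962a78340512962a783405127938450a16207938450a162069350a841720962a783405127938450a16207938450a162069584a130720962a7834051269584a13072069350a841720684a37051922984a07531622684a37051922684a370519226718a3540922973a61450821684a37051922684a37051922692a78451302692a7845130269584a1307209a58437016227938450a16207938450a1620693a841507206a4783921501684a3705192238496a2715007629a84135007629a841350069584a13072098057a14362269584a13072069584a1307209a18347506229a27835406119a18473506229a184735062269584a13072069584a130720693a841507209a784305162269584a13072069584a1307209a78430516229a784305162269584a130720693a84150720987a50143622698a51430720987a50143622987a5014362279a8413506207a965124083179a84135062079a841350620987a51430622987a514306229a7843051622683a570419227958a40316207958a40316209a7843051622683a570419229a78430516229a784305162258762a04391258762a04391269584a13072069584a130720693a841507209a784305162269584a13072069584a1307209a78430516229a784305162269584a130720693a84150720962a7834051238496a2715006a75180439226a75180439229a5843701622693580a4172069350a84172069350a8417207938450a16207938450a16205739a4281601684a370519227938450a16207938450a1620684a37051922684a370519227938450a16205739a4281601798a3146250059a7841326016895310a47207a8934051620769a413508236985a14037205a87034629125a87034629125a86249137005a8624913700684a370519226a59830147206758a31409226758a3140922684a37051922694785032a117938450a16207938450a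16206a75180439226a751804392278a93621450078a9362145005a98713426017a895301462078a93621450078a9362145007a89530146207a895301462078a9362145005a9871342601

set_option maxHeartbeats 0 in
theorem cover_coverCode : cover tables 12 [] coverCode (fun _ => true) = true := by
  decide +kernel

theorem not_sortable_eleven : ¬ Sortable 7 (Set.univ : Set (Fin 11 → Bool)) := by
  intro h
  obtain ⟨m, hm, h⟩ := h.pairSorted
  exact (excluded_of_cover not_sortable_tables _ _ _ _ cover_coverCode).1 m hm
    (fun p hp => absurd hp List.not_mem_nil) h

theorem not_sortable_twelve : ¬ Sortable 7 (Set.univ : Set (Fin 12 → Bool)) :=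
  fun h => not_sortable_eleven (Sortable.of_image_snoc (h.mono (Set.subset_univ _)))

theorem IsSortingNet.sortable {n : ℕ} {C : Net n} (h : IsSortingNet C) :
    Sortable C.length (Set.univ : Set (Fin n → Bool)) :=
  sortable_of_bSorted_run h.1 fun x _ => h.2 x

end LowerBound

/-- For n ∈ {11, 12} there is a sorting network on n channels of
depth 8 and none of depth 7, i.e. T(11) = T(12) = 8. -/
theorem optimal_depth_11_12 :
    ((∃ C : Net 11, C.length = 8 ∧ IsSortingNet C) ∧
      ¬ ∃ C : Net 11, C.length = 7 ∧ IsSortingNet C) ∧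
    ((∃ C : Net 12, C.length = 8 ∧ IsSortingNet C) ∧
      ¬ ∃ C : Net 12, C.length = 7 ∧ IsSortingNet C) := by
  refine ⟨⟨exists_sortingNet_eleven, ?_⟩, exists_sortingNet_twelve, ?_⟩
  · rintro ⟨C, hC, h⟩
    exact not_sortable_eleven (hC ▸ h.sortable)
  · rintro ⟨C, hC, h⟩
    exact not_sortable_twelve (hC ▸ h.sortable)

end SN
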